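/- A periodic orientation-reversing homeomorphism of the 2-sphere with at least one fixed point has fixed point set homeomorphic to an embedded circle. -/

import Mathlib

/-- The 2-sphere, as the unit sphere in Euclidean 3-space. -/
noncomputable abbrev Sphere2 : Set (EuclideanSpace ℝ (Fin 3)) :=
  Metric.sphere (0 : EuclideanSpace ℝ (Fin 3)) 1

/-- The circle, as the unit sphere in Euclidean 2-space. -/
noncomputable abbrev Circle1 : Set (EuclideanSpace ℝ (Fin 2)) :=
  Metric.sphere (0 : EuclideanSpace ℝ (Fin 2)) 1

/-- The antipodal map of the sphere, as a continuous map. -/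
noncomputable def antipodalMap : C(Sphere2, Sphere2) :=
  ⟨fun x => -x, continuous_neg⟩

/-- A homeomorphism of the sphere is orientation reversing if (as a continuous map)
it is homotopic to the antipodal map, which has degree `−1` on `S²`. -/
def OrientReversing (F : Sphere2 ≃ₜ Sphere2) : Prop :=
  (F : C(Sphere2, Sphere2)).Homotopic antipodalMap

section

namespace KK
open Complex Set Metric Filter Topology

/-- `u` has a continuous logarithm on `S`. -/
def LogOn (u : ℂ → ℂ) (S : Set ℂ) : Prop :=
  ∃ a : ℂ → ℂ, ContinuousOn a S ∧ ∀ y ∈ S, u y = exp (a y)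

theorem LogOn.mono {u S T} (h : LogOn u S) (hT : T ⊆ S) : LogOn u T := by
  obtain ⟨a, ha, h⟩ := h
  exact ⟨a, ha.mono hT, fun y hy => h y (hT hy)⟩

theorem LogOn.congr {u w S} (h : LogOn u S) (hw : ∀ y ∈ S, w y = u y) : LogOn w S := by
  obtain ⟨a, ha, h⟩ := h
  exact ⟨a, ha, fun y hy => (hw y hy).trans (h y hy)⟩

theorem LogOn.mul {u w S} (h : LogOn u S) (h' : LogOn w S) : LogOn (fun y => u y * w y) S := by
  obtain ⟨a, ha, h⟩ := h
  obtain ⟨b, hb, h'⟩ := h'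
  exact ⟨fun y => a y + b y, ha.add hb, fun y hy => by simp only [h y hy, h' y hy, exp_add]⟩

theorem LogOn.inv {u S} (h : LogOn u S) : LogOn (fun y => (u y)⁻¹) S := by
  obtain ⟨a, ha, h⟩ := h
  exact ⟨fun y => - a y, ha.neg, fun y hy => by simp only [h y hy, exp_neg]⟩

theorem LogOn.div {u w S} (h : LogOn u S) (h' : LogOn w S) : LogOn (fun y => u y / w y) S :=
  (h.mul h'.inv).congr fun _ _ => div_eq_mul_inv _ _

theorem LogOn.zpow {u S} (h : LogOn u S) (m : ℤ) : LogOn (fun y => (u y) ^ m) S := by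
  obtain ⟨a, ha, h⟩ := h
  exact ⟨fun y => m * a y, continuousOn_const.mul ha, fun y hy => by simp only [h y hy, exp_int_mul]⟩

theorem LogOn.conj {u S} (h : LogOn u S) : LogOn (fun y => (starRingEnd ℂ) (u y)) S := by
  obtain ⟨a, ha, h⟩ := h
  exact ⟨fun y => (starRingEnd ℂ) (a y), continuous_conj.comp_continuousOn ha,
    fun y hy => by simp only [h y hy, exp_conj]⟩

theorem LogOn.comp {u S T} (h : LogOn u S) {φ : ℂ → ℂ} (hφ : ContinuousOn φ T)
    (hm : MapsTo φ T S) : LogOn (fun y => u (φ y)) T := by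
  obtain ⟨a, ha, h⟩ := h
  exact ⟨fun y => a (φ y), ha.comp hφ hm, fun y hy => h _ (hm hy)⟩

theorem LogOn.ne_zero {u S} (h : LogOn u S) {y} (hy : y ∈ S) : u y ≠ 0 := by
  obtain ⟨a, ha, h⟩ := h
  rw [h y hy]; exact exp_ne_zero _

theorem logOn_const {c : ℂ} (hc : c ≠ 0) (S) : LogOn (fun _ => c) S :=
  ⟨fun _ => log c, continuousOn_const, fun _ _ => (exp_log hc).symm⟩

/-- a function within distance `< 1` of `1` has a log. -/
theorem logOn_of_near_one {u : ℂ → ℂ} {S} (hu : ContinuousOn u S) (h : ∀ y ∈ S, ‖u y - 1‖ < 1) :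
    LogOn u S := by
  have hs : ∀ y ∈ S, u y ∈ slitPlane := fun y hy => by
    have := mem_slitPlane_of_norm_lt_one (h y hy)
    simpa using this
  exact ⟨fun y => log (u y), hu.clog hs, fun y hy => (exp_log (slitPlane_ne_zero (hs y hy))).symm⟩

/-- S0 -/
theorem logOn_univ {u : ℂ → ℂ} (hu : Continuous u) (h : ∀ y, u y ≠ 0) : LogOn u univ := by
  have hsc : IsSimplyConnected (univ : Set ℂ) := by
    have := (convex_univ (𝕜 := ℝ) (E := ℂ)).contractibleSpace ⟨0, trivial⟩
    unfold IsSimplyConnected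
    infer_instance
  obtain ⟨f, hf, he⟩ := exists_continuousOn_eqOn_exp_comp hsc isOpen_univ hu.continuousOn
    (by rintro ⟨y, -, hy⟩; exact h y hy)
  exact ⟨f, hf, fun y hy => (he hy).symm⟩

/-- integer-valued (times 2πi) continuous functions on preconnected sets are constant -/
theorem const_of_exp_eq_one {X : Type*} [TopologicalSpace X] {S : Set X} (hS : IsPreconnected S)
    {c : X → ℂ} (hc : ContinuousOn c S) (h : ∀ y ∈ S, exp (c y) = 1) {x y} (hx : x ∈ S)
    (hy : y ∈ S) : c x = c y := by
  set D : Set ℂ := (AddSubgroup.zmultiples (2 * Real.pi * I) : Set ℂ)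
  have hD : DiscreteTopology D := 
    NormedSpace.discreteTopology_zmultiples _
  have hm : MapsTo c S D := fun y hy => by
    obtain ⟨n, hn⟩ := exp_eq_one_iff.1 (h y hy)
    exact AddSubgroup.mem_zmultiples_iff.2 ⟨n, by rw [hn]; simp⟩
  exact hS.constant_of_mapsTo ⟨hD⟩ hc hm hx hy

theorem exp_isQuot : IsQuotientMap (fun z : ℂ ↦ (⟨_, z.exp_ne_zero⟩ : {z : ℂ // z ≠ 0})) := by
  refine IsOpenMap.isQuotientMap ?_ (by fun_prop) fun z ↦ ⟨_, Subtype.ext (exp_log z.2)⟩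
  exact (IsOpen.isOpenEmbedding_subtypeVal isClosed_singleton.1).isOpenMap_iff.mpr isOpenMap_exp

/-- S1 -/
theorem exists_index {u : ℂ → ℂ} (hu : ContinuousOn u {0}ᶜ) (h : ∀ y ≠ 0, u y ≠ 0) :
    ∃ m : ℤ, LogOn (fun y => u y / y ^ m) {0}ᶜ := by
  have hc : Continuous (fun w => u (exp w)) := by
    rw [← continuousOn_univ]
    exact hu.comp continuous_exp.continuousOn (fun w _ => exp_ne_zero w)
  obtain ⟨Lg, hL, hLe⟩ := logOn_univ hc (fun w => h _ (exp_ne_zero w))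
  rw [continuousOn_univ] at hL
  have hper : ∀ w, exp (Lg (w + 2 * Real.pi * I) - Lg w) = 1 := fun w => by
    rw [exp_sub, ← hLe _ trivial, ← hLe _ trivial]
    simp only [exp_periodic w]
    exact div_self (h _ (exp_ne_zero w))
  obtain ⟨m, hm⟩ := exp_eq_one_iff.1 (hper 0)
  have hconst : ∀ w, Lg (w + 2 * Real.pi * I) - Lg w = m * (2 * Real.pi * I) := fun w => by
    rw [← hm]
    exact const_of_exp_eq_one (S := univ) isPreconnected_univ
      (c := fun w => Lg (w + 2 * Real.pi * I) - Lg w) (by fun_prop) (fun y _ => hper y)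
      trivial trivial
  have hconst' : ∀ w (n : ℤ), Lg (w + n * (2 * Real.pi * I)) - Lg w = n * (m * (2 * Real.pi * I)) := by
    intro w n
    induction n using Int.induction_on with
    | zero => simp
    | succ k ih =>
      have := hconst (w + k * (2 * Real.pi * I))
      push_cast at ih ⊢
      have e : w + (k + 1) * (2 * Real.pi * I) = w + k * (2 * Real.pi * I) + 2 * Real.pi * I := by ring
      rw [e]
      linear_combination this + ih
    | pred k ih =>
      have := hconst (w + (-k - 1) * (2 * Real.pi * I))
      push_cast at ih ⊢
      have e : w + (-k) * (2 * Real.pi * I) = w + (-k - 1) * (2 * Real.pi * I) + 2 * Real.pi * I := by ring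
      rw [e] at ih
      linear_combination ih - this
  let A : {z : ℂ // z ≠ 0} → ℂ := fun z => Lg (log z) - m * log z
  have hA : ∀ w : ℂ, A ⟨exp w, exp_ne_zero w⟩ = Lg w - m * w := fun w => by
    obtain ⟨n, hn⟩ := exp_eq_exp_iff_exists_int.1 (exp_log (exp_ne_zero w))
    have := hconst' w n
    simp only [A]
    rw [hn]
    linear_combination this
  have hAc : Continuous A := by
    rw [exp_isQuot.continuous_iff]
    have : A ∘ (fun z : ℂ ↦ (⟨_, z.exp_ne_zero⟩ : {z : ℂ // z ≠ 0})) = fun w => Lg w - m * w :=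
      funext hA
    rw [this]; fun_prop
  refine ⟨m, fun y => Lg (log y) - m * log y, ?_, ?_⟩
  · rw [continuousOn_iff_continuous_domRestrict]
    exact hAc
  · intro y hy
    have hy : y ≠ 0 := hy
    have := hLe (log y) trivial
    simp only [exp_log hy] at this
    rw [exp_sub, ← this, exp_int_mul, exp_log hy]

/-- S2 -/
theorem index_unique {m : ℤ} {r : ℝ} (hr : 0 < r) (h : LogOn (fun y => y ^ m) (sphere 0 r)) :
    m = 0 := by
  obtain ⟨a, ha, h⟩ := h
  have hmem : ∀ t : ℝ, (r : ℂ) * exp (t * I) ∈ sphere (0 : ℂ) r := fun t => by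
    simp [abs_of_pos hr]
  let c : ℝ → ℂ := fun t => a (r * exp (t * I)) - m * (Real.log r + t * I)
  have hc : Continuous c := by
    have : Continuous fun t : ℝ => a (r * exp (t * I)) := by
      rw [← continuousOn_univ]
      exact ha.comp (by fun_prop) (fun t _ => hmem t)
    exact this.sub (by fun_prop)
  have h1 : ∀ t, exp (c t) = 1 := fun t => by
    have hr' : (r : ℂ) ≠ 0 := by exact_mod_cast hr.ne'
    simp only [c]
    rw [exp_sub, ← h _ (hmem t), exp_int_mul, exp_add, ← ofReal_exp, Real.exp_log hr]
    exact div_self (zpow_ne_zero _ (mul_ne_zero hr' (exp_ne_zero _)))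
  have := const_of_exp_eq_one (S := univ) isPreconnected_univ hc.continuousOn (fun y _ => h1 y)
    (x := 0) (y := 2 * Real.pi) trivial trivial
  simp only [c] at this
  have e : exp (((2 * Real.pi : ℝ) : ℂ) * I) = 1 := by
    push_cast; exact exp_two_pi_mul_I
  rw [e] at this
  simp at this
  have hp : (Real.pi : ℂ) ≠ 0 := by exact_mod_cast Real.pi_ne_zero
  simpa [hp] using this

end KK

end

section

namespace KK
open Complex Set Metric Filter Topology

theorem tietze {Y : Set ℂ} (hY : IsClosed Y) {v : ℂ → ℂ} (hv : ContinuousOn v Y) :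
    ∃ w : ℂ → ℂ, Continuous w ∧ EqOn w v Y := by
  obtain ⟨g, hg⟩ := ContinuousMap.exists_restrict_eq hY
    (⟨Y.domRestrict v, continuousOn_iff_continuous_domRestrict.1 hv⟩ : C(Y, ℂ))
  exact ⟨g, g.continuous, fun y hy => congrArg (fun f : C(Y, ℂ) => f ⟨y, hy⟩) hg⟩

theorem glue {A B : Set ℂ} (hA : IsClosed A) (hB : IsClosed B) {u w : ℂ → ℂ}
    (hu : ContinuousOn u A) (hw : ContinuousOn w B) (h : ∀ y ∈ A, y ∈ B → u y = w y) :
    ∃ v : ℂ → ℂ, Continuous v ∧ EqOn v u A ∧ EqOn v w B := by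
  classical
  let v0 : ℂ → ℂ := fun y => if y ∈ A then u y else w y
  have h1 : EqOn v0 u A := fun y hy => if_pos hy
  have h2 : EqOn v0 w B := fun y hy => by
    by_cases hyA : y ∈ A
    · simp only [v0, hyA, if_true]; exact h y hyA hy
    · simp only [v0, hyA, if_false]
  obtain ⟨v, hv, hve⟩ := tietze (hA.union hB)
    ((hu.congr h1).union_of_isClosed (hw.congr h2) hA hB)
  exact ⟨v, hv, fun y hy => (hve (Or.inl hy)).trans (h1 hy),
    fun y hy => (hve (Or.inr hy)).trans (h2 hy)⟩

def Far (R : ℝ) : Set ℂ := {y | R ≤ ‖y‖}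

theorem far_mono {R R' : ℝ} (h : R ≤ R') : Far R' ⊆ Far R := fun _ hy => le_trans h hy

theorem isClosed_far (R) : IsClosed (Far R) := isClosed_le continuous_const continuous_norm

theorem far_ne {R : ℝ} (hR : 0 < R) {y} (hy : y ∈ Far R) : y ≠ 0 := by
  rintro rfl
  simp [Far] at hy; linarith

theorem isPreconnected_compl_zero : IsPreconnected ({0}ᶜ : Set ℂ) :=
  (isConnected_compl_singleton_of_one_lt_rank (by simp) 0).isPreconnected

theorem isPreconnected_far {R : ℝ} (hR : 0 < R) : IsPreconnected (Far R) := by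
  have : Far R = (fun y : ℂ => ((max 1 (R / ‖y‖) : ℝ) : ℂ) * y) '' {0}ᶜ := by
    ext y
    constructor
    · intro hy
      have h0 := far_ne hR hy
      refine ⟨y, h0, ?_⟩
      have : R / ‖y‖ ≤ 1 := (div_le_one (norm_pos_iff.2 h0)).2 hy
      simp [max_eq_left this]
    · rintro ⟨x, hx, rfl⟩
      have hx : x ≠ 0 := hx
      have hp := norm_pos_iff.2 hx
      simp only [Far, mem_ofPred_eq, norm_mul, norm_real, Real.norm_eq_abs]
      have h1 : R / ‖x‖ ≤ |max 1 (R / ‖x‖)| := (le_max_right _ _).trans (le_abs_self _)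
      calc R = R / ‖x‖ * ‖x‖ := by field_simp
        _ ≤ _ := by gcongr
  rw [this]
  refine isPreconnected_compl_zero.image _ ?_
  refine ContinuousOn.mul (continuous_ofReal.comp_continuousOn ?_) continuousOn_id
  refine ContinuousOn.sup continuousOn_const (continuousOn_const.div continuous_norm.continuousOn ?_)
  intro x hx; exact norm_ne_zero_iff.2 hx

theorem logOn_pos {φ : ℂ → ℝ} {S} (hφ : ContinuousOn φ S) (h : ∀ y ∈ S, 0 < φ y) :
    LogOn (fun y => (φ y : ℂ)) S :=
  ⟨fun y => (Real.log (φ y) : ℂ), continuous_ofReal.comp_continuousOn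
    (hφ.log fun y hy => (h y hy).ne'), fun y hy => by
      rw [← ofReal_exp, Real.exp_log (h y hy)]⟩

theorem logOn_sub {z c : ℂ} : LogOn (fun y => y - c) (ball z ‖z - c‖) := by
  by_cases hz : z - c = 0
  · rw [hz]; simp; exact ⟨fun _ => 0, continuousOn_const, fun y hy => hy.elim⟩
  have h1 : LogOn (fun y => (y - c) / (z - c)) (ball z ‖z - c‖) := by
    refine logOn_of_near_one (by fun_prop) fun y hy => ?_
    have : (y - c) / (z - c) - 1 = (y - z) / (z - c) := by field_simp; ring
    rw [this, norm_div, div_lt_one (norm_pos_iff.2 hz)]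
    simpa [dist_eq_norm] using hy
  exact (h1.mul (logOn_const hz _)).congr fun y _ => by field_simp

theorem logOn_far_sub (c : ℂ) : LogOn (fun y => (y - c) / y) (Far (‖c‖ + 1)) := by
  have h0 : ∀ y ∈ Far (‖c‖ + 1), y ≠ 0 := fun y hy => far_ne (by positivity) hy
  refine logOn_of_near_one ((by fun_prop : ContinuousOn (fun y => y - c) _).div continuousOn_id h0)
    fun y hy => ?_
  have hy0 := h0 y hy
  have : (y - c) / y - 1 = - c / y := by field_simp; ring
  rw [this, norm_div, div_lt_one (norm_pos_iff.2 hy0), norm_neg]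
  have : ‖c‖ + 1 ≤ ‖y‖ := hy
  linarith

theorem far_unique {v : ℂ → ℂ} {m m' : ℤ} {R R' : ℝ} (h : LogOn (fun y => v y / y ^ m) (Far R))
    (h' : LogOn (fun y => v y / y ^ m') (Far R')) : m = m' := by
  set r := max (max R R') 1 with hr
  have hr0 : 0 < r := lt_of_lt_of_le one_pos (le_max_right _ _)
  have hs : ∀ y ∈ sphere (0 : ℂ) r, ‖y‖ = r := fun y hy => by simpa using hy
  have s1 : sphere (0 : ℂ) r ⊆ Far R := fun y hy => by
    simp only [Far, mem_ofPred_eq, hs y hy, hr]; exact (le_max_left _ _).trans (le_max_left _ _)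
  have s2 : sphere (0 : ℂ) r ⊆ Far R' := fun y hy => by
    simp only [Far, mem_ofPred_eq, hs y hy, hr]; exact (le_max_right _ _).trans (le_max_left _ _)
  have := (h'.mono s2).div (h.mono s1)
  have key : LogOn (fun y => y ^ (m - m')) (sphere 0 r) := by
    refine this.congr fun y hy => ?_
    have hy0 : y ≠ 0 := by rw [← norm_pos_iff, hs y hy]; exact hr0
    have hv : v y ≠ 0 := fun h0 => (h.mono s1).ne_zero hy (by simp [h0])
    rw [zpow_sub₀ hy0]
    field_simp
  have := index_unique hr0 key
  omega

theorem local_unique {v : ℂ → ℂ} {z : ℂ} {m m' : ℤ} {r r' : ℝ} (hr : 0 < r) (hr' : 0 < r')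
    (h : LogOn (fun y => v y / (y - z) ^ m) (ball z r \ {z}))
    (h' : LogOn (fun y => v y / (y - z) ^ m') (ball z r' \ {z})) : m = m' := by
  set ρ := min r r' / 2 with hρ
  have hρ0 : 0 < ρ := by positivity
  have hl : ρ < r := by
    have := min_le_left r r'; have : 0 < min r r' := lt_min hr hr'; linarith
  have hl' : ρ < r' := by
    have := min_le_right r r'; have : 0 < min r r' := lt_min hr hr'; linarith
  have hn0 : ∀ y ∈ sphere (0 : ℂ) ρ, y ≠ 0 := fun y hy h0 => by
    simp [h0] at hy; linarith
  have hmap : ∀ s, ρ < s → MapsTo (fun y => z + y) (sphere (0 : ℂ) ρ) (ball z s \ {z}) :=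
    fun s hs y hy => ⟨by simpa [dist_eq_norm] using (by simpa using hy : ‖y‖ = ρ) ▸ hs,
      by simpa using hn0 y hy⟩
  have := (h'.comp (φ := fun y => z + y) (by fun_prop) (hmap _ hl')).div
    (h.comp (φ := fun y => z + y) (by fun_prop) (hmap _ hl))
  have key : LogOn (fun y => y ^ (m - m')) (sphere 0 ρ) := by
    refine this.congr fun y hy => ?_
    have hy0 : y ≠ 0 := hn0 y hy
    have hv : v (z + y) ≠ 0 := fun h0 => h.ne_zero (hmap _ hl hy) (by simp [h0])
    rw [zpow_sub₀ hy0]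
    simp only [add_sub_cancel_left]
    field_simp
  have := index_unique hρ0 key
  omega

theorem local_exists {v : ℂ → ℂ} {z : ℂ} {r : ℝ} (hr : 0 < r) (hv : Continuous v)
    (h : ∀ y ∈ ball z r, y ≠ z → v y ≠ 0) :
    ∃ m : ℤ, ∃ ρ > 0, LogOn (fun y => v y / (y - z) ^ m) (ball z ρ \ {z}) := by
  let φ : ℂ → ℂ := fun y => z + ((min 1 (r / 2 / ‖y‖) : ℝ) : ℂ) * y
  have hφc : ContinuousOn φ {0}ᶜ := by
    refine continuousOn_const.add
      (ContinuousOn.mul (continuous_ofReal.comp_continuousOn ?_) continuousOn_id)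
    refine ContinuousOn.inf continuousOn_const
      (continuousOn_const.div continuous_norm.continuousOn ?_)
    intro x hx; exact norm_ne_zero_iff.2 hx
  have hφ : ∀ y ≠ 0, φ y ∈ ball z r ∧ φ y ≠ z := fun y hy => by
    have hp := norm_pos_iff.2 hy
    have hm : 0 < min 1 (r / 2 / ‖y‖) := by positivity
    constructor
    · simp only [φ, mem_ball, dist_eq_norm, add_sub_cancel_left, norm_mul, norm_real,
        Real.norm_eq_abs, abs_of_pos hm]
      calc min 1 (r / 2 / ‖y‖) * ‖y‖ ≤ r / 2 / ‖y‖ * ‖y‖ := by gcongr; exact min_le_right _ _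
        _ = r / 2 := by field_simp
        _ < r := by linarith
    · simp only [φ, ne_eq, add_eq_left, mul_eq_zero, hy, or_false]
      exact_mod_cast hm.ne'
  obtain ⟨m, hm⟩ := exists_index (u := fun y => v (φ y)) (hv.comp_continuousOn hφc)
    (fun y hy => h _ (hφ y hy).1 (hφ y hy).2)
  refine ⟨m, r / 2, by positivity, ?_⟩
  have := hm.comp (φ := fun y => y - z) (T := ball z (r / 2) \ {z}) (by fun_prop)
    (fun y hy => by simpa [sub_eq_zero] using hy.2)
  refine this.congr fun y hy => ?_
  have : φ (y - z) = y := by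
    have hn : ‖y - z‖ < r / 2 := by simpa [dist_eq_norm] using hy.1
    have h0 : 0 < ‖y - z‖ := norm_pos_iff.2 (sub_ne_zero.2 hy.2)
    have : 1 ≤ r / 2 / ‖y - z‖ := (one_le_div h0).2 hn.le
    simp [φ, min_eq_left this]
  simp only [this]

theorem index_sum (m : ℂ → ℤ) (Z : Finset ℂ) : ∀ (v : ℂ → ℂ), Continuous v →
    (∀ y, v y = 0 → y ∈ Z) →
    (∀ z ∈ Z, ∃ r > 0, LogOn (fun y => v y / (y - z) ^ m z) (ball z r \ {z})) →
    ∃ R, LogOn (fun y => v y / y ^ (∑ z ∈ Z, m z)) (Far R) := by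
  induction Z using Finset.induction_on with
  | empty =>
    intro v hv h0 _
    exact ⟨0, ((logOn_univ hv fun y hy => by simpa using h0 y hy).mono (subset_univ _)).congr
      fun y _ => by simp⟩
  | insert c s hc ih =>
    intro v hv h0 hl
    obtain ⟨r, hr, hr'⟩ := hl c (Finset.mem_insert_self _ _)
    obtain ⟨ρ, hρ, hρr, hρs⟩ : ∃ ρ > 0, ρ < r ∧ ∀ y ∈ closedBall c ρ, y ∉ s := by
      have : (↑s : Set ℂ)ᶜ ∈ 𝓝 c := s.finite_toSet.isClosed.isOpen_compl.mem_nhds (by simpa using hc)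
      obtain ⟨e, he, hes⟩ := Metric.nhds_basis_closedBall.mem_iff.1 this
      refine ⟨min e (r / 2), by positivity, by have := min_le_right e (r/2); linarith,
        fun y hy => ?_⟩
      have := hes (closedBall_subset_closedBall (min_le_left _ _) hy)
      simpa using this
    have hss : sphere c ρ ⊆ ball c r \ {c} := fun y hy => by
      have hy : dist y c = ρ := hy
      refine ⟨by simpa [hy] using hρr, ?_⟩
      rintro rfl
      simp at hy; linarith
    obtain ⟨a, ha, hae⟩ := hr'.mono hss
    obtain ⟨b, hb, hbe⟩ := tietze isClosed_sphere ha
    obtain ⟨w, hw, hw1, hw2⟩ := glue (A := closedBall c ρ) (B := (ball c ρ)ᶜ)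
      (u := fun y => exp (b y)) (w := fun y => v y / (y - c) ^ m c)
      isClosed_closedBall isOpen_ball.isClosed_compl (by fun_prop)
      (by
        refine hv.continuousOn.div ?_ ?_
        · refine ContinuousOn.zpow₀ (by fun_prop) _ fun y hy => Or.inl ?_
          rintro h; rw [sub_eq_zero] at h; subst h; simp at hy; linarith
        · intro y hy
          refine zpow_ne_zero _ ?_
          rintro h; rw [sub_eq_zero] at h; subst h; simp at hy; linarith)
      (by
        intro y hy hy'
        have : y ∈ sphere c ρ := le_antisymm hy (by simpa using hy')
        rw [hbe this, ← hae y this])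
    have hne : ∀ y, y ∉ ball c ρ → y ≠ c := by
      rintro y hy rfl; simp at hy; linarith
    obtain ⟨R, hR⟩ := ih w hw
      (by
        intro y hy
        by_cases hyb : y ∈ ball c ρ
        · rw [hw1 (ball_subset_closedBall hyb)] at hy
          exact absurd hy (exp_ne_zero _)
        · rw [hw2 hyb] at hy
          have hyc := sub_ne_zero.2 (hne y hyb)
          have : v y = 0 := by
            rcases div_eq_zero_iff.1 hy with h | h
            · exact h
            · exact absurd h (zpow_ne_zero _ hyc)
          rcases Finset.mem_insert.1 (h0 y this) with h | h
          · exact absurd h (hne y hyb)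
          · exact h)
      (by
        intro z hz
        obtain ⟨e, he, hle⟩ := hl z (Finset.mem_insert_of_mem hz)
        have hzc : ρ < dist z c := by
          by_contra hcon
          exact hρs z (not_lt.1 hcon) hz
        refine ⟨min e (dist z c - ρ), lt_min he (by linarith), ?_⟩
        have h1 := hle.mono (T := ball z (min e (dist z c - ρ)) \ {z})
          (sdiff_subset_sdiff_left (ball_subset_ball (min_le_left _ _)))
        have h2 := ((logOn_sub (z := z) (c := c)).zpow (m c)).mono
          (T := ball z (min e (dist z c - ρ)) \ {z})
          (sdiff_subset.trans (ball_subset_ball (by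
            rw [← dist_eq_norm]; exact (min_le_right _ _).trans (by linarith))))
        refine (h1.div h2).congr fun y hy => ?_
        have hyb : y ∈ (ball c ρ)ᶜ := by
          have : dist y z < dist z c - ρ := lt_of_lt_of_le hy.1 (min_le_right _ _)
          have t := dist_triangle z y c
          rw [dist_comm z y] at t
          simp only [mem_compl_iff, mem_ball, not_lt]; linarith
        rw [hw2 hyb]
        exact div_right_comm _ _ _)
    refine ⟨max (max R (‖c‖ + 1)) (‖c‖ + ρ), ?_⟩
    set Q := max (max R (‖c‖ + 1)) (‖c‖ + ρ) with hQ
    have q1 : R ≤ Q := (le_max_left _ _).trans (le_max_left _ _)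
    have q2 : ‖c‖ + 1 ≤ Q := (le_max_right _ _).trans (le_max_left _ _)
    have q3 : ‖c‖ + ρ ≤ Q := le_max_right _ _
    have h1 := hR.mono (far_mono q1)
    have h2 := ((logOn_far_sub c).zpow (m c)).mono (far_mono q2)
    refine (h1.mul h2).congr fun y hy => ?_
    have hy0 : y ≠ 0 := far_ne (by positivity) (far_mono q2 hy)
    have hyb : y ∈ (ball c ρ)ᶜ := by
      have hy' : Q ≤ ‖y‖ := hy
      have t := norm_sub_norm_le y c
      simp only [mem_compl_iff, mem_ball, not_lt, dist_eq_norm]; linarith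
    have hyc := sub_ne_zero.2 (hne y hyb)
    rw [hw2 hyb, Finset.sum_insert hc, zpow_add₀ hy0, div_zpow]
    have := zpow_ne_zero (m c) hyc
    have := zpow_ne_zero (m c) hy0
    field_simp

end KK

end

section

namespace KK
open Complex Set Metric Filter Topology

theorem hmul_apply (g h : ℂ ≃ₜ ℂ) (x : ℂ) : (g * h) x = g (h x) := rfl

theorem proper (g : ℂ ≃ₜ ℂ) (K : ℝ) : ∃ R, 0 < R ∧ MapsTo g (Far R) (Far K) := by
  have h1 : Tendsto (fun y => ‖g y‖) (cocompact ℂ) atTop :=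
    (tendsto_norm_cocompact_atTop).comp g.isClosedEmbedding.tendsto_cocompact
  have h2 := h1.eventually_ge_atTop K
  rw [← cobounded_eq_cocompact] at h2
  rw [(hasBasis_cobounded_norm (E := ℂ)).eventually_iff] at h2
  obtain ⟨R, -, hR⟩ := h2
  exact ⟨max R 1, by positivity, fun y hy => by
    have h : max R 1 ≤ ‖y‖ := hy
    exact hR (show R ≤ ‖y‖ from le_trans (le_max_left _ _) h)⟩

def DegAt (g : ℂ ≃ₜ ℂ) (z0 : ℂ) (d : ℤ) : Prop :=
  LogOn (fun z => (g z - g z0) / (z - z0) ^ d) {z0}ᶜ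

def Deg (g : ℂ ≃ₜ ℂ) (d : ℤ) : Prop := ∀ z0, DegAt g z0 d

theorem DegAt.far {g : ℂ ≃ₜ ℂ} {z0 d} (h : DegAt g z0 d) :
    ∃ R, 0 < R ∧ LogOn (fun y => g y / y ^ d) (Far R) := by
  obtain ⟨R1, hR1, hm⟩ := proper g (‖g z0‖ + 1)
  refine ⟨max R1 (‖z0‖ + 1), by positivity, ?_⟩
  have a1 := (((logOn_far_sub (g z0)).comp g.continuous.continuousOn hm).mono
    (far_mono (le_max_left R1 (‖z0‖ + 1)))).inv
  have a2 := ((logOn_far_sub z0).mono (far_mono (le_max_right R1 (‖z0‖ + 1)))).zpow d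
  have hz : ∀ y ∈ Far (max R1 (‖z0‖ + 1)), y ≠ z0 := fun y hy e => by
    have : max R1 (‖z0‖ + 1) ≤ ‖y‖ := hy
    have := (le_max_right _ _).trans this
    rw [e] at this; linarith
  have a3 := h.mono (T := Far (max R1 (‖z0‖ + 1))) (fun y hy => hz y hy)
  refine ((a1.mul a2).mul a3).congr fun y hy => ?_
  have h1 : y - z0 ≠ 0 := sub_ne_zero.2 (hz y hy)
  have h2 : g y - g z0 ≠ 0 := sub_ne_zero.2 (fun e => hz y hy (g.injective e))
  rw [div_zpow]
  have := zpow_ne_zero d h1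
  field_simp

theorem DegAt.unique {g : ℂ ≃ₜ ℂ} {z0 z1 d e} (h : DegAt g z0 d) (h' : DegAt g z1 e) : d = e := by
  obtain ⟨R, -, h⟩ := h.far
  obtain ⟨R', -, h'⟩ := h'.far
  exact far_unique h h'

theorem exists_degAt (g : ℂ ≃ₜ ℂ) (z0) : ∃ d, DegAt g z0 d := by
  obtain ⟨m, hm⟩ := exists_index (u := fun y => g (y + z0) - g z0)
    (by have := g.continuous; fun_prop) (fun y hy => sub_ne_zero.2 fun e => hy (by
      have := g.injective e; simpa using this))
  refine ⟨m, (hm.comp (φ := fun y => y - z0) (T := {z0}ᶜ) (by fun_prop) ?_).congr ?_⟩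
  · intro y hy; simpa [sub_eq_zero] using hy
  · intro y _; simp

theorem Deg.mul {g h : ℂ ≃ₜ ℂ} {d e} (hg : Deg g d) (hh : Deg h e) : Deg (g * h) (d * e) := by
  intro z0
  have a1 := (hg (h z0)).comp h.continuous.continuousOn (T := {z0}ᶜ)
    (fun y hy => fun e => hy (h.injective e))
  refine (a1.mul ((hh z0).zpow d)).congr fun y hy => ?_
  have h2 : h y - h z0 ≠ 0 := sub_ne_zero.2 (fun e => hy (h.injective e))
  have := zpow_ne_zero d h2
  simp only [hmul_apply]
  rw [div_zpow, ← zpow_mul, mul_comm e d]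
  field_simp

theorem deg_one : Deg (1 : ℂ ≃ₜ ℂ) 1 := fun z0 => by
  refine (logOn_const one_ne_zero _).congr fun y hy => ?_
  simp only [zpow_one]
  exact div_self (sub_ne_zero.2 hy)

theorem exists_deg (g : ℂ ≃ₜ ℂ) : ∃ d, Deg g d := by
  obtain ⟨d, hd⟩ := exists_degAt g 0
  refine ⟨d, fun z => ?_⟩
  obtain ⟨e, he⟩ := exists_degAt g z
  rwa [hd.unique he]

theorem Deg.unique {g : ℂ ≃ₜ ℂ} {d e} (h : Deg g d) (h' : Deg g e) : d = e := (h 0).unique (h' 0)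

theorem deg_cases (g : ℂ ≃ₜ ℂ) : Deg g 1 ∨ Deg g (-1) := by
  obtain ⟨d, hd⟩ := exists_deg g
  obtain ⟨e, he⟩ := exists_deg g⁻¹
  have h := hd.mul he
  rw [mul_inv_cancel] at h
  rcases Int.eq_one_or_neg_one_of_mul_eq_one (h.unique deg_one) with rfl | rfl
  exacts [Or.inl hd, Or.inr hd]

theorem Deg.pow {g : ℂ ≃ₜ ℂ} {d} (h : Deg g d) (n : ℕ) : Deg (g ^ n) (d ^ n) := by
  induction n with
  | zero => simpa using deg_one
  | succ n ih => rw [pow_succ, pow_succ]; exact ih.mul h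

/-- `y⁻¹` and `conj y` differ by a positive function -/
theorem logOn_conj_mul {S : Set ℂ} (h : (0 : ℂ) ∉ S) :
    LogOn (fun y => (starRingEnd ℂ) y * y) S := by
  refine (logOn_pos (φ := fun y => ‖y‖ ^ 2) (by fun_prop) fun y hy => ?_).congr fun y hy => ?_
  · have : y ≠ 0 := fun e => h (e ▸ hy)
    positivity
  · rw [mul_comm, Complex.mul_conj, normSq_eq_norm_sq]

end KK

end

section

namespace KK
open Complex Set Metric Filter Topology MeasureTheory

theorem sard_approx {v : ℂ → ℂ} (hv : Continuous v) {ε : ℝ} (hε : 0 < ε) (c : ℂ) (r : ℝ) :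
    ∃ w : ℂ → ℂ, Continuous w ∧ (∀ z, ‖w z - v z‖ < ε) ∧
      {z | z ∈ closedBall c r ∧ w z = 0}.Finite ∧ ∀ z ∈ sphere c r, w z ≠ 0 := by
  obtain ⟨P, hP, hPv, -⟩ := hv.exists_contDiff_approx (ε := fun _ => ε / 2) 1 continuous_const
    (fun _ => half_pos hε)
  have hd : Differentiable ℝ P := hP.differentiable (by simp)
  set Cr : Set ℂ := {z | (fderiv ℝ P z).det = 0}
  have n1 : volume (P '' Cr) = 0 :=
    addHaar_image_eq_zero_of_det_fderivWithin_eq_zero (f' := fderiv ℝ P) volume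
      (fun x _ => (hd x).hasFDerivAt.hasFDerivWithinAt) (fun x hx => hx)
  have n2 : volume (P '' sphere c r) = 0 :=
    addHaar_image_eq_zero_of_differentiableOn_of_addHaar_eq_zero volume hd.differentiableOn
      (Measure.addHaar_sphere volume c r)
  obtain ⟨q, hq, hqn⟩ : ∃ q ∈ ball (0 : ℂ) (ε / 2), q ∉ P '' Cr ∪ P '' sphere c r := by
    by_contra! hcon
    have h0 : volume (P '' Cr ∪ P '' sphere c r) = 0 := measure_union_null n1 n2
    have := measure_mono_null hcon h0
    exact (measure_ball_pos volume (0 : ℂ) (half_pos hε)).ne' this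
  refine ⟨fun z => P z - q, hd.continuous.sub continuous_const, fun z => ?_, ?_, ?_⟩
  · have h1 := hPv z
    have h2 : ‖q‖ < ε / 2 := by simpa using hq
    rw [dist_eq_norm] at h1
    calc ‖P z - q - v z‖ = ‖(P z - v z) - q‖ := by congr 1; ring
      _ ≤ ‖P z - v z‖ + ‖q‖ := norm_sub_le _ _
      _ < ε := by linarith
  · by_contra hinf
    obtain ⟨x, hx, hacc⟩ := Set.Infinite.exists_accPt_of_subset_isCompact hinf
      (isCompact_closedBall c r) (fun z hz => hz.1)
    have hfr := accPt_iff_frequently.1 hacc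
    have hcl : IsClosed {z | P z = q} := isClosed_eq hd.continuous continuous_const
    have hxq : P x = q := by
      have : x ∈ closure {z | P z = q} := by
        rw [mem_closure_iff_frequently]
        exact hfr.mono fun y hy => sub_eq_zero.1 hy.2.2
      rwa [hcl.closure_eq] at this
    have hdet : (fderiv ℝ P x).det ≠ 0 := fun h => hqn (Or.inl ⟨x, h, hxq⟩)
    have hev := (hd x).hasFDerivAt.eventually_ne (c := q) ⟨_, by
      exact ((fderiv ℝ P x).toContinuousLinearEquivOfDetNeZero hdet).antilipschitz⟩
    rw [eventually_nhdsWithin_iff] at hev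
    obtain ⟨y, hy1, hy2⟩ := (hfr.and_eventually hev).exists
    exact hy2 hy1.1 (sub_eq_zero.1 hy1.2.2)
  · intro z hz h
    exact hqn (Or.inr ⟨z, hz, sub_eq_zero.1 h⟩)

theorem lemX {c : ℂ} {r : ℝ} {Y : Set ℂ} (hY : IsClosed Y) {v : ℂ → ℂ} (hv : Continuous v)
    (h : ∀ z ∈ closedBall c r, z ∈ Y → z ∉ interior Y → v z ≠ 0) :
    ∃ w : ℂ → ℂ, Continuous w ∧ EqOn w v Y ∧
      {z | z ∈ closedBall c r ∧ z ∉ Y ∧ w z = 0}.Finite ∧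
      ∀ z ∈ closedBall c r, z ∉ Y → w z = 0 → z ∈ ball c r := by
  set K := closedBall c r \ interior Y
  have hK : IsClosed K := isClosed_closedBall.sdiff isOpen_interior
  have hKY : IsCompact (K ∩ Y) := 
    ((isCompact_closedBall c r).diff isOpen_interior).inter_right hY
  have hne : ∀ z ∈ K ∩ Y, v z ≠ 0 := fun z hz => h z hz.1.1 hz.2 hz.1.2
  obtain ⟨ε, hε, hmin⟩ : ∃ ε > 0, ∀ z ∈ K ∩ Y, ε ≤ ‖v z‖ := by
    rcases (K ∩ Y).eq_empty_or_nonempty with he | he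
    · exact ⟨1, one_pos, fun z hz => by rw [he] at hz; exact hz.elim⟩
    · obtain ⟨z0, h0, hm⟩ := hKY.exists_isMinOn he hv.norm.continuousOn
      exact ⟨‖v z0‖, norm_pos_iff.2 (hne z0 h0), fun z hz => hm hz⟩
  obtain ⟨w0, hw0, hc, hfin, hsp⟩ := sard_approx hv (half_pos hε) c r
  have hw0n : ∀ z ∈ K ∩ Y, ε / 2 < ‖w0 z‖ := fun z hz => by
    have h1 := hmin z hz
    have h2 := hc z
    have h3 := norm_sub_norm_le (v z) (w0 z)
    rw [norm_sub_rev] at h3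
    linarith
  obtain ⟨a, ha, hae⟩ := logOn_of_near_one (u := fun z => v z / w0 z) (S := K ∩ Y)
    (hv.continuousOn.div hw0.continuousOn fun z hz h0 => by
      have := hw0n z hz; rw [h0] at this; simp at this; linarith)
    (fun z hz => by
      have h1 := hw0n z hz
      have h0 : w0 z ≠ 0 := norm_pos_iff.1 (by linarith)
      have : v z / w0 z - 1 = (v z - w0 z) / w0 z := by field_simp
      rw [this, norm_div, div_lt_one (by linarith), norm_sub_rev]
      exact (hc z).trans h1)
  obtain ⟨a', ha', hae'⟩ := tietze (hK.inter hY) ha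
  obtain ⟨w, hw, hwK, hwY⟩ := glue (u := fun z => w0 z * exp (a' z)) hK hY
    (by fun_prop) hv.continuousOn (fun z hzK hzY => by
      have h1 := hw0n z ⟨hzK, hzY⟩
      have h0 : w0 z ≠ 0 := norm_pos_iff.1 (by linarith)
      have := hae z ⟨hzK, hzY⟩
      simp only [hae' ⟨hzK, hzY⟩, ← this]
      field_simp)
  have key : ∀ z ∈ closedBall c r, z ∉ Y → w z = 0 → w0 z = 0 := fun z hz hzY h0 => by
    have hzK : z ∈ K := ⟨hz, fun hh => hzY (interior_subset hh)⟩
    rw [hwK hzK] at h0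
    exact (mul_eq_zero.1 h0).resolve_right (exp_ne_zero _)
  refine ⟨w, hw, hwY, hfin.subset fun z hz => ⟨hz.1, key z hz.1 hz.2.1 hz.2.2⟩, ?_⟩
  intro z hz hzY h0
  by_contra hb
  exact hsp z (by
    rw [mem_ball, not_lt] at hb
    exact mem_sphere.2 (le_antisymm (mem_closedBall.1 hz) hb)) (key z hz hzY h0)

end KK

end

section

namespace KK
open Complex Set Metric Filter Topology

theorem pow_succ_app (g : ℂ ≃ₜ ℂ) (k : ℕ) (z : ℂ) : (g ^ (k + 1)) z = (g ^ k) (g z) := by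
  rw [pow_succ]; rfl

theorem pow_succ_app' (g : ℂ ≃ₜ ℂ) (k : ℕ) (z : ℂ) : (g ^ (k + 1)) z = g ((g ^ k) z) := by
  rw [pow_succ']; rfl

theorem pow_add_app (g : ℂ ≃ₜ ℂ) (j k : ℕ) (z : ℂ) : (g ^ (j + k)) z = (g ^ j) ((g ^ k) z) := by
  rw [pow_add]; rfl

theorem pow_inv_set {g : ℂ ≃ₜ ℂ} {Y : Set ℂ} (h : ∀ z, g z ∈ Y ↔ z ∈ Y) (k : ℕ) (z : ℂ) :
    (g ^ k) z ∈ Y ↔ z ∈ Y := by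
  induction k generalizing z with
  | zero => simp
  | succ k ih => rw [pow_succ_app, ih, h]

theorem pow_equivar {g : ℂ ≃ₜ ℂ} {ρ : ℂ ≃L[ℝ] ℂ} {v : ℂ → ℂ} (h : ∀ z, v (g z) = ρ (v z)) (k : ℕ)
    (z : ℂ) : v ((g ^ k) z) = (ρ ^ k) (v z) := by
  induction k generalizing z with
  | zero => rfl
  | succ k ih => rw [pow_succ_app, ih, h, pow_succ]; rfl

/-- the union of the translates of `T` -/
def Orb (g : ℂ ≃ₜ ℂ) (p : ℕ) (T : Set ℂ) : Set ℂ := {z | ∃ k < p, (g ^ k) z ∈ T}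

theorem orb_inv {g : ℂ ≃ₜ ℂ} {p : ℕ} (hp : 0 < p) (hg : g ^ p = 1) (T : Set ℂ) (z : ℂ) :
    g z ∈ Orb g p T ↔ z ∈ Orb g p T := by
  constructor
  · rintro ⟨k, hk, h⟩
    rw [← pow_succ_app] at h
    rcases (Nat.succ_le_of_lt hk).lt_or_eq with h' | h'
    · exact ⟨k + 1, h', h⟩
    · refine ⟨0, hp, ?_⟩
      rw [show k + 1 = p from h', hg] at h
      exact h
  · rintro ⟨k, hk, h⟩
    rcases k with _ | k
    · refine ⟨p - 1, by omega, ?_⟩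
      rw [← pow_succ_app, Nat.sub_add_cancel hp, hg]
      exact h
    · exact ⟨k, by omega, by rwa [← pow_succ_app]⟩

theorem orb_eq (g : ℂ ≃ₜ ℂ) (p : ℕ) (T : Set ℂ) :
    Orb g p T = ⋃ k ∈ Finset.range p, (g ^ k) ⁻¹' T := by
  ext z; simp [Orb]

theorem orb_closed (g : ℂ ≃ₜ ℂ) (p : ℕ) {T : Set ℂ} (hT : IsClosed T) : IsClosed (Orb g p T) := by
  rw [orb_eq]
  exact isClosed_biUnion_finset fun k _ => hT.preimage (g ^ k).continuous

theorem orb_open (g : ℂ ≃ₜ ℂ) (p : ℕ) {T : Set ℂ} (hT : IsOpen T) : IsOpen (Orb g p T) := by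
  rw [orb_eq]
  exact isOpen_biUnion fun k _ => hT.preimage (g ^ k).continuous

theorem orb_compact (g : ℂ ≃ₜ ℂ) (p : ℕ) {T : Set ℂ} (hT : IsCompact T) : IsCompact (Orb g p T) := by
  rw [orb_eq]
  exact (Finset.range p).isCompact_biUnion fun k _ => (g ^ k).isCompact_preimage.2 hT

theorem orb_mono (g : ℂ ≃ₜ ℂ) (p : ℕ) {S T : Set ℂ} (h : S ⊆ T) : Orb g p S ⊆ Orb g p T :=
  fun _ ⟨k, hk, hz⟩ => ⟨k, hk, h hz⟩

theorem stepD {g : ℂ ≃ₜ ℂ} {p : ℕ} (hp : 0 < p) (hg : g ^ p = 1) {ρ : ℂ ≃L[ℝ] ℂ} (hρ : ρ ^ p = 1)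
    {Y : Set ℂ} (hY : IsClosed Y) (hYi : ∀ z, g z ∈ Y ↔ z ∈ Y) {v : ℂ → ℂ} (hv : Continuous v)
    (hve : ∀ z, v (g z) = ρ (v z)) (hfin : {z | z ∈ Y ∧ v z = 0}.Finite)
    (hintr : ∀ z ∈ Y, v z = 0 → z ∈ interior Y) {c : ℂ} {r : ℝ}
    (hT : ∀ k, 0 < k → k < p → ∀ z ∈ closedBall c r, (g ^ k) z ∉ closedBall c r) :
    ∃ v' : ℂ → ℂ, Continuous v' ∧ (∀ z, v' (g z) = ρ (v' z)) ∧ EqOn v' v Y ∧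
      {z | z ∈ Y ∪ Orb g p (closedBall c r) ∧ v' z = 0}.Finite ∧
      ∀ z ∈ Y ∪ Orb g p (closedBall c r), v' z = 0 →
        z ∈ interior (Y ∪ Orb g p (closedBall c r)) := by
  obtain ⟨w, hw, hwY, hwf, hwb⟩ := lemX (c := c) (r := r) hY hv
    (fun z _ hzY hzi h0 => hzi (hintr z hzY h0))
  set T := closedBall c r
  set B : Set ℂ := Y ∪ ⋃ k ∈ (Finset.range p).filter (0 < ·), (g ^ k) ⁻¹' T
  have hB : IsClosed B := hY.union
    (isClosed_biUnion_finset fun k _ => isClosed_closedBall.preimage (g ^ k).continuous)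
  obtain ⟨h, hh, hhT, hhB⟩ := glue (A := T) (B := B) (u := fun z => w z - v z) (w := fun _ => 0)
    isClosed_closedBall hB (by fun_prop) continuousOn_const (fun z hzT hzB => by
      rcases hzB with hz | hz
      · simp [hwY hz]
      · simp only [mem_iUnion, Finset.mem_filter, Finset.mem_range] at hz
        obtain ⟨k, ⟨h1, h2⟩, h3⟩ := hz
        exact (hT k h2 h1 z hzT h3).elim)
  let t : ℕ → ℂ → ℂ := fun k z => (ρ⁻¹ ^ k) (h ((g ^ k) z))
  let v' : ℂ → ℂ := fun z => v z + ∑ k ∈ Finset.range p, t k z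
  have ht : ∀ k, Continuous (t k) := fun k => by
    have := (g ^ k).continuous
    have := (ρ⁻¹ ^ k).continuous
    simp only [t]; fun_prop
  have hv' : Continuous v' := hv.add (continuous_finsetSum _ fun k _ => ht k)
  have hts : ∀ k z, t k (g z) = ρ (t (k + 1) z) := fun k z => by
    simp only [t, pow_succ_app]
    rw [pow_succ' ρ⁻¹ k]
    change _ = (ρ * (ρ⁻¹ * ρ⁻¹ ^ k)) _
    rw [← mul_assoc, mul_inv_cancel, one_mul]
  have htp : ∀ z, t p z = t 0 z := fun z => by
    simp only [t, hg, inv_pow, hρ]; simp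
  have hv'e : ∀ z, v' (g z) = ρ (v' z) := fun z => by
    simp only [v', map_add, map_sum, hts, hve]
    congr 1
    rw [← map_sum, ← map_sum]
    congr 1
    have h1 := Finset.sum_range_succ (fun k => t k z) p
    have h2 := Finset.sum_range_succ' (fun k => t k z) p
    rw [h2, htp] at h1
    exact add_right_cancel h1
  have hv'Y : EqOn v' v Y := fun z hz => by
    simp only [v', add_eq_left]
    refine Finset.sum_eq_zero fun k _ => ?_
    simp only [t]
    rw [hhB (Or.inl ((pow_inv_set hYi k z).2 hz)), map_zero]
  have hv'T : EqOn v' w T := fun z hz => by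
    obtain ⟨q, rfl⟩ : ∃ q, p = q + 1 := ⟨p - 1, by omega⟩
    simp only [v', Finset.sum_range_succ']
    rw [Finset.sum_eq_zero]
    · simp only [t, pow_zero, zero_add]
      change v z + h z = w z
      rw [hhT hz]; ring
    · intro k hk
      rw [Finset.mem_range] at hk
      have : (g ^ (k + 1)) z ∈ B := by
        right
        simp only [mem_iUnion, Finset.mem_filter, Finset.mem_range]
        refine ⟨q - k, ⟨by omega, by omega⟩, ?_⟩
        change (g ^ (q - k)) ((g ^ (k + 1)) z) ∈ T
        rw [← pow_add_app, show q - k + (k + 1) = q + 1 by omega, hg]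
        exact hz
      simp only [t]
      rw [hhB this, map_zero]
  have key : ∀ z ∈ Y ∪ Orb g p T, v' z = 0 → z ∉ Y → ∃ k < p, (g ^ k) z ∈ T ∧ (g ^ k) z ∉ Y ∧
      w ((g ^ k) z) = 0 := fun z hz h0 hzY => by
    obtain ⟨k, hk, hkz⟩ := hz.resolve_left hzY
    refine ⟨k, hk, hkz, fun h => hzY ((pow_inv_set hYi k z).1 h), ?_⟩
    rw [← hv'T hkz, pow_equivar hv'e, h0, map_zero]
  refine ⟨v', hv', hv'e, hv'Y, ?_, ?_⟩
  · have : (⋃ k ∈ Finset.range p, (g ^ k) ⁻¹' {z | z ∈ T ∧ z ∉ Y ∧ w z = 0}).Finite :=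
      (Finset.range p).finite_toSet.biUnion fun k _ => hwf.preimage (g ^ k).injective.injOn
    refine (hfin.union this).subset ?_
    rintro z ⟨hz, h0⟩
    by_cases hzY : z ∈ Y
    · exact Or.inl ⟨hzY, by rw [← hv'Y hzY]; exact h0⟩
    · obtain ⟨k, hk, h3⟩ := key z hz h0 hzY
      right
      simp only [mem_iUnion, Finset.mem_range]
      exact ⟨k, hk, h3⟩
  · intro z hz h0
    by_cases hzY : z ∈ Y
    · exact interior_mono subset_union_left (hintr z hzY (by rw [← hv'Y hzY]; exact h0))
    · obtain ⟨k, hk, h3, h4, h5⟩ := key z hz h0 hzY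
      refine interior_maximal (t := Orb g p (ball c r)) ?_ (orb_open g p isOpen_ball)
        ⟨k, hk, hwb _ h3 h4 h5⟩
      exact (orb_mono g p ball_subset_closedBall).trans subset_union_right

theorem inductD {g : ℂ ≃ₜ ℂ} {p : ℕ} (hp : 0 < p) (hg : g ^ p = 1) {ρ : ℂ ≃L[ℝ] ℂ} (hρ : ρ ^ p = 1)
    {Y : Set ℂ} (hY : IsClosed Y) (hYi : ∀ z, g z ∈ Y ↔ z ∈ Y) {v : ℂ → ℂ} (hv : Continuous v)
    (hve : ∀ z, v (g z) = ρ (v z)) (hvY : ∀ z ∈ Y, v z ≠ 0) (r : ℂ → ℝ) (s : Finset ℂ) 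
    (hT : ∀ c ∈ s, ∀ k, 0 < k → k < p → ∀ z ∈ closedBall c (r c), (g ^ k) z ∉ closedBall c (r c)) :
    ∃ v' : ℂ → ℂ, Continuous v' ∧ (∀ z, v' (g z) = ρ (v' z)) ∧ EqOn v' v Y ∧
      {z | z ∈ Y ∪ Orb g p (⋃ c ∈ s, closedBall c (r c)) ∧ v' z = 0}.Finite ∧
      ∀ z ∈ Y ∪ Orb g p (⋃ c ∈ s, closedBall c (r c)), v' z = 0 →
        z ∈ interior (Y ∪ Orb g p (⋃ c ∈ s, closedBall c (r c))) := by
  induction s using Finset.induction_on with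
  | empty =>
    have : Orb g p (⋃ c ∈ (∅ : Finset ℂ), closedBall c (r c)) = ∅ := by
      ext z; simp [Orb]
    rw [this, union_empty]
    refine ⟨v, hv, hve, fun _ _ => rfl, ?_, fun z hz h0 => (hvY z hz h0).elim⟩
    convert Set.finite_empty (α := ℂ)
    ext z
    simp only [mem_ofPred_eq, mem_empty_iff_false, iff_false]
    exact fun h => hvY z h.1 h.2
  | insert c s hc ih =>
    obtain ⟨v1, h1, h2, h3, h4, h5⟩ := ih fun c hc => hT c (Finset.mem_insert_of_mem hc)
    set Y1 := Y ∪ Orb g p (⋃ c ∈ s, closedBall c (r c)) with hY1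
    have hcl : IsClosed Y1 := hY.union (orb_closed g p
      (isClosed_biUnion_finset fun k _ => isClosed_closedBall))
    have hinv : ∀ z, g z ∈ Y1 ↔ z ∈ Y1 := fun z => by
      simp only [hY1, mem_union, hYi, orb_inv hp hg]
    obtain ⟨v2, k1, k2, k3, k4, k5⟩ := stepD hp hg hρ hcl hinv h1 h2 h4 h5
      (hT c (Finset.mem_insert_self _ _))
    have : Y ∪ Orb g p (⋃ x ∈ insert c s, closedBall x (r x)) =
        Y1 ∪ Orb g p (closedBall c (r c)) := by
      rw [hY1, union_assoc]; congr 1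
      ext z
      simp only [Orb, Finset.mem_insert, iUnion_iUnion_eq_or_left, mem_union, mem_ofPred_eq]
      constructor
      · rintro ⟨k, hk, h | h⟩
        · exact Or.inr ⟨k, hk, h⟩
        · exact Or.inl ⟨k, hk, h⟩
      · rintro (⟨k, hk, h⟩ | ⟨k, hk, h⟩)
        · exact ⟨k, hk, Or.inr h⟩
        · exact ⟨k, hk, Or.inl h⟩
    rw [this]
    exact ⟨v2, k1, k2, fun z hz => (k3 (Or.inl hz)).trans (h3 hz), k4, k5⟩

end KK

end

section

namespace KK
open Complex Set Metric Filter Topology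

/-- the pair (g, ρ) preserves local exponents -/
def Good (g : ℂ ≃ₜ ℂ) (ρ : ℂ ≃L[ℝ] ℂ) : Prop :=
  ∀ v : ℂ → ℂ, (∀ z, v (g z) = ρ (v z)) → ∀ z (m : ℤ), (∃ r > 0,
    LogOn (fun y => v y / (y - g z) ^ m) (ball (g z) r \ {g z})) →
    ∃ r > 0, LogOn (fun y => v y / (y - z) ^ m) (ball z r \ {z})

theorem good_aux (g : ℂ ≃ₜ ℂ) {u : ℂ → ℂ} {z : ℂ} (h : ∃ r > 0, LogOn u (ball (g z) r \ {g z})) :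
    ∃ r > 0, LogOn (fun y => u (g y)) (ball z r \ {z}) := by
  obtain ⟨r, hr, h⟩ := h
  obtain ⟨s, hs, hsb⟩ := Metric.continuous_iff.1 g.continuous z r hr
  exact ⟨s, hs, h.comp g.continuous.continuousOn fun y hy =>
    ⟨hsb y hy.1, fun e => hy.2 (g.injective e)⟩⟩

/-- multiplication by a nonzero number -/
noncomputable def mulEq (ζ : ℂ) (h : ζ ≠ 0) : ℂ ≃L[ℝ] ℂ :=
  ContinuousLinearEquiv.smulLeft (Units.mk0 ζ h)

theorem mulEq_apply (ζ : ℂ) (h : ζ ≠ 0) (z) : mulEq ζ h z = ζ * z := rfl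

theorem good_mul {g : ℂ ≃ₜ ℂ} (hg : Deg g 1) (ζ : ℂ) (h : ζ ≠ 0) : Good g (mulEq ζ h) := by
  intro v hv z m hm
  obtain ⟨r, hr, h1⟩ := good_aux g hm
  have h2 := ((hg z).mono (T := ball z r \ {z}) (fun y hy => hy.2)).zpow m
  refine ⟨r, hr, ((h1.mul h2).div (logOn_const h _)).congr fun y hy => ?_⟩
  have e1 : y - z ≠ 0 := sub_ne_zero.2 hy.2
  have e2 : g y - g z ≠ 0 := sub_ne_zero.2 fun e => hy.2 (g.injective e)
  simp only [hv, mulEq_apply, zpow_one, div_zpow]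
  have := zpow_ne_zero m e1
  have := zpow_ne_zero m e2
  field_simp

theorem good_conj {g : ℂ ≃ₜ ℂ} (hg : Deg g (-1)) : Good g conjCLE := by
  intro v hv z m hm
  obtain ⟨r, hr, h1⟩ := good_aux g hm
  have h2 := ((hg z).mono (T := ball z r \ {z}) (fun y hy => hy.2)).zpow m
  have h3 : LogOn (fun y => (starRingEnd ℂ) (y - z) * (y - z)) (ball z r \ {z}) :=
    (logOn_conj_mul (S := {0}ᶜ) (by simp)).comp (φ := fun y => y - z) (by fun_prop)
      (fun y hy => sub_ne_zero.2 hy.2)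
  refine ⟨r, hr, ((h1.mul h2).conj.div (h3.zpow m)).congr fun y hy => ?_⟩
  have e1 : y - z ≠ 0 := sub_ne_zero.2 hy.2
  have e2 : g y - g z ≠ 0 := sub_ne_zero.2 fun e => hy.2 (g.injective e)
  have e3 := (map_ne_zero (starRingEnd ℂ)).2 e1
  have e4 := (map_ne_zero (starRingEnd ℂ)).2 e2
  simp only [hv, conjCLE_apply, zpow_neg, zpow_one, div_inv_eq_mul, map_mul, map_div₀, map_zpow₀,
    mul_zpow, conj_conj]
  have := zpow_ne_zero m e1
  have := zpow_ne_zero m e3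
  have := zpow_ne_zero m e4
  field_simp

theorem free_of_prime {g : ℂ ≃ₜ ℂ} {p : ℕ} (hp : p.Prime) (hg : g ^ p = 1) {z : ℂ} (hz : g z ≠ z)
    {k : ℕ} (hk : 0 < k) (hkp : k < p) : (g ^ k) z ≠ z := by
  intro h
  have it : ∀ n w, (g : ℂ → ℂ)^[n] w = (g ^ n) w := fun n => by
    induction n with
    | zero => intro w; rfl
    | succ n ih => intro w; rw [Function.iterate_succ_apply, ih, pow_succ_app]
  have h1 : Function.IsPeriodicPt g k z := (it k z).trans h
  have h2 : Function.IsPeriodicPt g p z := (it p z).trans (by rw [hg]; rfl)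
  have h3 := h1.gcd h2
  have : Nat.gcd k p = 1 := by
    exact (Nat.coprime_of_lt_prime hk.ne' hkp hp).symm
  rw [this] at h3
  exact hz h3

theorem exists_disc {g : ℂ ≃ₜ ℂ} {p : ℕ} (hp : p.Prime) (hg : g ^ p = 1) {z : ℂ} (hz : g z ≠ z) :
    ∃ r > 0, ∀ k, 0 < k → k < p → ∀ x ∈ closedBall z r, (g ^ k) x ∉ closedBall z r := by
  have h1 : ∀ k ∈ (Finset.range p).filter (0 < ·), ∀ᶠ r in 𝓝[>] (0 : ℝ),
      ∀ x ∈ closedBall z r, (g ^ k) x ∉ closedBall z r := by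
    intro k hk
    simp only [Finset.mem_filter, Finset.mem_range] at hk
    have hne := free_of_prime hp hg hz hk.2 hk.1
    have hδ : 0 < dist ((g ^ k) z) z := dist_pos.2 hne
    obtain ⟨s, hs, hsb⟩ := Metric.continuous_iff.1 (g ^ k).continuous z _ (half_pos hδ)
    filter_upwards [Ioo_mem_nhdsGT (lt_min hs (half_pos hδ))] with r hr x hx hx'
    have hr1 := hr.2.trans_le (min_le_left _ _)
    have hr2 := hr.2.trans_le (min_le_right _ _)
    have h1 := hsb x ((mem_closedBall.1 hx).trans_lt hr1)
    have h2 := mem_closedBall.1 hx'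
    have := dist_triangle_left ((g ^ k) z) z ((g ^ k) x)
    linarith
  have h2 := (Filter.eventually_all_finset _).2 h1
  obtain ⟨r, hr, hr0⟩ := (h2.and self_mem_nhdsWithin).exists
  exact ⟨r, hr0, fun k h1 h2 => hr k (by simp [h1, h2])⟩

theorem sum_dvd {g : ℂ ≃ₜ ℂ} {p : ℕ} (hp : p.Prime) (hg : g ^ p = 1) (Z : Finset ℂ)
    (hZ : ∀ z, z ∈ Z → g z ∈ Z) (hfix : ∀ z ∈ Z, g z ≠ z) (m : ℂ → ℤ)
    (hm : ∀ z ∈ Z, m (g z) = m z) : (p : ℤ) ∣ ∑ z ∈ Z, m z := by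
  classical
  have := Fact.mk hp
  have h := Finset.sum_comp (s := Z) (fun k : ℤ => k) m
  rw [h]
  refine Finset.dvd_sum fun b _ => ?_
  rw [nsmul_eq_mul]
  refine Dvd.dvd.mul_right ?_ _
  rw [Int.natCast_dvd_natCast]
  set W := Z.filter (fun a => m a = b)
  have hW : ∀ z ∈ W, g z ∈ W := fun z hz => by
    simp only [W, Finset.mem_filter] at hz ⊢
    exact ⟨hZ z hz.1, (hm z hz.1).trans hz.2⟩
  let f : Function.End W := fun z : W => ⟨g z, hW z z.2⟩
  have hf : f ^ p ^ 1 = 1 := by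
    rw [pow_one]
    have : ∀ n (z : W), (((f ^ n) z : W) : ℂ) = (g ^ n) z := fun n z => by
      induction n with
      | zero => rfl
      | succ n ih => rw [pow_succ' f, pow_succ_app', ← ih]; rfl
    funext z
    apply Subtype.ext
    rw [this, hg]; rfl
  have h3 := Equiv.Perm.card_fixedPoints_modEq (p := p) (n := 1) hf
  have h4 : Fintype.card (Function.fixedPoints f) = 0 := by
    rw [Fintype.card_eq_zero_iff]
    refine ⟨fun ⟨z, hz⟩ => hfix z (Finset.mem_filter.1 z.2).1 (congrArg Subtype.val hz)⟩
  rw [h4, Fintype.card_coe] at h3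
  exact (Nat.modEq_zero_iff_dvd).1 h3

theorem claimD {g : ℂ ≃ₜ ℂ} {p : ℕ} (hp : p.Prime) (hg : g ^ p = 1) {ρ : ℂ ≃L[ℝ] ℂ}
    (hρ : ρ ^ p = 1) (hgood : Good g ρ) {v : ℂ → ℂ} (hv : Continuous v)
    (hve : ∀ z, v (g z) = ρ (v z)) (hfix : ∀ z, g z = z → v z ≠ 0) {R : ℝ}
    (hfar : LogOn (fun y => v y / y) (Far R)) : False := by
  have hK : IsCompact {z | v z = 0} := by
    refine Metric.isCompact_of_isClosed_isBounded (isClosed_eq hv continuous_const) ?_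
    refine (isBounded_closedBall (x := (0 : ℂ)) (r := R)).subset fun z hz => ?_
    by_contra hn
    have : z ∈ Far R := by
      simp only [mem_closedBall, dist_zero_right, not_le] at hn
      exact hn.le
    have := hfar.ne_zero this
    simp [show v z = 0 from hz] at this
  have hdisc : ∀ z, ∃ r > 0, v z = 0 → ∀ k, 0 < k → k < p → ∀ x ∈ closedBall z r,
      (g ^ k) x ∉ closedBall z r := fun z => by
    by_cases h : v z = 0
    · obtain ⟨r, h1, h2⟩ := exists_disc hp hg (z := z) (fun e => hfix z e h)
      exact ⟨r, h1, fun _ => h2⟩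
    · exact ⟨1, one_pos, fun h' => (h h').elim⟩
  choose r hr hrd using hdisc
  obtain ⟨s, hs, hcov⟩ := hK.elim_nhds_subcover (fun z => ball z (r z))
    (fun z _ => ball_mem_nhds z (hr z))
  set U : Set ℂ := Orb g p (⋃ c ∈ s, ball c (r c))
  have hUo : IsOpen U := orb_open g p (isOpen_biUnion fun _ _ => isOpen_ball)
  have hYi : ∀ z, g z ∈ Uᶜ ↔ z ∈ Uᶜ := fun z => not_congr (orb_inv hp.pos hg _ z)
  have hT : ∀ c ∈ s, ∀ k, 0 < k → k < p → ∀ z ∈ closedBall c (r c),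
      (g ^ k) z ∉ closedBall c (r c) := fun c hc => hrd c (hs c hc)
  obtain ⟨w, h1, h2, h3, h4, -⟩ := inductD hp.pos hg hρ hUo.isClosed_compl hYi hv hve
    (fun z hz h0 => hz ⟨0, hp.pos, hcov h0⟩) r s hT
  have hsub : U ⊆ Orb g p (⋃ c ∈ s, closedBall c (r c)) :=
    orb_mono g p (iUnion₂_mono fun _ _ => ball_subset_closedBall)
  have huniv : Uᶜ ∪ Orb g p (⋃ c ∈ s, closedBall c (r c)) = univ := by
    rw [eq_univ_iff_forall]
    intro z
    by_cases hz : z ∈ U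
    · exact Or.inr (hsub hz)
    · exact Or.inl hz
  simp only [huniv, mem_univ, true_and] at h4
  -- no zeros at fixed points
  have hwfix : ∀ z, g z = z → w z ≠ 0 := fun z hz => by
    have : z ∈ Uᶜ := by
      rintro ⟨k, hk, hkz⟩
      have hk' : ∀ k : ℕ, (g ^ k) z = z := fun k => by
        induction k with
        | zero => rfl
        | succ k ih => rw [pow_succ_app, hz, ih]
      rw [hk'] at hkz
      simp only [mem_iUnion] at hkz
      obtain ⟨c, hc, hzc⟩ := hkz
      have := hT c hc 1 one_pos hp.one_lt z (ball_subset_closedBall hzc)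
      rw [hk'] at this
      exact this (ball_subset_closedBall hzc)
    rw [h3 this]
    exact hfix z hz
  obtain ⟨Z, hZ⟩ : ∃ Z : Finset ℂ, ∀ z, z ∈ Z ↔ w z = 0 := ⟨h4.toFinset, fun z => by simp⟩
  have hloc : ∀ z, ∃ m : ℤ, ∃ ρ > 0, LogOn (fun y => w y / (y - z) ^ m) (ball z ρ \ {z}) := by
    intro z
    have hcl : IsClosed ((Z.erase z : Finset ℂ) : Set ℂ) := (Finset.finite_toSet _).isClosed
    have hzn : z ∉ ((Z.erase z : Finset ℂ) : Set ℂ) := by simp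
    obtain ⟨r, hr, hb⟩ := Metric.isOpen_iff.1 hcl.isOpen_compl z hzn
    refine local_exists hr h1 fun y hy hyz h0 => hb hy ?_
    simpa [hyz] using (hZ y).2 h0
  choose m hm using hloc
  have hmg : ∀ z ∈ Z, m (g z) = m z := fun z _ => by
    obtain ⟨r1, hr1, k1⟩ := hgood w h2 z (m (g z)) (hm (g z))
    obtain ⟨r2, hr2, k2⟩ := hm z
    exact local_unique hr1 hr2 k1 k2
  have hdvd := sum_dvd hp hg Z (fun z hz => by rw [hZ] at hz ⊢; rw [h2, hz, map_zero])
    (fun z hz e => hwfix z e ((hZ z).1 hz)) m hmg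
  obtain ⟨R1, hR1⟩ := index_sum m Z w h1 (fun y hy => (hZ y).2 hy) (fun z _ => hm z)
  have hcpt : IsCompact (Orb g p (⋃ c ∈ s, closedBall c (r c))) :=
    orb_compact g p (s.isCompact_biUnion fun c _ => isCompact_closedBall _ _)
  obtain ⟨R2, hR2⟩ := hcpt.isBounded.subset_closedBall 0
  have hfar2 : LogOn (fun y => w y / y ^ (1 : ℤ)) (Far (max R (R2 + 1))) := by
    refine (hfar.mono (far_mono (le_max_left _ _))).congr fun y hy => ?_
    have : y ∈ Uᶜ := fun hyU => by
      have a1 := hR2 (hsub hyU)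
      have a2 : max R (R2 + 1) ≤ ‖y‖ := hy
      have a3 := (le_max_right R (R2 + 1)).trans a2
      simp at a1; linarith
    simp only [h3 this, zpow_one]
  have := far_unique hR1 hfar2
  rw [this] at hdvd
  have := Int.eq_one_of_dvd_one (by positivity) hdvd
  exact hp.one_lt.ne' (by exact_mod_cast this)

end KK

end

section

namespace KK
open Complex Set Metric Filter Topology

theorem average {g : ℂ ≃ₜ ℂ} {p : ℕ} (hp : 0 < p) (hg : g ^ p = 1) {ρ : ℂ ≃L[ℝ] ℂ}
    (hρ : ρ ^ p = 1) {Y : Set ℂ} (hYi : ∀ z, g z ∈ Y ↔ z ∈ Y) {E : ℂ → ℂ} (hE : Continuous E)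
    (hEY : ∀ z ∈ Y, E (g z) = ρ (E z)) :
    ∃ v : ℂ → ℂ, Continuous v ∧ (∀ z, v (g z) = ρ (v z)) ∧ EqOn v E Y := by
  let t : ℕ → ℂ → ℂ := fun k z => (ρ⁻¹ ^ k) (E ((g ^ k) z))
  let v : ℂ → ℂ := fun z => (p : ℝ)⁻¹ • ∑ k ∈ Finset.range p, t k z
  have ht : ∀ k, Continuous (t k) := fun k => by
    have := (g ^ k).continuous
    have := (ρ⁻¹ ^ k).continuous
    simp only [t]; fun_prop
  have hts : ∀ k z, t k (g z) = ρ (t (k + 1) z) := fun k z => by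
    simp only [t, pow_succ_app]
    rw [pow_succ' ρ⁻¹ k]
    change _ = (ρ * (ρ⁻¹ * ρ⁻¹ ^ k)) _
    rw [← mul_assoc, mul_inv_cancel, one_mul]
  have htp : ∀ z, t p z = t 0 z := fun z => by
    simp only [t, hg, inv_pow, hρ]; simp
  refine ⟨v, by simp only [v]; fun_prop, fun z => ?_, fun z hz => ?_⟩
  · simp only [v, map_smul, hts]
    congr 1
    rw [← map_sum]
    congr 1
    have h1 := Finset.sum_range_succ (fun k => t k z) p
    have h2 := Finset.sum_range_succ' (fun k => t k z) p
    rw [h2, htp] at h1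
    exact add_right_cancel h1
  · have hk : ∀ k, t k z = E z := fun k => by
      have : E ((g ^ k) z) = (ρ ^ k) (E z) := by
        clear hts htp ht
        induction k with
        | zero => rfl
        | succ k ih =>
          rw [pow_succ_app', hEY _ ((pow_inv_set hYi k z).2 hz), ih, pow_succ']; rfl
      simp only [t, this, inv_pow]
      change ((ρ ^ k)⁻¹ * (ρ ^ k)) _ = _
      rw [inv_mul_cancel]; rfl
    simp only [v, hk, Finset.sum_const, Finset.card_range]
    rw [← Nat.cast_smul_eq_nsmul ℝ, smul_smul, inv_mul_cancel₀ (by positivity), one_smul]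

/-- the points whose orbit stays far -/
def FarInv (g : ℂ ≃ₜ ℂ) (p : ℕ) (R : ℝ) : Set ℂ := (Orb g p (Far R)ᶜ)ᶜ

theorem farInv_closed (g : ℂ ≃ₜ ℂ) (p : ℕ) (R : ℝ) : IsClosed (FarInv g p R) :=
  (orb_open g p (isClosed_far R).isOpen_compl).isClosed_compl

theorem farInv_inv {g : ℂ ≃ₜ ℂ} {p : ℕ} (hp : 0 < p) (hg : g ^ p = 1) (R : ℝ) (z : ℂ) :
    g z ∈ FarInv g p R ↔ z ∈ FarInv g p R := not_congr (orb_inv hp hg _ z)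

theorem farInv_mem {g : ℂ ≃ₜ ℂ} {p : ℕ} {R : ℝ} {z : ℂ} (h : z ∈ FarInv g p R) {k : ℕ} (hk : k < p) :
    (g ^ k) z ∈ Far R := by
  by_contra hn
  exact h ⟨k, hk, hn⟩

theorem farInv_sub {g : ℂ ≃ₜ ℂ} {p : ℕ} (hp : 0 < p) {R : ℝ} : FarInv g p R ⊆ Far R := 
  fun _ hz => farInv_mem hz (k := 0) hp

theorem far_sub_farInv (g : ℂ ≃ₜ ℂ) (p : ℕ) (R : ℝ) : ∃ R', 0 < R' ∧ Far R' ⊆ FarInv g p R := by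
  have h : IsCompact (Orb g p (closedBall 0 R)) := orb_compact g p (isCompact_closedBall _ _)
  obtain ⟨r, hr⟩ := h.isBounded.subset_closedBall 0
  refine ⟨max (r + 1) 1, by positivity, fun z hz hzo => ?_⟩
  have h1 : z ∈ Orb g p (closedBall 0 R) := orb_mono g p (fun y hy => by
    have : ¬ R ≤ ‖y‖ := hy
    simp; linarith) hzo
  have h2 := hr h1
  have h3 : max (r + 1) 1 ≤ ‖z‖ := hz
  have := (le_max_left _ _).trans h3
  simp at h2; linarith

noncomputable def asum (a : ℂ → ℂ) (g : ℂ ≃ₜ ℂ) (k : ℕ) (y : ℂ) : ℂ :=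
  ∑ j ∈ Finset.range k, a ((g ^ j) y)

noncomputable def ssum (a : ℂ → ℂ) (g : ℂ ≃ₜ ℂ) (p : ℕ) (y : ℂ) : ℂ :=
  ∑ k ∈ Finset.range p, asum a g k y

theorem asum_succ (a : ℂ → ℂ) (g : ℂ ≃ₜ ℂ) (k : ℕ) (y : ℂ) :
    asum a g (k + 1) y = a y + asum a g k (g y) := by
  simp only [asum]
  rw [Finset.sum_range_succ', add_comm]
  congr 1

theorem ssum_g (a : ℂ → ℂ) (g : ℂ ≃ₜ ℂ) (p : ℕ) (y : ℂ) :
    ssum a g p (g y) = ssum a g p y + asum a g p y - p * a y := by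
  have h1 : ∀ k, asum a g k (g y) = asum a g (k + 1) y - a y := fun k => by
    rw [asum_succ]; ring
  simp only [ssum, h1, Finset.sum_sub_distrib, Finset.sum_const, Finset.card_range, nsmul_eq_mul]
  have h2 := Finset.sum_range_succ (fun k => asum a g k y) p
  have h3 := Finset.sum_range_succ' (fun k => asum a g k y) p
  have h4 : asum a g 0 y = 0 := by simp [asum]
  rw [h2, h4] at h3
  linear_combination -h3

theorem asum_cont {a : ℂ → ℂ} {g : ℂ ≃ₜ ℂ} {S Y : Set ℂ} (ha : ContinuousOn a S) (k : ℕ)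
    (h : ∀ j < k, ∀ y ∈ Y, (g ^ j) y ∈ S) : ContinuousOn (asum a g k) Y := by
  refine continuousOn_finsetSum _ fun j hj => ?_
  exact ha.comp (g ^ j).continuous.continuousOn (h j (Finset.mem_range.1 hj))

theorem ssum_cont {a : ℂ → ℂ} {g : ℂ ≃ₜ ℂ} {S Y : Set ℂ} (ha : ContinuousOn a S) (k : ℕ)
    (h : ∀ j < k, ∀ y ∈ Y, (g ^ j) y ∈ S) : ContinuousOn (ssum a g k) Y := by
  refine continuousOn_finsetSum _ fun j hj => ?_
  exact asum_cont ha j fun i hi => h i (hi.trans (Finset.mem_range.1 hj))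

theorem asum_exp {a : ℂ → ℂ} {g : ℂ ≃ₜ ℂ} {z0 : ℂ} (k : ℕ) {y : ℂ}
    (h : ∀ j < k, g ((g ^ j) y) - z0 = ((g ^ j) y - z0) * exp (a ((g ^ j) y))) :
    (g ^ k) y - z0 = (y - z0) * exp (asum a g k y) := by
  induction k with
  | zero => simp [asum]
  | succ k ih =>
    rw [pow_succ_app', h k (Nat.lt_succ_self k), ih fun j hj => h j (hj.trans (Nat.lt_succ_self k))]
    have : asum a g (k + 1) y = asum a g k y + a ((g ^ k) y) := by
      simp only [asum, Finset.sum_range_succ]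
    rw [this, exp_add]; ring

theorem fix_pow {g : ℂ ≃ₜ ℂ} {z : ℂ} (hz : g z = z) (k : ℕ) : (g ^ k) z = z := by
  induction k with
  | zero => rfl
  | succ k ih => rw [pow_succ_app, hz, ih]

theorem mulEq_pow {ζ : ℂ} (h : ζ ≠ 0) {p : ℕ} (hp : ζ ^ p = 1) : mulEq ζ h ^ p = 1 := by
  have : ∀ k : ℕ, ∀ z, (mulEq ζ h ^ k) z = ζ ^ k * z := fun k => by
    induction k with
    | zero => intro z; rw [pow_zero, pow_zero, one_mul]; rfl
    | succ k ih =>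
      intro z
      rw [pow_succ]
      change (mulEq ζ h ^ k) (mulEq ζ h z) = _
      rw [ih, mulEq_apply]; ring
  ext1
  funext z
  rw [this, hp, one_mul]; rfl

theorem no_two {g : ℂ ≃ₜ ℂ} {p : ℕ} (hp : p.Prime) (hg : g ^ p = 1) (hd : Deg g 1) {z0 z1 q : ℂ}
    (h0 : g z0 = z0) (h1 : g z1 = z1) (hne : z1 ≠ z0) (hq : g q ≠ q) : False := by
  have hp0 : (p : ℂ) ≠ 0 := by exact_mod_cast hp.ne_zero
  obtain ⟨a0, ha0, hae0⟩ := hd z0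
  let a : ℂ → ℂ := fun y => a0 y - a0 z1
  have ha : ContinuousOn a {z0}ᶜ := ha0.sub continuousOn_const
  have hae : ∀ y, y ≠ z0 → g y - z0 = (y - z0) * exp (a y) := fun y hy => by
    have e1 := hae0 y hy
    have e2 := hae0 z1 hne
    simp only [h0, h1, zpow_one] at e1 e2
    rw [div_self (sub_ne_zero.2 hne)] at e2
    simp only [a]
    rw [exp_sub, ← e1, ← e2]
    have := sub_ne_zero.2 hy
    field_simp
  have hpw : ∀ (j : ℕ) y, y ≠ z0 → (g ^ j) y ≠ z0 := fun j y hy e => by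
    rw [← fix_pow h0 j] at e
    exact hy ((g ^ j).injective e)
  have hak : ∀ k y, y ≠ z0 → (g ^ k) y - z0 = (y - z0) * exp (asum a g k y) := fun k y hy =>
    asum_exp k fun j _ => hae _ (hpw j y hy)
  have hpc : IsPreconnected ({z0}ᶜ : Set ℂ) :=
    (isConnected_compl_singleton_of_one_lt_rank (by simp) z0).isPreconnected
  have hap : ∀ y, y ≠ z0 → asum a g p y = 0 := fun y hy => by
    have : asum a g p y = asum a g p z1 := by
      refine const_of_exp_eq_one hpc (asum_cont ha p fun j _ y hy => hpw j y hy) (fun y hy => ?_) hy hne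
      have := hak p y hy
      rw [hg] at this
      have h3 := sub_ne_zero.2 (show y ≠ z0 from hy)
      change y - z0 = _ at this
      exact (mul_left_cancel₀ h3 (by rw [← this, mul_one]))
    rw [this]
    simp [asum, fix_pow h1, a]
  clear_value a
  let E : ℂ → ℂ := fun y => z0 + (y - z0) * exp (ssum a g p y / p)
  have hEz0 : E z0 = z0 := by simp [E]
  have hEg : ∀ y, E (g y) = E y := fun y => by
    by_cases hy : y = z0
    · rw [hy, h0]
    simp only [E]
    rw [ssum_g, hap y hy, hae y hy, add_zero, sub_div, exp_sub, mul_div_cancel_left₀ _ hp0]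
    have := exp_ne_zero (a y)
    field_simp
  have hEid : ∀ y, g y = y → E y = y := fun y hy => by
    by_cases hy0 : y = z0
    · rw [hy0, hEz0]
    have h3 := hap y hy0
    simp only [asum, fix_pow hy, Finset.sum_const, Finset.card_range, nsmul_eq_mul] at h3
    have h4 := (mul_eq_zero.1 h3).resolve_left hp0
    simp [E, ssum, asum, fix_pow hy, h4]
  have hprod : ∀ y, (E y - z0) ^ p = ∏ k ∈ Finset.range p, ((g ^ k) y - z0) := fun y => by
    by_cases hy : y = z0
    · rw [hy, hEz0]
      simp only [fix_pow h0, sub_self, Finset.prod_const, Finset.card_range]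
    rw [Finset.prod_congr rfl fun k _ => hak k y hy, Finset.prod_mul_distrib, ← exp_sum]
    simp only [E, add_sub_cancel_left, mul_pow, Finset.prod_const, Finset.card_range]
    rw [← exp_nat_mul, mul_div_cancel₀ _ hp0]; rfl
  have hSc : ContinuousOn (ssum a g p) {z0}ᶜ := ssum_cont ha p fun j _ y hy => hpw j y hy
  have hEc : Continuous E := by
    rw [continuous_iff_continuousAt]
    intro y
    by_cases hy : y = z0
    · rw [hy]
      have c1 : Continuous fun y => ∏ k ∈ Finset.range p, ((g ^ k) y - z0) :=
        continuous_finsetProd _ fun k _ => (g ^ k).continuous.sub continuous_const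
      have c2 : Tendsto (fun y => ‖E y - z0‖ ^ p) (𝓝 z0) (𝓝 0) := by
        have := (c1.norm.tendsto z0)
        simp only [← hprod, norm_pow, hEz0, sub_self, norm_zero] at this
        rwa [zero_pow hp.ne_zero] at this
      have c3 : Tendsto (fun y => ‖E y - z0‖) (𝓝 z0) (𝓝 0) := by
        rw [Metric.tendsto_nhds] at c2 ⊢
        intro ε hε
        filter_upwards [c2 (ε ^ p) (by positivity)] with y hy
        simp only [dist_zero_right, norm_pow, norm_norm] at hy ⊢
        exact lt_of_pow_lt_pow_left₀ p hε.le hy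
      rw [ContinuousAt, hEz0]
      exact tendsto_iff_norm_sub_tendsto_zero.2 c3
    · have : ContinuousOn E {z0}ᶜ := by
        simp only [E]
        exact continuousOn_const.add ((by fun_prop : ContinuousOn (fun y => y - z0) _).mul
          (continuous_exp.comp_continuousOn (hSc.div_const _)))
      exact this.continuousAt (isOpen_compl_singleton.mem_nhds hy)
  -- far
  obtain ⟨R, hR, hRm⟩ := far_sub_farInv g p (‖q - z0‖ + 1 + ‖z0‖)
  have hfarE : ∀ y ∈ Far R, E y - z0 ∈ Far (‖q - z0‖ + 1) := fun y hy => by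
    have : (‖q - z0‖ + 1) ^ p ≤ ‖E y - z0‖ ^ p := by
      rw [← norm_pow, hprod, norm_prod, ← Finset.card_range p, ← Finset.prod_const,
        Finset.card_range]
      refine Finset.prod_le_prod (fun _ _ => by positivity) fun k hk => ?_
      have h3 : ‖q - z0‖ + 1 + ‖z0‖ ≤ ‖(g ^ k) y‖ := farInv_mem (hRm hy) (Finset.mem_range.1 hk)
      have := norm_sub_norm_le ((g ^ k) y) z0
      linarith
    exact le_of_pow_le_pow_left₀ hp.ne_zero (norm_nonneg _) this
  have hyz : ∀ y ∈ Far R, y ≠ z0 := fun y hy e => by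
    have := hfarE y hy
    rw [e, hEz0, sub_self] at this
    exact far_ne (by positivity) this rfl
  refine claimD (v := fun y => E y - q) (R := max R (‖z0‖ + 1)) hp hg
    (mulEq_pow one_ne_zero (one_pow p))
    (good_mul hd 1 one_ne_zero) (hEc.sub continuous_const) (fun z => ?_) (fun z hz e => ?_) ?_
  · rw [mulEq_apply, one_mul, hEg]
  · rw [hEid z hz, sub_eq_zero] at e
    rw [e] at hz; exact hq hz
  · have l1 := ((logOn_far_sub (q - z0)).comp (φ := fun y => E y - z0) (T := Far R)
      (by fun_prop) hfarE).mono (far_mono (le_max_left R (‖z0‖ + 1)))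
    have l2 : LogOn (fun y => exp (ssum a g p y / p)) (Far (max R (‖z0‖ + 1))) :=
      ⟨fun y => ssum a g p y / p, (hSc.div_const _).mono fun y hy =>
        hyz y (far_mono (le_max_left _ _) hy), fun _ _ => rfl⟩
    have l3 := (logOn_far_sub z0).mono (far_mono (le_max_right R (‖z0‖ + 1)))
    refine ((l1.mul l2).mul l3).congr fun y hy => ?_
    have n1 : E y - z0 ≠ 0 := far_ne (by positivity) (hfarE y (far_mono (le_max_left _ _) hy))
    have n2 : y ≠ 0 := far_ne (by positivity) hy
    have n3 : E y - z0 = (y - z0) * exp (ssum a g p y / p) := by simp only [E]; ring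
    rw [div_mul_eq_mul_div, div_mul_div_comm]
    rw [div_eq_div_iff n2 (mul_ne_zero n1 n2)]
    linear_combination (E y - q) * y * n3

theorem has_fix {g : ℂ ≃ₜ ℂ} {p : ℕ} (hp : p.Prime) (hg : g ^ p = 1) (hd : Deg g 1) :
    ∃ z, g z = z := by
  by_contra! hcon
  have hp0 : (p : ℂ) ≠ 0 := by exact_mod_cast hp.ne_zero
  obtain ⟨R0, hR0, a, ha, hae⟩ := (hd 0).far
  simp only [zpow_one] at hae
  have hae : ∀ y ∈ Far R0, g y - 0 = (y - 0) * exp (a y) := fun y hy => by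
    have := far_ne hR0 hy
    rw [← hae y hy]; field_simp; ring
  obtain ⟨R1, hR1, hsub⟩ := far_sub_farInv g p R0
  have hak : ∀ k ≤ p, ∀ y ∈ Far R1, (g ^ k) y - 0 = (y - 0) * exp (asum a g k y) :=
    fun k hk y hy => asum_exp k fun j hj => hae _ (farInv_mem (hsub hy) (hj.trans_le hk))
  have hR1m : ((R1 : ℝ) : ℂ) ∈ Far R1 := by
    change R1 ≤ ‖((R1 : ℝ) : ℂ)‖
    rw [norm_real, Real.norm_eq_abs]; exact le_abs_self _
  set c := asum a g p R1 with hc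
  have hexp : ∀ y ∈ Far R1, exp (asum a g p y) = 1 := fun y hy => by
    have h1 := hak p le_rfl y hy
    rw [hg] at h1
    change y - 0 = _ at h1
    have := far_ne hR1 hy
    simp only [sub_zero] at h1
    exact mul_left_cancel₀ this (by rw [← h1, mul_one])
  have hap : ∀ y ∈ Far R1, asum a g p y = c := fun y hy =>
    const_of_exp_eq_one (isPreconnected_far hR1)
      (asum_cont ha p fun j hj y hy => farInv_mem (hsub hy) hj) hexp hy hR1m
  set Y := FarInv g p R1 with hYd
  have hYR : Y ⊆ Far R1 := farInv_sub hp.pos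
  have hYi := farInv_inv hp.pos hg R1
  have hSc : ContinuousOn (ssum a g p) Y :=
    ssum_cont ha p fun j hj y hy => farInv_mem (hsub (hYR hy)) hj
  set ζ := exp (c / p) with hζ
  have hζ0 : ζ ≠ 0 := exp_ne_zero _
  have hζp : ζ ^ p = 1 := by
    rw [hζ, ← exp_nat_mul, mul_div_cancel₀ _ hp0, hc]; exact hexp _ hR1m
  let E : ℂ → ℂ := fun y => y * exp (ssum a g p y / p)
  have hEc : ContinuousOn E Y :=
    continuousOn_id.mul (continuous_exp.comp_continuousOn (hSc.div_const _))
  have hEg : ∀ y ∈ Y, E (g y) = ζ * E y := fun y hy => by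
    have h1 := hae y (farInv_mem (hsub (hYR hy)) (k := 0) hp.pos)
    simp only [sub_zero] at h1
    simp only [E]
    rw [ssum_g, hap y (hYR hy), h1, sub_div, exp_sub, mul_div_cancel_left₀ _ hp0, add_div, exp_add]
    have := exp_ne_zero (a y)
    field_simp
    rw [hζ]
  obtain ⟨E1, hE1, hE1Y⟩ := tietze (farInv_closed g p R1) hEc
  obtain ⟨v, hv, hve, hvY⟩ := average hp.pos hg (mulEq_pow hζ0 hζp) hYi hE1 (fun z hz => by
    rw [hE1Y hz, hE1Y ((hYi z).2 hz), hEg z hz, mulEq_apply])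
  obtain ⟨R2, hR2, hs2⟩ := far_sub_farInv g p R1
  refine claimD (R := R2) hp hg (mulEq_pow hζ0 hζp) (good_mul hd ζ hζ0) hv hve
    (fun z hz => (hcon z hz).elim)
    ⟨fun y => ssum a g p y / p, (hSc.div_const _).mono hs2, fun y hy => ?_⟩
  simp only [hvY (hs2 hy), hE1Y (hs2 hy)]
  have := far_ne hR2 hy
  simp only [E]; field_simp

theorem unique_fix {g : ℂ ≃ₜ ℂ} {n : ℕ} (hn : 0 < n) (hg : g ^ n = 1) (hd : Deg g 1) (h1 : g ≠ 1) :
    ∃ z, g z = z ∧ ∀ w, g w = w → w = z := by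
  have hfo : 0 < orderOf g := orderOf_pos_iff.2 (isOfFinOrder_iff_pow_eq_one.2 ⟨n, hn, hg⟩)
  have ho1 : orderOf g ≠ 1 := fun h => h1 (orderOf_eq_one_iff.1 h)
  have hp := Nat.minFac_prime ho1
  set p := (orderOf g).minFac
  obtain ⟨k, hk⟩ := Nat.minFac_dvd (orderOf g)
  have hhp : (g ^ k) ^ p = 1 := by rw [← pow_mul, mul_comm, ← hk]; exact pow_orderOf_eq_one g
  have hhd : Deg (g ^ k) 1 := by simpa using hd.pow k
  have hh1 : g ^ k ≠ 1 := fun h => by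
    have h2 := Nat.le_of_dvd (Nat.pos_of_ne_zero (fun h => by
      rw [h, mul_zero] at hk; omega)) (orderOf_dvd_of_pow_eq_one h)
    have := hp.two_le
    nlinarith
  obtain ⟨q, hq⟩ : ∃ q, (g ^ k) q ≠ q := by
    by_contra! hcon
    exact hh1 (Homeomorph.ext hcon)
  obtain ⟨z, hz⟩ := has_fix hp hhp hhd
  have huniq : ∀ w, (g ^ k) w = w → w = z := fun w hw => by
    by_contra hne
    exact no_two hp hhp hhd hz hw hne hq
  refine ⟨z, huniq _ ?_, fun w hw => huniq w (fix_pow hw k)⟩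
  rw [← pow_succ_app, pow_succ_app', hz]

end KK

end

section

namespace KK
open Complex Set Metric Filter Topology

theorem homeo_of_iterate {f : ℂ → ℂ} (hf : Continuous f) {n : ℕ} (hn : 0 < n)
    (h : ∀ w, f^[n] w = w) : ∃ F : ℂ ≃ₜ ℂ, (∀ w, F w = f w) ∧ F ^ n = 1 := by
  let F : ℂ ≃ₜ ℂ :=
    { toFun := f
      invFun := f^[n - 1]
      left_inv := fun w => by
        rw [← Function.iterate_succ_apply, Nat.succ_eq_add_one, Nat.sub_add_cancel hn, h]
      right_inv := fun w => by
        rw [← Function.iterate_succ_apply' f, Nat.succ_eq_add_one, Nat.sub_add_cancel hn, h]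
      continuous_toFun := hf
      continuous_invFun := hf.iterate _ }
  refine ⟨F, fun _ => rfl, ?_⟩
  have : ∀ k w, (F ^ k) w = f^[k] w := fun k => by
    induction k with
    | zero => intro w; rfl
    | succ k ih => intro w; rw [pow_succ_app, ih, Function.iterate_succ_apply]; rfl
  ext w
  rw [this, h]; rfl

theorem sq_eq_one {f : ℂ ≃ₜ ℂ} {n : ℕ} (hn : 0 < n) (hf : f ^ n = 1) (hd : Deg f (-1)) :
    f * f = 1 := by
  by_contra hne
  have hgd : Deg (f * f) 1 := by simpa using hd.mul hd
  have hgn : (f * f) ^ n = 1 := by rw [← pow_two, ← pow_mul, mul_comm, pow_mul, hf, one_pow]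
  obtain ⟨z0, hz0, hu⟩ := unique_fix hn hgn hgd hne
  have hfz : f z0 = z0 := hu _ (congrArg f hz0)
  obtain ⟨b, hb, hbe⟩ := hd z0
  have hbe : ∀ y, y ≠ z0 → f y - z0 = (y - z0)⁻¹ * exp (b y) := fun y hy => by
    have := hbe y hy
    simp only [hfz, zpow_neg, zpow_one, div_inv_eq_mul] at this
    rw [← this]
    have := sub_ne_zero.2 hy
    field_simp
  have hen : ∀ w, z0 + exp w ≠ z0 := fun w e => exp_ne_zero w (by simp at e)
  let φ : ℂ → ℂ := fun w => - w + b (z0 + exp w)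
  have hφc : Continuous φ := by
    have : Continuous fun w => b (z0 + exp w) := by
      rw [← continuousOn_univ]
      exact hb.comp (by fun_prop) fun w _ => hen w
    exact continuous_neg.add this
  have hφf : ∀ w, z0 + exp (φ w) = f (z0 + exp w) := fun w => by
    have h1 := hbe _ (hen w)
    rw [add_sub_cancel_left] at h1
    simp only [φ, exp_add, exp_neg]
    rw [← h1]; ring
  have hφk : ∀ k w, z0 + exp (φ^[k] w) = (f ^ k) (z0 + exp w) := fun k => by
    induction k with
    | zero => intro w; rfl
    | succ k ih => intro w; rw [Function.iterate_succ_apply, ih, hφf, pow_succ_app]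
  have hexp : ∀ w, exp (φ^[n] w - w) = 1 := fun w => by
    have h1 := hφk n w
    rw [hf] at h1
    have h2 : exp (φ^[n] w) = exp w := add_left_cancel h1
    rw [exp_sub, h2, div_self (exp_ne_zero _)]
  set c := φ^[n] 0 - 0 with hc
  have hconst : ∀ w, φ^[n] w = w + c := fun w => by
    have := const_of_exp_eq_one (S := univ) isPreconnected_univ (c := fun w => φ^[n] w - w)
      ((hφc.iterate n).sub continuous_id).continuousOn (fun y _ => hexp y)
      (x := w) (y := 0) trivial trivial
    simp only [← hc] at this
    rw [← this]; ring
  have hc1 : exp c = 1 := hexp 0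
  have h2 : φ (φ^[n] 0) = φ^[n] (φ 0) := by
    rw [← Function.iterate_succ_apply' φ, Function.iterate_succ_apply]
  have h3 : φ (0 + c) = φ 0 - c := by
    simp only [φ, exp_add, hc1, mul_one]; ring
  rw [hconst, hconst, h3] at h2
  have hc0 : c = 0 := by linear_combination -(1/2 : ℂ) * h2
  obtain ⟨F, hF, hFn⟩ := homeo_of_iterate hφc hn fun w => by rw [hconst, hc0, add_zero]
  have hd2 : Deg (F * F) 1 := by
    rcases deg_cases F with h | h
    · simpa using h.mul h
    · simpa using h.mul h
  have hn2 : (F * F) ^ n = 1 := by rw [← pow_two, ← pow_mul, mul_comm, pow_mul, hFn, one_pow]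
  obtain ⟨w, hw⟩ : ∃ w, (F * F) w = w := by
    by_cases h : F * F = 1
    · exact ⟨0, by rw [h]; rfl⟩
    · obtain ⟨w, hw, -⟩ := unique_fix hn hn2 hd2 h
      exact ⟨w, hw⟩
  refine hen w (hu _ ?_)
  rw [hmul_apply, hF, hF] at hw
  rw [hmul_apply, ← hφf, ← hφf, hw]

end KK

end

section

namespace KK
open Complex Set Metric Filter Topology


theorem conj_eq_neg_of_exp {c : ℂ} (h : exp c = 1) : (starRingEnd ℂ) c = -c := by
  obtain ⟨n, rfl⟩ := exp_eq_one_iff.1 h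
  have h2 : (starRingEnd ℂ) (2:ℂ) = 2 := map_ofNat _ 2
  simp [conj_ofReal, h2]

theorem conjlog {f : ℂ ≃ₜ ℂ} (hff : ∀ z, f (f z) = z) {b y0 : ℂ}
    {S S' : Set ℂ}
    (hS : IsPreconnected S) (hSS : S ⊆ S') (hfS : MapsTo f S S') (hy0 : y0 ∈ S) (hfy0 : f y0 ∈ S)
    {a : ℂ → ℂ} (ha : ContinuousOn a S') (hb : ∀ y ∈ S', y ≠ b)
    (hae : ∀ y ∈ S', f y - b = (starRingEnd ℂ) (y - b) * exp (a y)) :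
    ∀ y ∈ S, (starRingEnd ℂ) (a y) + a (f y) = 0 := by
  have hexp : ∀ y ∈ S, exp ((starRingEnd ℂ) (a y) + a (f y)) = 1 := fun y hy => by
    have h1 := hae y (hSS hy)
    have h2 := hae (f y) (hfS hy)
    rw [hff, h1, map_mul, conj_conj, ← exp_conj, mul_assoc, ← exp_add] at h2
    exact mul_left_cancel₀ (sub_ne_zero.2 (hb y (hSS hy))) (by rw [← h2, mul_one])
  have hc : ContinuousOn (fun y => (starRingEnd ℂ) (a y) + a (f y)) S :=
    (continuous_conj.comp_continuousOn (ha.mono hSS)).add (ha.comp f.continuous.continuousOn hfS)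
  have hconst := fun y (hy : y ∈ S) => const_of_exp_eq_one hS hc hexp hy hy0
  have h1 := hconst _ hfy0
  have h2 := conj_eq_neg_of_exp (hexp _ hy0)
  simp only [hff] at h1
  have h0 : (starRingEnd ℂ) (a y0) + a (f y0) = 0 := by
    simp only [map_add, conj_conj] at h2
    linear_combination (-1/2 : ℂ) * h1 + (1/2 : ℂ) * h2
  intro y hy
  exact (hconst y hy).trans h0

theorem E_equivar {f : ℂ ≃ₜ ℂ} {b y : ℂ} {a : ℂ → ℂ} (hae : f y - b = (starRingEnd ℂ) (y - b) * exp (a y))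
    (h : (starRingEnd ℂ) (a y) + a (f y) = 0) :
    (f y - b) * exp ((starRingEnd ℂ) (a (f y)) / 2) = (starRingEnd ℂ) ((y - b) * exp ((starRingEnd ℂ) (a y) / 2)) := by
  have h1 : (starRingEnd ℂ) (a (f y)) = - a y := by
    have := congrArg (starRingEnd ℂ) h
    simp only [map_add, conj_conj, map_zero] at this
    linear_combination this
  rw [hae, h1, map_mul, ← exp_conj, mul_assoc, ← exp_add]
  simp only [map_div₀, conj_conj, map_ofNat]
  congr 2; ring

theorem EL {f : ℂ ≃ₜ ℂ} (hd : Deg f (-1)) (hf : f * f = 1) :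
    ∃ σ : ℂ → ℝ, (∀ s : ℂ → ℝ, ContinuousOn s {z | f z = z} → (∀ y, f y = y → s y ≠ 0) →
        (∃ R, ∀ y, f y = y → y ∈ Far R → 0 < s y * σ y) → False) ∧
      ∀ b, f b = b → ∃ e : ℂ → ℝ, ContinuousOn e ({z | f z = z} \ {b}) ∧
        (∀ y, f y = y → y ≠ b → e y ≠ 0) ∧ ∃ R, ∀ y, f y = y → y ∈ Far R → 0 < e y * σ y := by
  have hff : ∀ z, f (f z) = z := fun z => congrArg (fun h : ℂ ≃ₜ ℂ => h z) hf
  have hf2 : f ^ 2 = 1 := by rw [pow_two, hf]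
  -- the log at infinity
  obtain ⟨R0, hR0, hl0⟩ := (hd 0).far
  have hl1 : LogOn (fun y => f y / (starRingEnd ℂ) y) (Far R0) := by
    refine (hl0.div (logOn_conj_mul (S := Far R0) fun h => far_ne hR0 h rfl)).congr fun y hy => ?_
    have h1 := far_ne hR0 hy
    have h2 := (map_ne_zero (starRingEnd ℂ)).2 h1
    simp only [zpow_neg, zpow_one, div_inv_eq_mul]
    field_simp
  obtain ⟨a, ha, hae⟩ := hl1
  have hae : ∀ y ∈ Far R0, f y - 0 = (starRingEnd ℂ) (y - 0) * exp (a y) := fun y hy => by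
    have h2 := (map_ne_zero (starRingEnd ℂ)).2 (far_ne hR0 hy)
    rw [← hae y hy, sub_zero, sub_zero]; field_simp
  obtain ⟨R1, hR1, hs1⟩ := far_sub_farInv f 2 R0
  have hfar1 : ∀ R', FarInv f 2 R' ⊆ Far R' := fun R' => farInv_sub (by norm_num)
  have hfm : ∀ {R' y}, y ∈ FarInv f 2 R' → f y ∈ Far R' := fun {R' y} hy => by
    simpa using farInv_mem hy (k := 1) (by norm_num)
  obtain ⟨R2, hR2, hs2⟩ := far_sub_farInv f 2 R1
  have hmem : ∀ {R : ℝ}, ((R : ℝ) : ℂ) ∈ Far R := fun {R} => by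
    change R ≤ ‖((R : ℝ) : ℂ)‖
    rw [norm_real, Real.norm_eq_abs]; exact le_abs_self _
  have hc0 : ∀ y ∈ Far R1, (starRingEnd ℂ) (a y) + a (f y) = 0 :=
    conjlog (b := 0) hff (isPreconnected_far hR1) (hs1.trans (hfar1 R0)) (fun y hy => hfm (hs1 hy))
      (hfar1 _ (hs2 hmem)) (hfm (hs2 (hmem (R := R2)))) ha (fun y hy => far_ne hR0 hy) hae
  have hR10 : Far R1 ⊆ Far R0 := hs1.trans (hfar1 R0)
  let E : ℂ → ℂ := fun y => (y - 0) * exp ((starRingEnd ℂ) (a y) / 2)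
  have hEc : ContinuousOn E (Far R1) := (by fun_prop : ContinuousOn (fun y : ℂ => y - 0) _).mul
    (continuous_exp.comp_continuousOn ((continuous_conj.comp_continuousOn (ha.mono hR10)).div_const _))
  have hEf : ∀ y ∈ Far R1, E (f y) = (starRingEnd ℂ) (E y) := fun y hy => E_equivar (hae y (hR10 hy)) (hc0 y hy)
  have hE0 : ∀ y ∈ Far R1, E y ≠ 0 := fun y hy => by
    simp only [E, sub_zero]
    exact mul_ne_zero (far_ne hR1 hy) (exp_ne_zero _)
  have hEr : ∀ y ∈ Far R1, f y = y → E y = ((E y).re : ℂ) := fun y hy h => by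
    have := hEf y hy
    rw [h] at this
    exact (conj_eq_iff_re.1 this.symm).symm
  have hEl : LogOn (fun y => E y / y) (Far R1) :=
    ⟨fun y => (starRingEnd ℂ) (a y) / 2, (continuous_conj.comp_continuousOn (ha.mono hR10)).div_const _,
      fun y hy => by
        have := far_ne hR1 hy
        simp only [E, sub_zero]; field_simp⟩
  refine ⟨fun y => (E y).re, ?_, ?_⟩
  · rintro s hs hs0 ⟨R, hR⟩
    set R3 := max R R1
    set Y := FarInv f 2 R3
    have hYi := farInv_inv (by norm_num) hf2 R3
    have hY3 : Y ⊆ Far R3 := hfar1 _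
    have hY1 : Y ⊆ Far R1 := hY3.trans (far_mono (le_max_right _ _))
    have hC : IsClosed {z | f z = z} := isClosed_eq f.continuous continuous_id
    obtain ⟨v1, hv1, hvY, hvC⟩ := glue (farInv_closed f 2 R3) hC
      (u := fun y => E y / (‖E y‖ : ℝ)) (w := fun y => ((s y / |s y| : ℝ) : ℂ))
      ((hEc.mono hY1).div (continuous_ofReal.comp_continuousOn (hEc.mono hY1).norm)
        fun y hy => by exact_mod_cast norm_ne_zero_iff.2 (hE0 y (hY1 hy)))
      (continuous_ofReal.comp_continuousOn (hs.div hs.abs fun y hy => abs_ne_zero.2 (hs0 y hy)))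
      (fun y hyY hyC => by
        have h1 := hR y hyC (far_mono (le_max_left _ _) (hY3 hyY))
        have h2 := hEr y (hY1 hyY) hyC
        rw [h2, norm_real, Real.norm_eq_abs]
        rw [← ofReal_div]
        congr 1
        rcases pos_and_pos_or_neg_and_neg_of_mul_pos h1 with ⟨p1, p2⟩ | ⟨p1, p2⟩
        · rw [abs_of_pos p1, abs_of_pos p2, div_self p1.ne', div_self p2.ne']
        · rw [abs_of_neg p1, abs_of_neg p2, div_neg, div_neg, div_self p1.ne, div_self p2.ne])
    have hρ : conjCLE ^ 2 = 1 := by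
      ext1; funext z
      rw [pow_two]
      change conjCLE (conjCLE z) = z
      simp
    obtain ⟨v, hv, hve, hvv⟩ := average (g := f) (p := 2) (Y := Y ∪ {z | f z = z}) (by norm_num)
      hf2 hρ (fun z => by
        simp only [mem_union, hYi, mem_ofPred_eq, hff, Y]
        refine or_congr_right ⟨fun h => h.symm, fun h => h.symm⟩) hv1 (by
        rintro z (hz | hz)
        · rw [hvY hz, hvY ((hYi z).2 hz)]
          simp only [hEf z (hY1 hz), conjCLE_apply, norm_conj, map_div₀, conj_ofReal]
        · have hz' : f z = z := hz
          rw [hz', hvC hz, conjCLE_apply, conj_ofReal])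
    obtain ⟨R4, hR4, hs4⟩ := far_sub_farInv f 2 R3
    refine claimD (R := R4) Nat.prime_two hf2 hρ (good_conj hd) hv hve (fun z hz => ?_) ?_
    · rw [hvv (Or.inr hz), hvC hz]
      have := hs0 z hz
      show ((s z / |s z| : ℝ) : ℂ) ≠ 0
      exact_mod_cast div_ne_zero this (abs_ne_zero.2 this)
    · have hsub : Far R4 ⊆ Far R1 := hs4.trans hY1
      refine ((hEl.mono hsub).div (logOn_pos (φ := fun y => ‖E y‖) (hEc.mono hsub).norm
        fun y hy => norm_pos_iff.2 (hE0 y (hsub hy)))).congr fun y hy => ?_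
      rw [hvv (Or.inl (hs4 hy)), hvY (hs4 hy)]
      simp only
      rw [div_right_comm]
  · intro b hb
    obtain ⟨a', ha', hae'⟩ : LogOn (fun y => (f y - b) / (starRingEnd ℂ) (y - b)) {b}ᶜ := by
      have hl : LogOn (fun y => (starRingEnd ℂ) (y - b) * (y - b)) {b}ᶜ :=
        (logOn_conj_mul (S := {0}ᶜ) (by simp)).comp (φ := fun y => y - b) (by fun_prop)
          (fun y hy => sub_ne_zero.2 hy)
      refine ((hd b).div hl).congr fun y hy => ?_
      have h1 : y - b ≠ 0 := sub_ne_zero.2 hy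
      have h2 := (map_ne_zero (starRingEnd ℂ)).2 h1
      simp only [zpow_neg, zpow_one, div_inv_eq_mul, hb]
      field_simp
    have hae' : ∀ y ∈ ({b}ᶜ : Set ℂ), f y - b = (starRingEnd ℂ) (y - b) * exp (a' y) := fun y hy => by
      have h2 := (map_ne_zero (starRingEnd ℂ)).2 (sub_ne_zero.2 (show y ≠ b from hy))
      rw [← hae' y hy]; field_simp
    have hfb : ∀ y, y ≠ b → f y ≠ b := fun y hy e => hy (by rw [← hb] at e; exact f.injective e)
    have hpc : IsPreconnected ({b}ᶜ : Set ℂ) :=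
      (isConnected_compl_singleton_of_one_lt_rank (by simp) b).isPreconnected
    have hb1 : b + 1 ≠ b := by simp
    have hc0' : ∀ y ∈ ({b}ᶜ : Set ℂ), (starRingEnd ℂ) (a' y) + a' (f y) = 0 :=
      conjlog (y0 := b + 1) hff hpc (subset_refl _) (fun y hy => hfb y hy)
        hb1 (hfb _ hb1) ha' (fun y hy => hy) hae'
    let B : ℂ → ℂ := fun y => (y - b) * exp ((starRingEnd ℂ) (a' y) / 2)
    have hBc : ContinuousOn B {b}ᶜ := (by fun_prop : ContinuousOn (fun y : ℂ => y - b) _).mul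
      (continuous_exp.comp_continuousOn ((continuous_conj.comp_continuousOn ha').div_const _))
    have hBf : ∀ y, y ≠ b → B (f y) = (starRingEnd ℂ) (B y) := fun y hy => E_equivar (hae' y hy) (hc0' y hy)
    have hB0 : ∀ y, y ≠ b → B y ≠ 0 := fun y hy => 
      mul_ne_zero (sub_ne_zero.2 hy) (exp_ne_zero _)
    have hBr : ∀ y, y ≠ b → f y = y → B y = ((B y).re : ℂ) := fun y hy h => by
      have := hBf y hy
      rw [h] at this
      exact (conj_eq_iff_re.1 this.symm).symm
    -- compare with E at infinity
    set R3 := max R1 (‖b‖ + 1)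
    have hR3 : 0 < R3 := by positivity
    have h31 : Far R3 ⊆ Far R1 := far_mono (le_max_left _ _)
    have h3b : Far R3 ⊆ Far (‖b‖ + 1) := far_mono (le_max_right _ _)
    have hnb : ∀ y ∈ Far R3, y ≠ b := fun y hy e => by
      have : ‖b‖ + 1 ≤ ‖y‖ := h3b hy
      rw [e] at this; linarith
    obtain ⟨h, hh, hhe⟩ : LogOn (fun y => B y / E y) (Far R3) := by
      have l1 : LogOn (fun y => exp ((starRingEnd ℂ) (a' y) / 2)) (Far R3) :=
        ⟨fun y => (starRingEnd ℂ) (a' y) / 2, ((continuous_conj.comp_continuousOn ha').div_const _).mono hnb,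
          fun _ _ => rfl⟩
      refine ((l1.mul ((logOn_far_sub b).mono h3b)).div (hEl.mono h31)).congr fun y hy => ?_
      have n1 := far_ne hR3 hy
      have n2 := hE0 y (h31 hy)
      have n3 : B y = (y - b) * exp ((starRingEnd ℂ) (a' y) / 2) := rfl
      rw [n3]
      generalize E y = e at n2 ⊢
      field_simp
    obtain ⟨R4, hR4, hs4⟩ := far_sub_farInv f 2 R3
    have h43 : Far R4 ⊆ Far R3 := hs4.trans (hfar1 _)
    have hcc : ContinuousOn (fun y => h (f y) - (starRingEnd ℂ) (h y)) (Far R4) :=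
      (hh.comp f.continuous.continuousOn fun y hy => hfm (hs4 hy)).sub
        (continuous_conj.comp_continuousOn (hh.mono h43))
    have hce : ∀ y ∈ Far R4, exp (h (f y) - (starRingEnd ℂ) (h y)) = 1 := fun y hy => by
      have e1 := hhe _ (hfm (hs4 hy))
      have e2 := hhe _ (h43 hy)
      simp only at e1 e2
      rw [exp_sub, exp_conj, ← e1, ← e2, hBf y (hnb y (h43 hy)), hEf y (h31 (h43 hy)), ← map_div₀]
      apply div_self
      rw [map_ne_zero, e2]; exact exp_ne_zero _
    set c := h (f R4) - (starRingEnd ℂ) (h R4) with hc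
    have hconst : ∀ y ∈ Far R4, h (f y) - (starRingEnd ℂ) (h y) = c := fun y hy =>
      const_of_exp_eq_one (isPreconnected_far hR4) hcc hce hy hmem
    have hc1 : exp c = 1 := hce _ hmem
    obtain ⟨κ, hκ, hκc⟩ : ∃ κ : ℝ, (κ = 1 ∨ κ = -1) ∧ exp (c / 2) = κ := by
      have : exp (c / 2) ^ 2 = 1 := by rw [← exp_nat_mul, ← hc1]; congr 1; push_cast; ring
      rcases mul_self_eq_one_iff.1 ((pow_two _).symm.trans this) with h | h
      · exact ⟨1, Or.inl rfl, by rw [h]; simp⟩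
      · exact ⟨-1, Or.inr rfl, by rw [h]; simp⟩
    have hκ0 : κ ≠ 0 := by rcases hκ with rfl | rfl <;> norm_num
    refine ⟨fun y => κ * (B y).re, ?_, ?_, R4, ?_⟩
    · exact continuousOn_const.mul (continuous_re.comp_continuousOn (hBc.mono fun y hy => hy.2))
    · intro y hy hyb h0
      have h1 := hBr y hyb hy
      rw [(mul_eq_zero.1 h0).resolve_left hκ0] at h1
      exact hB0 y hyb (by simpa using h1)
    · intro y hy hyR
      have h1 := hBr y (hnb y (h43 hyR)) hy
      have h2 := hEr y (h31 (h43 hyR)) hy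
      have h3 := hhe y (h43 hyR)
      have h4 := hconst y hyR
      have h5 := hE0 y (h31 (h43 hyR))
      rw [hy] at h4
      have h6 : h y = (h y).re + c / 2 := by
        rw [← h4]
        have := re_eq_add_conj (h y)
        rw [this]; ring
      have h7 : (B y).re / (E y).re = Real.exp (h y).re * κ := by
        have h8 : B y / E y = exp ((h y).re + c / 2) := by rw [← h6]; exact h3
        rw [h1, h2, exp_add, hκc, ← ofReal_exp] at h8
        exact_mod_cast h8
      have h9 : (E y).re ≠ 0 := fun h0 => h5 (by rw [h2, h0]; simp)
      have h10 : (B y).re = Real.exp (h y).re * κ * (E y).re := by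
        rw [← h7]; field_simp
      simp only
      rw [h10]
      have hk2 : κ * κ = 1 := by rcases hκ with rfl | rfl <;> norm_num
      have : κ * (Real.exp (h y).re * κ * (E y).re) * (E y).re =
        (κ * κ) * (Real.exp (h y).re * ((E y).re * (E y).re)) := by ring
      rw [this, hk2, one_mul]
      exact mul_pos (Real.exp_pos _) (mul_self_pos.2 h9)

end KK

end

section

namespace KK
open Complex Set Metric Filter Topology

theorem fix_nonempty {f : ℂ ≃ₜ ℂ} (hd : Deg f (-1)) (hf : f * f = 1) :
    {z | f z = z}.Nonempty := by
  obtain ⟨σ, h1, -⟩ := EL hd hf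
  by_contra hne
  rw [Set.not_nonempty_iff_eq_empty] at hne
  have hno : ∀ y, f y ≠ y := fun y hy => by
    have : y ∈ {z | f z = z} := hy
    rw [hne] at this; exact this
  exact h1 (fun _ => 1) continuousOn_const (fun _ _ => one_ne_zero)
    ⟨0, fun y hy => (hno y hy).elim⟩

theorem fix_preconn {f : ℂ ≃ₜ ℂ} (hd : Deg f (-1)) (hf : f * f = 1) :
    IsPreconnected {z | f z = z} := by
  classical
  obtain ⟨σ, h1, h2⟩ := EL hd hf
  rintro u v hu hv huv ⟨c, hcC, hcu⟩ ⟨b, hbC, hbv⟩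
  by_contra hne
  rw [Set.not_nonempty_iff_eq_empty] at hne
  have hdis : ∀ y, f y = y → y ∈ u → y ∈ v → False := fun y h1 h2 h3 => by
    have : y ∈ {z | f z = z} ∩ (u ∩ v) := ⟨h1, h2, h3⟩
    rw [hne] at this; exact this
  obtain ⟨eb, hbc, hb0, Rb, hbR⟩ := h2 b hbC
  obtain ⟨ec, hcc, hc0, Rc, hcR⟩ := h2 c hcC
  have nb : ∀ y, y ∈ u → y ≠ b := fun y hy e => hdis b hbC (e ▸ hy) hbv
  have nc : ∀ y, f y = y → y ∉ u → y ≠ c := fun y _ hu e => hu (e ▸ hcu)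
  refine h1 (fun y => if y ∈ u then eb y else ec y) ?_ ?_ ⟨max Rb Rc, ?_⟩
  · apply continuousOn_of_locally_continuousOn
    intro x hx
    rcases huv hx with hxu | hxv
    · refine ⟨u, hu, hxu, (hbc.mono fun y hy => ⟨hy.1, nb y hy.2⟩).congr fun y hy => ?_⟩
      simp only [if_pos hy.2]
    · have key : ∀ y, f y = y → y ∈ v → y ∉ u := fun y a b c => hdis y a c b
      refine ⟨v, hv, hxv, (hcc.mono fun y hy => ⟨hy.1, nc y hy.1 (key y hy.1 hy.2)⟩).congr
        fun y hy => ?_⟩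
      simp only [if_neg (key y hy.1 hy.2)]
  · intro y hy
    by_cases h : y ∈ u
    · simp only [if_pos h]; exact hb0 y hy (nb y h)
    · simp only [if_neg h]; exact hc0 y hy (nc y hy h)
  · intro y hy hR
    by_cases h : y ∈ u
    · simp only [if_pos h]; exact hbR y hy (far_mono (le_max_left _ _) hR)
    · simp only [if_neg h]; exact hcR y hy (far_mono (le_max_right _ _) hR)

theorem fix_not_preconn {f : ℂ ≃ₜ ℂ} (hd : Deg f (-1)) (hf : f * f = 1) {b : ℂ} (hb : f b = b) :
    ¬ IsPreconnected ({z | f z = z} \ {b}) := by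
  intro hp
  obtain ⟨σ, h1, h2⟩ := EL hd hf
  obtain ⟨e, hc, h0, R, hR⟩ := h2 b hb
  have hfar : ∀ y, y ∈ Far (max R (‖b‖ + 1)) → y ≠ b := fun y hy h => by
    have : ‖b‖ + 1 ≤ ‖y‖ := far_mono (le_max_right _ _) hy
    rw [h] at this; linarith
  have hsign : (∀ y, f y = y → y ≠ b → 0 < e y) ∨ (∀ y, f y = y → y ≠ b → e y < 0) := by
    by_contra hcon
    push Not at hcon
    obtain ⟨⟨y, hy, hyb, hy0⟩, ⟨z, hz, hzb, hz0⟩⟩ := hcon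
    have := hp.intermediate_value (show y ∈ _ from ⟨hy, hyb⟩) (show z ∈ _ from ⟨hz, hzb⟩) hc
    obtain ⟨w, hw, hw0⟩ := this ⟨hy0, hz0⟩
    exact h0 w hw.1 hw.2 hw0
  rcases hsign with hs | hs
  · refine h1 (fun _ => 1) continuousOn_const (fun _ _ => one_ne_zero) ⟨max R (‖b‖ + 1), ?_⟩
    intro y hy hyR
    have h3 := hR y hy (far_mono (le_max_left _ _) hyR)
    have h4 := hs y hy (hfar y hyR)
    rw [one_mul]
    exact pos_of_mul_pos_right h3 h4.le
  · refine h1 (fun _ => -1) continuousOn_const (fun _ _ => by norm_num) ⟨max R (‖b‖ + 1), ?_⟩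
    intro y hy hyR
    have h3 := hR y hy (far_mono (le_max_left _ _) hyR)
    have h4 := hs y hy (hfar y hyR)
    nlinarith

end KK

end

section

namespace KK
open Complex Set Metric Filter Topology


/-- `(u1,u2)` is in the complex line associated to the point `(w,t)` of the sphere. -/
def InL (w : ℂ) (t : ℝ) (u1 u2 : ℂ) : Prop :=
  (starRingEnd ℂ) w * u2 = (1 + t) * u1 ∧ w * u1 = (1 - t) * u2

theorem InL.parallel {w t u1 u2 v1 v2} (h : InL w t u1 u2) (h' : InL w t v1 v2) :
    u1 * v2 = u2 * v1 := by
  obtain ⟨a, b⟩ := h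
  obtain ⟨a', b'⟩ := h'
  linear_combination (-1/2 : ℂ) * (v2 * a - v1 * b - u2 * a' + u1 * b')

theorem InL.smul {w t u1 u2} (h : InL w t u1 u2) (c : ℂ) : InL w t (c * u1) (c * u2) := by
  obtain ⟨a, b⟩ := h
  constructor
  · linear_combination c * a
  · linear_combination c * b

theorem nsq_pos {u1 u2 : ℂ} (h : ¬ (u1 = 0 ∧ u2 = 0)) : (starRingEnd ℂ) u1 * u1 + (starRingEnd ℂ) u2 * u2 ≠ 0 := by
  intro h0
  rw [mul_comm, mul_conj, mul_comm, mul_conj] at h0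
  have h1 : normSq u1 + normSq u2 = 0 := by exact_mod_cast h0
  have := normSq_nonneg u1
  have := normSq_nonneg u2
  exact h ⟨normSq_eq_zero.1 (by linarith), normSq_eq_zero.1 (by linarith)⟩

theorem InL.det {w t u1 u2} (h : InL w t u1 u2) :
    w * ((starRingEnd ℂ) u1 * u1 + (starRingEnd ℂ) u2 * u2) = 2 * (starRingEnd ℂ) u1 * u2 ∧
    (t : ℂ) * ((starRingEnd ℂ) u1 * u1 + (starRingEnd ℂ) u2 * u2) = (starRingEnd ℂ) u2 * u2 - (starRingEnd ℂ) u1 * u1 := by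
  obtain ⟨a, b⟩ := h
  have a' := congrArg (starRingEnd ℂ) a
  simp only [map_mul, conj_conj, map_add, map_one, conj_ofReal] at a'
  constructor
  · linear_combination u2 * a' + (starRingEnd ℂ) u1 * b
  · linear_combination (starRingEnd ℂ) u2 * b - u1 * a'

theorem InL.proj {w : ℂ} {t : ℝ} (hs : (starRingEnd ℂ) w * w + t ^ 2 = 1) (u1 u2 : ℂ) :
    InL w t ((1 - t) * u1 + (starRingEnd ℂ) w * u2) (w * u1 + (1 + t) * u2) := by
  constructor
  · linear_combination u1 * hs
  · linear_combination u2 * hs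

theorem InL.proj_ne {w w' : ℂ} {t t' : ℝ} {u1 u2} (h : InL w t u1 u2) (h0 : ¬ (u1 = 0 ∧ u2 = 0))
    (hne : ¬ (w' = - w ∧ t' = -t)) :
    ¬ ((1 - t') * u1 + (starRingEnd ℂ) w' * u2 = 0 ∧ w' * u1 + (1 + t') * u2 = 0) := by
  rintro ⟨h1, h2⟩
  have h' : InL (-w') (-t') u1 u2 := by
    constructor
    · simp only [map_neg, ofReal_neg]; linear_combination -h1
    · simp only [ofReal_neg]; linear_combination -h2
  have hp := nsq_pos h0
  apply hne
  constructor
  · have := mul_right_cancel₀ hp (h.det.1.trans h'.det.1.symm)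
    rw [this, neg_neg]
  · have := mul_right_cancel₀ hp (h.det.2.trans h'.det.2.symm)
    have : t = -t' := by exact_mod_cast this
    rw [this, neg_neg]

def Cls (W : ℂ → ℂ) (T : ℂ → ℝ) (w : ℂ) (t : ℝ) (k : ℤ) : Prop :=
  ∃ (u1 u2 c : ℂ → ℂ) (R : ℝ) (a1 a2 : ℂ), Continuous u1 ∧ Continuous u2 ∧
    (∀ y, ¬ (u1 y = 0 ∧ u2 y = 0)) ∧ (∀ y, InL (W y) (T y) (u1 y) (u2 y)) ∧
    ¬ (a1 = 0 ∧ a2 = 0) ∧ InL w t a1 a2 ∧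
    Tendsto (fun y => c y * u1 y) (cocompact ℂ) (𝓝 a1) ∧
    Tendsto (fun y => c y * u2 y) (cocompact ℂ) (𝓝 a2) ∧
    0 < R ∧ LogOn (fun y => c y / y ^ k) (Far R)

theorem Cls.step {W T w t k} (h : Cls W T w t k) {W' : ℂ → ℂ} {T' : ℂ → ℝ} {w' t'}
    (hW : Continuous W') (hT : Continuous T') (hw : Tendsto W' (cocompact ℂ) (𝓝 w'))
    (ht : Tendsto T' (cocompact ℂ) (𝓝 t')) (hs : ∀ y, (starRingEnd ℂ) (W' y) * W' y + (T' y : ℂ) ^ 2 = 1)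
    (hs' : (starRingEnd ℂ) w' * w' + (t' : ℂ) ^ 2 = 1)
    (hne : ∀ y, ¬ (W' y = - W y ∧ T' y = - T y)) (hne' : ¬ (w' = -w ∧ t' = -t)) :
    Cls W' T' w' t' k := by
  obtain ⟨u1, u2, c, R, a1, a2, hu1, hu2, hu, hL, ha, hLa, hc1, hc2, hR, hl⟩ := h
  have hTc : Continuous (fun y => (T' y : ℂ)) := continuous_ofReal.comp hT
  have htc : Tendsto (fun y => (T' y : ℂ)) (cocompact ℂ) (𝓝 (t' : ℂ)) :=
    (continuous_ofReal.tendsto _).comp ht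
  have hwc : Tendsto (fun y => (starRingEnd ℂ) (W' y)) (cocompact ℂ) (𝓝 ((starRingEnd ℂ) w')) :=
    (continuous_conj.tendsto _).comp hw
  have hWc : Continuous (fun y => (starRingEnd ℂ) (W' y)) := continuous_conj.comp hW
  refine ⟨fun y => (1 - T' y) * u1 y + (starRingEnd ℂ) (W' y) * u2 y, fun y => W' y * u1 y + (1 + T' y) * u2 y,
    c, R, (1 - t') * a1 + (starRingEnd ℂ) w' * a2, w' * a1 + (1 + t') * a2,
    ((continuous_const.sub hTc).mul hu1).add (hWc.mul hu2),
    (hW.mul hu1).add ((continuous_const.add hTc).mul hu2),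
    fun y => (hL y).proj_ne (hu y) (hne y), fun y => InL.proj (hs y) _ _,
    hLa.proj_ne ha hne', InL.proj hs' _ _, ?_, ?_, hR, hl⟩
  · refine (((tendsto_const_nhds.sub htc).mul hc1).add (hwc.mul hc2)).congr fun y => ?_
    ring
  · refine ((hw.mul hc1).add ((tendsto_const_nhds.add htc).mul hc2)).congr fun y => ?_
    ring

theorem LogOn.continuousOn {u S} (h : LogOn u S) : ContinuousOn u S := by
  obtain ⟨a, ha, h⟩ := h
  exact (continuous_exp.comp_continuousOn ha).congr h

theorem far_of_cocompact {p : ℂ → Prop} (h : ∀ᶠ y in cocompact ℂ, p y) :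
    ∃ R, 0 < R ∧ ∀ y ∈ Far R, p y := by
  obtain ⟨K, hK, h⟩ := mem_cocompact.1 h
  obtain ⟨R, hR⟩ := hK.isBounded.exists_norm_le
  refine ⟨|R| + 1, by positivity, fun y hy => h fun hyK => ?_⟩
  have h1 := hR y hyK
  have h2 : |R| + 1 ≤ ‖y‖ := hy
  linarith [le_abs_self R]

theorem lin_factor {w t u1 u2 v1 v2} (h : InL w t u1 u2) (h' : InL w t v1 v2)
    (h0 : ¬ (u1 = 0 ∧ u2 = 0)) :
    v1 = ((starRingEnd ℂ) u1 * v1 + (starRingEnd ℂ) u2 * v2) / ((starRingEnd ℂ) u1 * u1 + (starRingEnd ℂ) u2 * u2) * u1 ∧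
    v2 = ((starRingEnd ℂ) u1 * v1 + (starRingEnd ℂ) u2 * v2) / ((starRingEnd ℂ) u1 * u1 + (starRingEnd ℂ) u2 * u2) * u2 := by
  have hp := nsq_pos h0
  have := h.parallel h'
  constructor
  · rw [div_mul_eq_mul_div, eq_div_iff hp]
    linear_combination (-(starRingEnd ℂ) u2) * this
  · rw [div_mul_eq_mul_div, eq_div_iff hp]
    linear_combination (starRingEnd ℂ) u1 * this

theorem Cls.unique {W T w t k k'} (h : Cls W T w t k) (h' : Cls W T w t k') : k' = k := by
  obtain ⟨u1, u2, c, R, a1, a2, hu1, hu2, hu, hL, ha, hLa, hc1, hc2, hR, hl⟩ := h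
  obtain ⟨v1, v2, d, R', b1, b2, hv1, hv2, hv, hM, hb, hMb, hd1, hd2, hR', hl'⟩ := h'
  let lam : ℂ → ℂ := fun y => ((starRingEnd ℂ) (u1 y) * v1 y + (starRingEnd ℂ) (u2 y) * v2 y) /
    ((starRingEnd ℂ) (u1 y) * u1 y + (starRingEnd ℂ) (u2 y) * u2 y)
  have hlam : ∀ y, v1 y = lam y * u1 y ∧ v2 y = lam y * u2 y := fun y =>
    lin_factor (hL y) (hM y) (hu y)
  have hlam0 : ∀ y, lam y ≠ 0 := fun y h0 => hv y (by
    obtain ⟨e1, e2⟩ := hlam y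
    rw [h0, zero_mul] at e1 e2; exact ⟨e1, e2⟩)
  have hlamc : Continuous lam := by
    have k1 : Continuous fun y => (starRingEnd ℂ) (u1 y) := continuous_conj.comp hu1
    have k2 : Continuous fun y => (starRingEnd ℂ) (u2 y) := continuous_conj.comp hu2
    exact ((k1.mul hv1).add (k2.mul hv2)).div ((k1.mul hu1).add (k2.mul hu2))
      fun y => nsq_pos (hu y)
  obtain ⟨e1, e2⟩ := lin_factor hLa hMb ha
  set m := ((starRingEnd ℂ) a1 * b1 + (starRingEnd ℂ) a2 * b2) / ((starRingEnd ℂ) a1 * a1 + (starRingEnd ℂ) a2 * a2) with hm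
  have hm0 : m ≠ 0 := fun h0 => hb (by rw [h0, zero_mul] at e1 e2; exact ⟨e1, e2⟩)
  have hp := nsq_pos ha
  have tD : Tendsto (fun y => (starRingEnd ℂ) a1 * (c y * u1 y) + (starRingEnd ℂ) a2 * (c y * u2 y)) (cocompact ℂ)
      (𝓝 ((starRingEnd ℂ) a1 * a1 + (starRingEnd ℂ) a2 * a2)) := (hc1.const_mul _).add (hc2.const_mul _)
  have tN : Tendsto (fun y => (starRingEnd ℂ) a1 * (d y * v1 y) + (starRingEnd ℂ) a2 * (d y * v2 y)) (cocompact ℂ)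
      (𝓝 ((starRingEnd ℂ) a1 * b1 + (starRingEnd ℂ) a2 * b2)) := (hd1.const_mul _).add (hd2.const_mul _)
  have tq := ((tN.div tD hp).div_const m)
  rw [← hm, div_self hm0] at tq
  have ev := (tq.eventually (ball_mem_nhds (1:ℂ) one_pos)).and (tD.eventually_ne hp)
  obtain ⟨R1, hR1, hfar⟩ := far_of_cocompact ev
  set S := Far (max R1 (max R R'))
  have s1 : S ⊆ Far R1 := far_mono (le_max_left _ _)
  have s2 : S ⊆ Far R := far_mono ((le_max_left _ _).trans (le_max_right _ _))
  have s3 : S ⊆ Far R' := far_mono ((le_max_right _ _).trans (le_max_right _ _))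
  have hcne : ∀ y ∈ S, c y ≠ 0 := fun y hy h0 => by
    have := hl.ne_zero (s2 hy)
    simp only [h0, zero_div, ne_eq, not_true] at this
  have cont : ∀ {g : ℂ → ℂ} {j : ℤ} {r : ℝ}, 0 < r → LogOn (fun y => g y / y ^ j) (Far r) →
      ContinuousOn g (Far r) := fun {g j r} hr hg => by
    refine (hg.continuousOn.mul (continuousOn_id.zpow₀ j fun y hy => Or.inl (far_ne hr hy))).congr
      fun y hy => ?_
    have := zpow_ne_zero j (far_ne hr hy)
    simp only [Pi.mul_apply, id]
    field_simp
  have hq : LogOn (fun y => d y * lam y / c y / m) S := by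
    refine logOn_of_near_one ?_ ?_
    · exact ((((cont hR' hl').mono s3).mul hlamc.continuousOn).div ((cont hR hl).mono s2)
        hcne).div_const _
    · intro y hy
      obtain ⟨k1, k2⟩ := hfar y (s1 hy)
      have hc0 := hcne y hy
      have key : d y * lam y / c y = ((starRingEnd ℂ) a1 * (d y * v1 y) + (starRingEnd ℂ) a2 * (d y * v2 y)) /
          ((starRingEnd ℂ) a1 * (c y * u1 y) + (starRingEnd ℂ) a2 * (c y * u2 y)) := by
        rw [div_eq_div_iff hc0 k2, (hlam y).1, (hlam y).2]
        ring
      rw [key, ← dist_eq_norm]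
      exact k1
  have hlamL := (logOn_univ hlamc hlam0).mono (subset_univ S)
  refine far_unique (v := d) hl' (R' := max R1 (max R R')) ?_
  refine (((hq.mul (logOn_const hm0 S)).div hlamL).mul (hl.mono s2)).congr fun y hy => ?_
  have hc0 := hcne y hy
  have hl0 := hlam0 y
  have := zpow_ne_zero k (far_ne hR (s2 hy))
  field_simp

end KK

end

section

namespace KK
open Complex Set Metric Filter Topology


noncomputable def toW (x : Sphere2) : ℂ := ⟨x.1 0, x.1 1⟩
noncomputable def toT (x : Sphere2) : ℝ := x.1 2

theorem toT_continuous : Continuous toT := by unfold toT; fun_prop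
theorem toW_continuous : Continuous toW := by
  have : toW = fun x => ((x.1 0 : ℝ) : ℂ) + ((x.1 1 : ℝ) : ℂ) * I := by
    funext x
    apply Complex.ext <;> simp [toW]
  rw [this]
  fun_prop

theorem sphere_iff (v : EuclideanSpace ℝ (Fin 3)) :
    v ∈ Sphere2 ↔ v 0 ^ 2 + v 1 ^ 2 + v 2 ^ 2 = 1 := by
  rw [mem_sphere_zero_iff_norm, ← sq_eq_sq₀ (norm_nonneg _) zero_le_one, EuclideanSpace.norm_sq_eq,
    Fin.sum_univ_three]
  simp

theorem toWT_real (x : Sphere2) : normSq (toW x) + toT x ^ 2 = 1 := by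
  have := (sphere_iff x.1).1 x.2
  rw [normSq_apply, ← this]
  simp only [toW, toT]; ring

theorem toWT (x : Sphere2) : (starRingEnd ℂ) (toW x) * toW x + (toT x : ℂ) ^ 2 = 1 := by
  rw [mul_comm, mul_conj]
  exact_mod_cast toWT_real x

theorem toWT_inj {x y : Sphere2} (h : toW x = toW y) (h' : toT x = toT y) : x = y := by
  apply Subtype.ext
  ext i
  have h0 := congrArg re h
  have h1 := congrArg im h
  fin_cases i
  · exact h0
  · exact h1
  · exact h'

theorem toW_neg (x : Sphere2) : toW (-x) = - toW x := by
  apply Complex.ext <;> simp [toW]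
theorem toT_neg (x : Sphere2) : toT (-x) = - toT x := by
  simp [toT]

noncomputable def ofWT (w : ℂ) (t : ℝ) (h : normSq w + t ^ 2 = 1) : Sphere2 :=
  ⟨!₂[w.re, w.im, t], by
    rw [sphere_iff, ← h, normSq_apply]
    simp; ring⟩

@[simp] theorem toW_ofWT (w t h) : toW (ofWT w t h) = w := by
  apply Complex.ext <;> simp [toW, ofWT]
@[simp] theorem toT_ofWT (w t h) : toT (ofWT w t h) = t := by
  simp [toT, ofWT]

noncomputable def north : Sphere2 := ofWT 0 1 (by simp)

theorem eq_north {x : Sphere2} (h : toT x = 1) : x = north := by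
  have := toWT_real x
  rw [h] at this
  refine toWT_inj ?_ ?_
  · rw [north, toW_ofWT]; exact normSq_eq_zero.1 (by linarith)
  · rw [h, north, toT_ofWT]

theorem np_pos (y : ℂ) : 0 < normSq y + 1 := by have := normSq_nonneg y; linarith

noncomputable def st (y : ℂ) : Sphere2 :=
  ofWT (2 * y / ((normSq y + 1 : ℝ) : ℂ)) ((normSq y - 1) / (normSq y + 1)) (by
    have := (np_pos y).ne'
    rw [normSq_div, normSq_mul, normSq_ofReal, normSq_ofNat]
    field_simp; ring)

theorem toW_st (y : ℂ) : toW (st y) = 2 * y / ((normSq y + 1 : ℝ) : ℂ) := by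
  unfold st; exact toW_ofWT _ _ _
theorem toT_st (y : ℂ) : toT (st y) = (normSq y - 1) / (normSq y + 1) := by
  unfold st; exact toT_ofWT _ _ _

theorem st_ne (y : ℂ) : st y ≠ north := by
  intro h
  have h1 := toT_st y
  rw [h, north, toT_ofWT, eq_div_iff (np_pos y).ne'] at h1
  linarith

noncomputable def pr (x : Sphere2) : ℂ := toW x / ((1 - toT x : ℝ) : ℂ)

theorem pr_continuousOn : ContinuousOn pr {north}ᶜ := by
  refine toW_continuous.continuousOn.div (continuous_ofReal.comp
    (continuous_const.sub toT_continuous)).continuousOn fun x hx => ?_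
  rw [ofReal_ne_zero]
  intro h
  exact hx (eq_north (by linarith))

theorem pr_st (y : ℂ) : pr (st y) = y := by
  have h1 : (1 - toT (st y) : ℝ) = 2 / (normSq y + 1) := by
    rw [toT_st]
    have := (np_pos y).ne'
    field_simp; ring
  rw [pr, h1, toW_st]
  have : ((normSq y + 1 : ℝ) : ℂ) ≠ 0 := ofReal_ne_zero.2 (np_pos y).ne'
  rw [ofReal_div, ofReal_ofNat]
  field_simp

theorem st_pr {x : Sphere2} (hx : x ≠ north) : st (pr x) = x := by
  have hT : 1 - toT x ≠ 0 := fun h => hx (eq_north (by linarith))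
  have hr := toWT_real x
  have hn : normSq (pr x) = (1 + toT x) / (1 - toT x) := by
    rw [pr, normSq_div, normSq_ofReal, eq_sub_of_add_eq hr]
    field_simp; ring
  have hn1 : normSq (pr x) + 1 = 2 / (1 - toT x) := by rw [hn]; field_simp; ring
  refine toWT_inj ?_ ?_
  · rw [toW_st, hn1, pr, ofReal_div, ofReal_ofNat]
    have := ofReal_ne_zero.2 hT
    field_simp
  · rw [toT_st, hn1, hn]; field_simp; ring

theorem toSphere_continuous {α : Type*} [TopologicalSpace α] {g : α → Sphere2}
    (h : Continuous fun a => toW (g a)) (h' : Continuous fun a => toT (g a)) : Continuous g := by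
  refine Continuous.subtype_mk (f := fun a => (g a).1) ?_ _
  have : (fun a => (g a).1) = fun a => !₂[(toW (g a)).re, (toW (g a)).im, toT (g a)] := by
    funext a
    ext i
    fin_cases i <;> simp [toW, toT]
  rw [this]
  have h1 := continuous_re.comp h
  have h2 := continuous_im.comp h
  refine (PiLp.continuous_toLp 2 _).comp (continuous_pi fun i => ?_)
  fin_cases i
  · exact h1
  · exact h2
  · exact h'

theorem st_continuous : Continuous st := by
  have hn : Continuous fun y : ℂ => normSq y := continuous_normSq
  refine toSphere_continuous ?_ ?_
  · simp only [toW_st]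
    refine (continuous_const.mul continuous_id).div (continuous_ofReal.comp
      (hn.add continuous_const)) fun y => ofReal_ne_zero.2 (np_pos y).ne'
  · simp only [toT_st]
    exact (hn.sub continuous_const).div (hn.add continuous_const) fun y => (np_pos y).ne'

theorem st_tendsto : Tendsto st (cocompact ℂ) (𝓝 north) := by
  intro U hU
  obtain ⟨V, hVU, hV, hN⟩ := _root_.mem_nhds_iff.1 hU
  have hK : IsCompact (pr '' Vᶜ) := hV.isClosed_compl.isCompact.image_of_continuousOn
    (pr_continuousOn.mono fun x hx h => hx (by rw [h]; exact hN))
  refine mem_cocompact.2 ⟨_, hK, fun y hy => hVU ?_⟩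
  by_contra h
  exact hy ⟨st y, h, pr_st y⟩

end KK

end

section

namespace KK
open Complex Set Metric Filter Topology


def CS (g : Sphere2 → Sphere2) (k : ℤ) : Prop :=
  Cls (fun y => toW (g (st y))) (fun y => toT (g (st y))) (toW (g north)) (toT (g north)) k

theorem CS.step {g h : Sphere2 → Sphere2} {k} (hg : CS g k) (hh : Continuous h)
    (hne : ∀ x, h x ≠ - g x) : CS h k := by
  have key : ∀ x, ¬ (toW (h x) = - toW (g x) ∧ toT (h x) = - toT (g x)) := fun x hx =>
    hne x (toWT_inj (by rw [toW_neg]; exact hx.1) (by rw [toT_neg]; exact hx.2))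
  have ht := (hh.tendsto north).comp st_tendsto
  exact Cls.step hg (toW_continuous.comp (hh.comp st_continuous))
    (toT_continuous.comp (hh.comp st_continuous))
    ((toW_continuous.tendsto _).comp ht) ((toT_continuous.tendsto _).comp ht)
    (fun y => toWT _) (toWT _) (fun y => key _) (key _)

theorem ne_neg_self (x : Sphere2) : x ≠ -x := by
  intro h
  have h1 := toW_neg x
  have h2 := toT_neg x
  rw [← h] at h1 h2
  have h3 := toWT_real x
  have h4 : toT x = 0 := by linarith
  have h5 : toW x = 0 := by linear_combination (1/2 : ℂ) * h1
  rw [h4, h5] at h3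
  simp at h3

theorem CS.homotopic {g h : C(Sphere2, Sphere2)} {k} (hg : CS g k) (H : g.Homotopic h) :
    CS h k := by
  obtain ⟨H⟩ := H
  let G : unitInterval → Sphere2 → Sphere2 := fun t x => H (t, x)
  have hG : ∀ t, Continuous (G t) := fun t => by fun_prop
  have := PreconnectedSpace.induction₂' (fun s t => CS (G s) k → CS (G t) k) (fun s => by
    have hev : ∀ᶠ t in 𝓝 s, ∀ x ∈ (univ : Set Sphere2), G t x ≠ - G s x := by
      apply isCompact_univ.eventually_forall_of_forall_eventually
      intro x _
      have hcl : IsClosed {z : unitInterval × Sphere2 | G z.1 z.2 = - G s z.2} :=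
        isClosed_eq (show Continuous fun z : unitInterval × Sphere2 => H (z.1, z.2) from
          H.continuous.comp (continuous_fst.prodMk continuous_snd)) (continuous_neg.comp ((hG s).comp continuous_snd))
      exact hcl.isOpen_compl.mem_nhds (ne_neg_self _)
    filter_upwards [hev] with t ht
    refine ⟨fun h => h.step (hG t) fun x => ht x trivial, fun h => h.step (hG s) fun x e => ?_⟩
    exact ht x trivial (by rw [e, neg_neg])) ⟨fun a b c h1 h2 h => h2 (h1 h)⟩ 0 1
  have e0 : G 0 = g := by funext x; simp [G]
  have e1 : G 1 = h := by funext x; simp [G]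
  rw [e0, e1] at this
  exact this hg

theorem CS_antipodal : CS antipodalMap 1 := by
  have hcoe : ∀ x, antipodalMap x = -x := fun x => rfl
  unfold CS
  simp only [hcoe, toW_neg, toT_neg]
  have hW : Tendsto (fun y => toW (st y)) (cocompact ℂ) (𝓝 (toW north)) :=
    (toW_continuous.tendsto _).comp st_tendsto
  have hT : Tendsto (fun y => toT (st y)) (cocompact ℂ) (𝓝 (toT north)) :=
    (toT_continuous.tendsto _).comp st_tendsto
  have hT' : Tendsto (fun y => (toT (st y) : ℂ)) (cocompact ℂ) (𝓝 (toT north : ℂ)) :=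
    (continuous_ofReal.tendsto _).comp hT
  have hTn : toT north = 1 := by rw [north, toT_ofWT]
  have hWn : toW north = 0 := by rw [north, toW_ofWT]
  have hnz : ∀ y : ℂ, ((normSq y : ℂ) + 1) ≠ 0 := fun y => by exact_mod_cast (np_pos y).ne'
  refine ⟨fun y => - (starRingEnd ℂ) y, fun y => 1, fun y => - y / ((normSq y + 1 : ℝ) : ℂ), 1, 1, 0,
    continuous_conj.neg, continuous_const, fun y h => one_ne_zero h.2, fun y => ?_,
    fun h => one_ne_zero h.1, ?_, ?_, ?_, one_pos, ?_⟩
  · simp only [toW_st, toT_st]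
    have := hnz y
    have hm := mul_conj y
    constructor
    · simp only [map_neg, map_div₀, map_mul, map_ofNat, conj_ofReal]
      push_cast
      field_simp
      ring
    · push_cast
      field_simp
      linear_combination 2 * hm
  · rw [hTn, hWn]; constructor <;> simp
  · have := (tendsto_const_nhds (x := (1:ℂ))).add hT'
    have := this.div_const 2
    rw [hTn] at this
    convert this using 2
    · rename_i y
      rw [toT_st]
      have := hnz y
      have hm := mul_conj y
      push_cast
      field_simp
      linear_combination 2 * hm
    · norm_num
  · have := (hW.neg.div_const 2)
    rw [hWn] at this
    convert this using 2
    · rename_i y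
      rw [toW_st]
      ring
    · simp
  · refine ((logOn_const (c := -1) (by norm_num) _).div (logOn_pos (φ := fun y => normSq y + 1)
      (S := Far 1) (continuous_normSq.add continuous_const).continuousOn
      fun y _ => np_pos y)).congr fun y hy => ?_
    have h1 := far_ne one_pos hy
    have h2 : ((normSq y + 1 : ℝ) : ℂ) ≠ 0 := ofReal_ne_zero.2 (np_pos y).ne'
    simp only [zpow_one]
    field_simp

theorem apply_ne_north {F : Sphere2 ≃ₜ Sphere2} (hF : F north = north) (y : ℂ) :
    F (st y) ≠ north := fun h => st_ne y (F.injective (h.trans hF.symm))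

theorem symm_north {F : Sphere2 ≃ₜ Sphere2} (hF : F north = north) : F.symm north = north :=
  (F.symm_apply_eq).2 hF.symm

noncomputable def plane (F : Sphere2 ≃ₜ Sphere2) (hF : F north = north) : ℂ ≃ₜ ℂ where
  toFun y := pr (F (st y))
  invFun y := pr (F.symm (st y))
  left_inv y := by
    show pr (F.symm (st (pr (F (st y))))) = y
    rw [st_pr (apply_ne_north hF y), F.symm_apply_apply, pr_st]
  right_inv y := by
    show pr (F (st (pr (F.symm (st y))))) = y
    rw [st_pr (apply_ne_north (symm_north hF) y), F.apply_symm_apply, pr_st]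
  continuous_toFun := pr_continuousOn.comp_continuous (F.continuous.comp st_continuous)
    fun y => apply_ne_north hF y
  continuous_invFun := pr_continuousOn.comp_continuous (F.symm.continuous.comp st_continuous)
    fun y => apply_ne_north (symm_north hF) y

theorem st_plane {F : Sphere2 ≃ₜ Sphere2} (hF : F north = north) (y : ℂ) :
    st (plane F hF y) = F (st y) := st_pr (apply_ne_north hF y)

theorem CS_plane {F : Sphere2 ≃ₜ Sphere2} (hF : F north = north) {d} (hd : Deg (plane F hF) d) :
    CS F (-d) := by
  unfold CS
  simp only [← st_plane hF, hF]
  set f := plane F hF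
  obtain ⟨R, hR, hl⟩ := (hd 0).far
  obtain ⟨R1, hR1, hm⟩ := proper f 1
  have hf : Tendsto f (cocompact ℂ) (cocompact ℂ) := f.isClosedEmbedding.tendsto_cocompact
  have hst := st_tendsto.comp hf
  have hW : Tendsto (fun y => toW (st (f y))) (cocompact ℂ) (𝓝 (toW north)) :=
    (toW_continuous.tendsto _).comp hst
  have hT : Tendsto (fun y => toT (st (f y))) (cocompact ℂ) (𝓝 (toT north)) :=
    (toT_continuous.tendsto _).comp hst
  have hT' : Tendsto (fun y => (toT (st (f y)) : ℂ)) (cocompact ℂ) (𝓝 (toT north : ℂ)) :=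
    (continuous_ofReal.tendsto _).comp hT
  have hTn : toT north = 1 := by rw [north, toT_ofWT]
  have hWn : toW north = 0 := by rw [north, toW_ofWT]
  have hnz : ∀ y : ℂ, ((normSq y : ℂ) + 1) ≠ 0 := fun y => by exact_mod_cast (np_pos y).ne'
  refine ⟨fun y => 1, fun y => f y, fun y => (starRingEnd ℂ) (f y) / ((normSq (f y) + 1 : ℝ) : ℂ),
    max R R1, 0, 1, continuous_const, f.continuous, fun y h => one_ne_zero h.1, fun y => ?_,
    fun h => one_ne_zero h.2, ?_, ?_, ?_, by positivity, ?_⟩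
  · simp only [toW_st, toT_st]
    generalize f y = y
    have := hnz y
    have hm := mul_conj y
    constructor
    · simp only [map_div₀, map_mul, map_ofNat, conj_ofReal]
      push_cast
      field_simp
      linear_combination 2 * hm
    · push_cast
      field_simp
      ring
  · rw [hTn, hWn]; constructor <;> simp
  · have := ((continuous_conj.tendsto _).comp hW).div_const 2
    rw [hWn] at this
    convert this using 2
    · rename_i y
      simp only [Function.comp_apply, toW_st, map_div₀, map_mul, map_ofNat, conj_ofReal]
      ring
    · simp
  · have := (tendsto_const_nhds (x := (1:ℂ))).add hT'
    have := this.div_const 2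
    rw [hTn] at this
    convert this using 2
    · rename_i y
      simp only [toT_st]
      generalize f y = y
      have := hnz y
      have hm := mul_conj y
      push_cast
      field_simp
      linear_combination 2 * hm
    · norm_num
  · have hmf : MapsTo f (Far (max R R1)) (Far 1) := hm.mono_left (far_mono (le_max_right _ _))
    have l1 := (logOn_conj_mul (S := Far 1) fun h => far_ne one_pos h rfl).comp
      f.continuous.continuousOn hmf
    have l2 := logOn_pos (φ := fun y => normSq (f y) + 1)
      (S := Far (max R R1)) ((continuous_normSq.comp f.continuous).add continuous_const).continuousOn
      fun y _ => np_pos _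
    refine ((l1.div l2).div (hl.mono (far_mono (le_max_left _ _)))).congr fun y hy => ?_
    have h1 := far_ne (lt_of_lt_of_le hR (le_max_left _ _)) hy
    have h2 : ((normSq (f y) + 1 : ℝ) : ℂ) ≠ 0 := ofReal_ne_zero.2 (np_pos _).ne'
    have h3 : f y ≠ 0 := far_ne one_pos (hmf hy)
    have h4 := zpow_ne_zero d h1
    simp only [zpow_neg]
    field_simp

theorem plane_deg {F : Sphere2 ≃ₜ Sphere2} (hF : F north = north) (h : OrientReversing F) :
    Deg (plane F hF) (-1) := by
  rcases deg_cases (plane F hF) with h1 | h1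
  · have := CS_antipodal.unique (CS.homotopic (g := (F : C(Sphere2, Sphere2))) (CS_plane hF h1) h)
    norm_num at this
  · exact h1

end KK

end

section

namespace KK
open Complex Set Metric Filter Topology

theorem plane_iterate {F : Sphere2 ≃ₜ Sphere2} (hF : F north = north) (k : ℕ) (y : ℂ) :
    st ((plane F hF)^[k] y) = F^[k] (st y) := by
  induction k generalizing y with
  | zero => rfl
  | succ k ih => rw [Function.iterate_succ_apply, Function.iterate_succ_apply, ih, st_plane]

theorem fix_north {F : Sphere2 ≃ₜ Sphere2} (hF : F north = north) {n : ℕ} (hn : 1 ≤ n)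
    (hper : ∀ x, F^[n] x = x) (hor : OrientReversing F) :
    ({z | F z = z} \ {north}).Nonempty ∧ IsPreconnected ({z | F z = z} \ {north}) ∧
    ∀ y, F y = y → y ≠ north → ¬ IsPreconnected (({z | F z = z} \ {north}) \ {y}) := by
  have hd := plane_deg hF hor
  have hfn : (plane F hF) ^ n = 1 := by
    have hpw : ∀ (k : ℕ) (y : ℂ), ((plane F hF) ^ k) y = (plane F hF)^[k] y := fun k => by
      induction k with
      | zero => intro y; rfl
      | succ k ih => intro y; rw [pow_succ, Function.iterate_succ_apply, ← ih]; rfl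
    ext1 y
    change ((plane F hF) ^ n) y = y
    rw [hpw]
    rw [← pr_st ((plane F hF)^[n] y), plane_iterate, hper, pr_st]
  have hff := sq_eq_one hn hfn hd
  have himg : st '' {z | plane F hF z = z} = {z | F z = z} \ {north} := by
    ext x
    constructor
    · rintro ⟨z, hz, rfl⟩
      have hz' : plane F hF z = z := hz
      exact ⟨by rw [mem_ofPred_eq, ← st_plane hF, hz'], st_ne z⟩
    · rintro ⟨hx, hxn⟩
      have hx' : F x = x := hx
      refine ⟨pr x, ?_, st_pr hxn⟩
      show pr (F (st (pr x))) = pr x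
      rw [st_pr hxn, hx']
  refine ⟨?_, ?_, fun y hy hyn hp => ?_⟩
  · rw [← himg]; exact (fix_nonempty hd hff).image _
  · rw [← himg]; exact (fix_preconn hd hff).image _ st_continuous.continuousOn
  · have hb : plane F hF (pr y) = pr y := by
      show pr (F (st (pr y))) = pr y
      rw [st_pr hyn, hy]
    apply fix_not_preconn hd hff hb
    have := hp.image pr (pr_continuousOn.mono fun x hx => hx.1.2)
    convert this using 1
    rw [← himg]
    ext z
    constructor
    · rintro ⟨hz, hzb⟩
      refine ⟨st z, ⟨⟨z, hz, rfl⟩, fun h => hzb ?_⟩, pr_st z⟩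
      have h' : st z = y := h
      show z = pr y
      rw [← h', pr_st]
    · rintro ⟨_, ⟨⟨w, hw, rfl⟩, hwy⟩, rfl⟩
      rw [pr_st]
      refine ⟨hw, fun h => hwy ?_⟩
      have h' : w = pr y := h
      show st w = y
      rw [h', st_pr hyn]

theorem exists_rot (x : Sphere2) : ∃ L : Sphere2 ≃ₜ Sphere2, L north = x ∧ ∀ z, L (-z) = - L z := by
  obtain ⟨A, hA⟩ : ∃ A : EuclideanSpace ℝ (Fin 3) ≃ₗᵢ[ℝ] EuclideanSpace ℝ (Fin 3),
      A north.1 = x.1 := by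
    refine ⟨Submodule.reflection (Submodule.span ℝ {north.1 - x.1})ᗮ, ?_⟩
    apply Submodule.reflection_sub
    rw [mem_sphere_zero_iff_norm.1 north.2, mem_sphere_zero_iff_norm.1 x.2]
  have hm : ∀ B : EuclideanSpace ℝ (Fin 3) ≃ₗᵢ[ℝ] EuclideanSpace ℝ (Fin 3), ∀ z : Sphere2,
      B z.1 ∈ Sphere2 := fun B z => by
    rw [mem_sphere_zero_iff_norm, B.norm_map]; exact mem_sphere_zero_iff_norm.1 z.2
  refine ⟨⟨⟨fun z => ⟨A z.1, hm A z⟩, fun z => ⟨A.symm z.1, hm A.symm z⟩, fun z => ?_, fun z => ?_⟩,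
    ?_, ?_⟩, ?_, ?_⟩
  · apply Subtype.ext; simp
  · apply Subtype.ext; simp
  · exact (A.continuous.comp continuous_subtype_val).subtype_mk _
  · exact (A.symm.continuous.comp continuous_subtype_val).subtype_mk _
  · exact Subtype.ext hA
  · intro z
    apply Subtype.ext
    show A (-z.1) = -A z.1
    exact map_neg A _

theorem fix_data {F : Sphere2 ≃ₜ Sphere2} {n : ℕ} (hn : 1 ≤ n)
    (hper : ∀ x, F^[n] x = x) (hor : OrientReversing F) {x : Sphere2} (hx : F x = x) :
    ({z | F z = z} \ {x}).Nonempty ∧ IsPreconnected ({z | F z = z} \ {x}) ∧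
    ∀ y, F y = y → y ≠ x → ¬ IsPreconnected (({z | F z = z} \ {x}) \ {y}) := by
  obtain ⟨L, hL, hLn⟩ := exists_rot x
  let G : Sphere2 ≃ₜ Sphere2 := (L.trans F).trans L.symm
  have hG : ∀ z, G z = L.symm (F (L z)) := fun z => rfl
  have hGN : G north = north := by rw [hG, hL, hx, ← hL, L.symm_apply_apply]
  have hGit : ∀ k z, L (G^[k] z) = F^[k] (L z) := fun k => by
    induction k with
    | zero => intro z; rfl
    | succ k ih =>
      intro z
      rw [Function.iterate_succ_apply, Function.iterate_succ_apply, ih, hG, L.apply_symm_apply]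
  have hGor : OrientReversing G := by
    unfold OrientReversing at hor ⊢
    have h1 := (ContinuousMap.Homotopic.refl (L.symm : C(Sphere2, Sphere2))).comp
      (hor.comp (ContinuousMap.Homotopic.refl (L : C(Sphere2, Sphere2))))
    convert h1 using 1
    · rfl
    ext1 z
    show -z = L.symm (-(L z))
    rw [← hLn, L.symm_apply_apply]
  have hGf : ∀ z, G z = z ↔ F (L z) = L z := fun z => by
    rw [hG, L.symm_apply_eq]
  have hset : ∀ S : Set Sphere2, L '' ({z | G z = z} \ S) = {z | F z = z} \ (L '' S) := fun S => by
    rw [image_sdiff L.injective]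
    congr 1
    ext z
    constructor
    · rintro ⟨w, hw, rfl⟩; exact (hGf w).1 hw
    · intro hz
      refine ⟨L.symm z, ?_, L.apply_symm_apply z⟩
      rw [mem_ofPred_eq, hGf, L.apply_symm_apply]; exact hz
  obtain ⟨h1, h2, h3⟩ := fix_north hGN hn (fun z => L.injective (by rw [hGit, hper])) hGor
  have e1 := hset {north}
  rw [image_singleton, hL] at e1
  refine ⟨?_, ?_, fun y hy hyx hp => ?_⟩
  · rw [← e1]; exact h1.image _
  · rw [← e1]; exact h2.image _ L.continuous.continuousOn
  · refine h3 (L.symm y) ?_ ?_ ?_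
    · rw [hGf, L.apply_symm_apply, hy]
    · intro h
      rw [L.symm_apply_eq, hL] at h
      exact hyx h
    · have := hp.image L.symm L.symm.continuous.continuousOn
      convert this using 1
      rw [image_sdiff L.symm.injective, image_singleton, ← e1, ← image_comp]
      simp
end KK

end

section

namespace KK
open Set Filter Topology

theorem order_fun {Y : Type*} [TopologicalSpace Y] [LinearOrder Y]
    [TopologicalSpace.SeparableSpace Y] [PreconnectedSpace Y] (hI : ∀ x : Y, IsOpen (Iio x))
    (hO : ∀ x : Y, IsOpen (Ioi x)) {a b : Y} (ha : ∀ x, a ≤ x) (hb : ∀ x, x ≤ b) (hab : a < b) :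
    ∃ f : Y → ℝ, Continuous f ∧ StrictMono f ∧ f a = 0 ∧ f b = 1 := by
  have hdense : ∀ x y : Y, x < y → (Ioo x y).Nonempty := fun x y hxy => by
    have := (isPreconnected_univ (α := Y)) (Iio y) (Ioi x) (hI y) (hO x)
      (fun z _ => (lt_or_ge z y).imp id fun h => lt_of_lt_of_le hxy h)
      ⟨x, trivial, hxy⟩ ⟨y, trivial, hxy⟩
    obtain ⟨z, -, h1, h2⟩ := this
    exact ⟨z, h2, h1⟩
  obtain ⟨D0, hD0c, hD0⟩ := TopologicalSpace.exists_countable_dense Y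
  let D : Set Y := D0 ∩ Ioo a b
  have hD : ∀ x y : Y, x < y → ∃ d ∈ D, x < d ∧ d < y := fun x y hxy => by
    have ho : IsOpen (Ioo x y) := (hO x).inter (hI y)
    obtain ⟨d, hd1, hd2⟩ := hD0.inter_open_nonempty _ ho (hdense x y hxy)
    exact ⟨d, ⟨hd2, lt_of_le_of_lt (ha x) hd1.1, lt_of_lt_of_le hd1.2 (hb y)⟩, hd1⟩
  have : Countable D := (hD0c.mono inter_subset_left).to_subtype
  have : DenselyOrdered D := ⟨fun x y hxy => by
    obtain ⟨d, hd, h1, h2⟩ := hD x.1 y.1 hxy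
    exact ⟨⟨d, hd⟩, h1, h2⟩⟩
  have : NoMinOrder D := ⟨fun x => by
    obtain ⟨d, hd, h1, h2⟩ := hD a x.1 x.2.2.1
    exact ⟨⟨d, hd⟩, h2⟩⟩
  have : NoMaxOrder D := ⟨fun x => by
    obtain ⟨d, hd, h1, h2⟩ := hD x.1 b x.2.2.2
    exact ⟨⟨d, hd⟩, h1⟩⟩
  have : Nonempty D := by
    obtain ⟨d, hd, -⟩ := hD a b hab
    exact ⟨⟨d, hd⟩⟩
  have : Nonempty (Ioo (0:ℚ) 1) := ⟨⟨1/2, by norm_num, by norm_num⟩⟩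
  obtain ⟨e⟩ := Order.iso_of_countable_dense D (Ioo (0:ℚ) 1)
  let φ : D → ℝ := fun d => ((e d : ℚ) : ℝ)
  have hφ : ∀ {d d' : D}, d < d' → φ d < φ d' := fun {d d'} h => by
    have : (e d : ℚ) < e d' := e.strictMono h
    exact Rat.cast_lt.2 this
  have hφ0 : ∀ d, 0 < φ d := fun d => Rat.cast_pos.2 (e d).2.1
  have hφ1 : ∀ d, φ d < 1 := fun d => by
    have : (((e d).1 : ℚ) : ℝ) < ((1 : ℚ) : ℝ) := Rat.cast_lt.2 (e d).2.2
    rwa [Rat.cast_one] at this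
  have hφs : ∀ q : ℚ, 0 < q → q < 1 → ∃ d, φ d = q := fun q h0 h1 =>
    ⟨e.symm ⟨q, h0, h1⟩, by simp [φ]⟩
  let T : Y → Set ℝ := fun x => insert 0 {r | ∃ d : D, d.1 < x ∧ φ d = r}
  have hTb : ∀ x, BddAbove (T x) := fun x => ⟨1, by
    rintro r (rfl | ⟨d, -, rfl⟩)
    · exact zero_le_one
    · exact (hφ1 d).le⟩
  have hTn : ∀ x, (T x).Nonempty := fun x => ⟨0, Or.inl rfl⟩
  let f : Y → ℝ := fun x => sSup (T x)
  have f0 : ∀ x, 0 ≤ f x := fun x => le_csSup (hTb x) (Or.inl rfl)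
  have f1 : ∀ x, f x ≤ 1 := fun x => csSup_le (hTn x) (by
    rintro r (rfl | ⟨d, -, rfl⟩)
    · exact zero_le_one
    · exact (hφ1 d).le)
  have fd : ∀ (d : D) x, d.1 < x → φ d < f x := fun d x h => by
    obtain ⟨d', hd', h1, h2⟩ := hD _ _ h
    exact lt_of_lt_of_le (hφ (d := d) (d' := ⟨d', hd'⟩) h1) (le_csSup (hTb x) (Or.inr ⟨_, h2, rfl⟩))
  have df : ∀ (d : D) x, x ≤ d.1 → f x ≤ φ d := fun d x h => csSup_le (hTn x) (by
    rintro r (rfl | ⟨d', hd', rfl⟩)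
    · exact (hφ0 d).le
    · exact (hφ (show d'.1 < d.1 from lt_of_lt_of_le hd' h)).le)
  refine ⟨f, ?_, ?_, ?_, ?_⟩
  · rw [OrderTopology.continuous_iff]
    intro r
    constructor
    · rw [isOpen_iff_mem_nhds]
      intro x hx
      obtain ⟨t, ht, hrt⟩ := exists_lt_of_lt_csSup (hTn x) (show r < sSup (T x) from hx)
      rcases ht with rfl | ⟨d, hd, rfl⟩
      · exact Filter.mem_of_superset univ_mem fun y _ => lt_of_lt_of_le hrt (f0 y)
      · exact Filter.mem_of_superset ((hO d.1).mem_nhds hd) fun y hy => hrt.trans (fd d y hy)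
    · rw [isOpen_iff_mem_nhds]
      intro x hx
      have hx : f x < r := hx
      rcases lt_or_ge 1 r with hr | hr
      · exact Filter.mem_of_superset univ_mem fun y _ => lt_of_le_of_lt (f1 y) hr
      · obtain ⟨q1, h1, h2⟩ := exists_rat_btwn hx
        obtain ⟨q2, h3, h4⟩ := exists_rat_btwn h2
        have p1 : (0:ℝ) < q1 := lt_of_le_of_lt (f0 x) h1
        obtain ⟨d1, e1⟩ := hφs q1 (by exact_mod_cast p1) (by
          have : (q1:ℝ) < 1 := lt_of_lt_of_le h2 hr
          exact_mod_cast this)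
        obtain ⟨d2, e2⟩ := hφs q2 (by exact_mod_cast p1.trans h3) (by
          have : (q2:ℝ) < 1 := lt_of_lt_of_le h4 hr
          exact_mod_cast this)
        have hxd : x < d2.1 := by
          by_contra hcon
          push Not at hcon
          have hd : d1 < d2 := by
            by_contra hc
            rcases eq_or_lt_of_le (not_lt.1 hc) with h | h
            · rw [h, e1] at e2; exact h3.ne e2
            · have := hφ h
              rw [e1, e2] at this; exact lt_asymm this h3
          have := fd d1 x (lt_of_lt_of_le hd hcon)
          rw [e1] at this
          exact lt_asymm this h1
        exact Filter.mem_of_superset ((hI d2.1).mem_nhds hxd) fun y hy =>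
          lt_of_le_of_lt (df d2 y (le_of_lt hy)) (by rw [e2]; exact h4)
  · intro x y hxy
    obtain ⟨d, hd, h1, h2⟩ := hD _ _ hxy
    exact lt_of_le_of_lt (df ⟨d, hd⟩ x h1.le) (fd ⟨d, hd⟩ y h2)
  · refine le_antisymm (csSup_le (hTn a) ?_) (f0 a)
    rintro r (rfl | ⟨d, hd, rfl⟩)
    · exact le_rfl
    · exact absurd hd (not_lt.2 (ha _))
  · by_contra hne
    obtain ⟨q, h1, h2⟩ := exists_rat_btwn (lt_of_le_of_ne (f1 b) hne)
    have p1 : (0:ℝ) < q := lt_of_le_of_lt (f0 b) h1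
    obtain ⟨d, hd⟩ := hφs q (by exact_mod_cast p1) (by exact_mod_cast h2)
    have := fd d b d.2.2.2
    rw [hd] at this
    exact lt_asymm this h1

theorem cut {X : Type*} [TopologicalSpace X] {S A B : Set X} {c : X} (hS : IsPreconnected S)
    (hA : IsOpen A) (hB : IsOpen B) (hd : Disjoint A B) (hSe : S = insert c A ∪ B) :
    IsPreconnected (insert c A) := by
  have key : ∀ u v : Set X, IsOpen u → IsOpen v → insert c A ⊆ u ∪ v → c ∈ u →
      (insert c A ∩ v).Nonempty → (insert c A ∩ (u ∩ v)).Nonempty := by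
    rintro u v hu hv huv hcu ⟨p, hpA, hpv⟩
    by_contra hcon
    have hp : p ∈ A := by
      rcases hpA with rfl | h
      · exact (hcon ⟨p, Or.inl rfl, hcu, hpv⟩).elim
      · exact h
    obtain ⟨q, hqS, hq1, hq2⟩ := hS (u ∪ B) (v ∩ A) (hu.union hB) (hv.inter hA) (by
      rw [hSe]
      rintro z (hz | hz)
      · rcases hz with rfl | hz
        · exact Or.inl (Or.inl hcu)
        · rcases huv (Or.inr hz) with h | h
          · exact Or.inl (Or.inl h)
          · exact Or.inr ⟨h, hz⟩
      · exact Or.inl (Or.inr hz)) ⟨c, by rw [hSe]; exact Or.inl (Or.inl rfl), Or.inl hcu⟩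
      ⟨p, by rw [hSe]; exact Or.inl (Or.inr hp), hpv, hp⟩
    rcases hq1 with h | h
    · exact hcon ⟨q, Or.inr hq2.2, h, hq2.1⟩
    · exact disjoint_left.1 hd hq2.2 h
  intro u v hu hv huv hnu hnv
  rcases huv (mem_insert c A) with h | h
  · exact key u v hu hv huv h hnv
  · rw [inter_comm u v]
    exact key v u hv hu (by rwa [union_comm]) h hnu

theorem arc {Y : Type*} [TopologicalSpace Y] [T1Space Y]
    [TopologicalSpace.SeparableSpace Y] [PreconnectedSpace Y] {a b : Y} (hab : a ≠ b)
    (h : ∀ x, x ≠ a → x ≠ b → ∃ A B : Set Y, IsOpen A ∧ IsOpen B ∧ Disjoint A B ∧ A ∪ B = {x}ᶜ ∧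
      a ∈ A ∧ b ∈ B) :
    ∃ f : Y → ℝ, Continuous f ∧ Function.Injective f ∧ (∀ x, 0 ≤ f x ∧ f x ≤ 1) ∧
      f a = 0 ∧ f b = 1 := by
  classical
  have h' : ∀ x, ∃ A B : Set Y, IsOpen A ∧ IsOpen B ∧ Disjoint A B ∧ A ∪ B = {x}ᶜ ∧
      a ∉ B ∧ b ∉ A := by
    intro x
    by_cases hxa : x = a
    · exact ⟨∅, {x}ᶜ, isOpen_empty, isOpen_compl_singleton, empty_disjoint _, empty_union _,
        by simp [hxa], by simp⟩
    by_cases hxb : x = b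
    · exact ⟨{x}ᶜ, ∅, isOpen_compl_singleton, isOpen_empty, disjoint_empty _, union_empty _,
        by simp, by simp [hxb]⟩
    obtain ⟨A, B, h1, h2, h3, h4, h5, h6⟩ := h x hxa hxb
    exact ⟨A, B, h1, h2, h3, h4, disjoint_left.1 h3 h5, disjoint_right.1 h3 h6⟩
  choose A B hA hB hAB hun haB hbA using h'
  have hxA : ∀ x, x ∉ A x := fun x hx => by
    have : x ∈ ({x}ᶜ : Set Y) := hun x ▸ Or.inl hx
    exact this rfl
  have hxB : ∀ x, x ∉ B x := fun x hx => by
    have : x ∈ ({x}ᶜ : Set Y) := hun x ▸ Or.inr hx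
    exact this rfl
  have hor : ∀ {x y}, y ≠ x → y ∈ A x ∨ y ∈ B x := fun {x y} hy => by
    have : y ∈ ({x}ᶜ : Set Y) := hy
    rw [← hun x] at this; exact this
  have huniv : ∀ x, (univ : Set Y) = insert x (A x) ∪ B x := fun x => by
    symm
    rw [eq_univ_iff_forall]
    intro y
    by_cases hy : y = x
    · exact Or.inl (Or.inl hy)
    · rcases hor hy with h | h
      · exact Or.inl (Or.inr h)
      · exact Or.inr h
  have cA : ∀ x, IsPreconnected (insert x (A x)) := fun x =>
    cut isPreconnected_univ (hA x) (hB x) (hAB x) (huniv x)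
  have cB : ∀ x, IsPreconnected (insert x (B x)) := fun x =>
    cut isPreconnected_univ (hB x) (hA x) (hAB x).symm (by
      rw [huniv x, insert_union, insert_union, union_comm])
  have k1 : ∀ {x y}, y ∈ A x → insert x (B x) ⊆ B y := fun {x y} hy => by
    have hyx : y ≠ x := fun e => hxA x (e ▸ hy)
    have hyB : y ∉ B x := disjoint_left.1 (hAB x) hy
    have hbm : b ∈ insert x (B x) := by
      by_cases hbx : b = x
      · exact Or.inl hbx
      · exact Or.inr ((hor hbx).resolve_left (hbA x))
    rcases IsPreconnected.subset_or_subset (hA y) (hB y) (hAB y) (fun z hz => by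
      refine hor fun e => ?_
      rw [e] at hz
      rcases hz with h | h
      · exact hyx h
      · exact hyB h) (cB x) with h | h
    · exact (hbA y (h hbm)).elim
    · exact h
  have k2 : ∀ {x y}, y ∈ B x → insert x (A x) ⊆ A y := fun {x y} hy => by
    have hyx : y ≠ x := fun e => hxB x (e ▸ hy)
    have hyB : y ∉ A x := disjoint_right.1 (hAB x) hy
    have hbm : a ∈ insert x (A x) := by
      by_cases hbx : a = x
      · exact Or.inl hbx
      · exact Or.inr ((hor hbx).resolve_right (haB x))
    rcases IsPreconnected.subset_or_subset (hA y) (hB y) (hAB y) (fun z hz => by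
      refine hor fun e => ?_
      rw [e] at hz
      rcases hz with h | h
      · exact hyx h
      · exact hyB h) (cA x) with h | h
    · exact h
    · exact (haB y (h hbm)).elim
  have hAiffB : ∀ {x y}, y ∈ A x ↔ x ∈ B y := fun {x y} =>
    ⟨fun h => k1 h (mem_insert _ _), fun h => k2 h (mem_insert _ _)⟩
  have htrans : ∀ {x y z}, x ∈ A y → y ∈ A z → x ∈ A z := fun {x y z} h1 h2 =>
    k2 (hAiffB.1 h2) (Or.inr h1)
  let ord : LinearOrder Y :=
    { le := fun x y => x = y ∨ x ∈ A y
      lt := fun x y => x ∈ A y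
      le_refl := fun x => Or.inl rfl
      le_trans := fun x y z h1 h2 => by
        rcases h1 with rfl | h1
        · exact h2
        · rcases h2 with rfl | h2
          · exact Or.inr h1
          · exact Or.inr (htrans h1 h2)
      le_antisymm := fun x y h1 h2 => by
        rcases h1 with rfl | h1
        · rfl
        · rcases h2 with rfl | h2
          · rfl
          · exact (hxA x (htrans h1 h2)).elim
      le_total := fun x y => by
        by_cases hxy : x = y
        · exact Or.inl (Or.inl hxy)
        · rcases hor hxy with h | h
          · exact Or.inl (Or.inr h)
          · exact Or.inr (Or.inr (hAiffB.2 h))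
      lt_iff_le_not_ge := fun x y => by
        constructor
        · intro h
          refine ⟨Or.inr h, fun h' => ?_⟩
          rcases h' with rfl | h'
          · exact hxA _ h
          · exact hxA x (htrans h h')
        · rintro ⟨h1 | h1, h2⟩
          · exact (h2 (Or.inl h1.symm)).elim
          · exact h1
      toDecidableLE := Classical.decRel _ }
  have eI : ∀ x : Y, Iio x = A x := fun x => rfl
  have eO : ∀ x : Y, Ioi x = B x := fun x => by
    ext y; exact hAiffB
  obtain ⟨f, hf, hfm, hfa, hfb⟩ := order_fun (Y := Y) (a := a) (b := b) (fun x => by rw [eI]; exact hA x)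
    (fun x => by rw [eO]; exact hB x)
    (fun x => by
      by_cases hx : a = x
      · exact Or.inl hx
      · exact Or.inr ((hor hx).resolve_right (haB x)))
    (fun x => by
      by_cases hx : x = b
      · exact Or.inl hx
      · refine Or.inr (hAiffB.2 ((hor (Ne.symm hx)).resolve_left (hbA x))))
    ((hor hab).resolve_right (haB b))
  refine ⟨f, hf, hfm.injective, fun x => ⟨?_, ?_⟩, hfa, hfb⟩
  · rw [← hfa]
    apply hfm.monotone
    by_cases hx : a = x
    · exact Or.inl hx
    · exact Or.inr ((hor hx).resolve_right (haB x))
  · rw [← hfb]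
    apply hfm.monotone
    by_cases hx : x = b
    · exact Or.inl hx
    · exact Or.inr (hAiffB.2 ((hor (Ne.symm hx)).resolve_left (hbA x)))

end KK

end

section

namespace KK
open Set Filter Topology

theorem split {X : Type*} [TopologicalSpace X] {S : Set X} (hS : IsOpen S)
    (h : ¬ IsPreconnected S) : ∃ U V : Set X, IsOpen U ∧ IsOpen V ∧ U.Nonempty ∧ V.Nonempty ∧
      Disjoint U V ∧ U ∪ V = S := by
  unfold IsPreconnected at h
  push Not at h
  obtain ⟨u, v, hu, hv, huv, h1, h2, h3⟩ := h
  refine ⟨S ∩ u, S ∩ v, hS.inter hu, hS.inter hv, h1, h2, ?_, ?_⟩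
  · rw [disjoint_left]
    rintro x ⟨hx, hxu⟩ ⟨-, hxv⟩
    have : x ∈ S ∩ (u ∩ v) := ⟨hx, hxu, hxv⟩
    rw [h3] at this; exact this
  · rw [← inter_union_distrib_left, inter_eq_left]; exact huv

theorem side {X : Type*} [TopologicalSpace X] [T2Space X] [SecondCountableTopology X]
    (h1 : ∀ x : X, IsPreconnected ({x}ᶜ : Set X))
    (h2 : ∀ x y : X, x ≠ y → ¬ IsPreconnected (({x}ᶜ : Set X) \ {y})) {a b : X} (hab : a ≠ b)
    {U V : Set X} (hU : IsOpen U) (hV : IsOpen V) (hUn : U.Nonempty) (hVn : V.Nonempty)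
    (hd : Disjoint U V) (hUV : U ∪ V = {a}ᶜ \ {b}) :
    ∃ k : X → ℝ, ContinuousOn k (insert a (insert b U)) ∧ InjOn k (insert a (insert b U)) ∧
      (∀ x ∈ insert a (insert b U), -1 ≤ k x ∧ k x ≤ 1) ∧ k a = 1 ∧ k b = -1 ∧
      ∀ r : ℝ, -1 ≤ r → r ≤ 1 → ∃ x ∈ insert a (insert b U), k x = r := by
  classical
  set I := insert a (insert b U) with hIdef
  have memUV : ∀ z, z ∈ U ∪ V ↔ z ≠ a ∧ z ≠ b := fun z => by rw [hUV]; rfl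
  have haU : a ∉ U := fun h => ((memUV a).1 (Or.inl h)).1 rfl
  have hbU : b ∉ U := fun h => ((memUV b).1 (Or.inl h)).2 rfl
  have haV : a ∉ V := fun h => ((memUV a).1 (Or.inr h)).1 rfl
  have hbV : b ∉ V := fun h => ((memUV b).1 (Or.inr h)).2 rfl
  have hca : IsPreconnected (insert a U) := by
    refine cut (h1 b) hU hV hd ?_
    ext z
    have := memUV z
    simp only [mem_union, mem_compl_iff, mem_singleton_iff, mem_insert_iff] at this ⊢
    grind
  have hcb : IsPreconnected (insert b U) := by
    refine cut (h1 a) hU hV hd ?_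
    ext z
    have := memUV z
    simp only [mem_union, mem_compl_iff, mem_singleton_iff, mem_insert_iff] at this ⊢
    grind
  have hI : IsPreconnected I := by
    obtain ⟨p, hp⟩ := hUn
    have := hca.union p (Or.inr hp) (Or.inr hp) hcb
    convert this using 1
    ext z
    simp only [I, mem_union, mem_insert_iff]
    grind
  have hIV : ∀ z, z ∈ I ↔ z ∉ V := fun z => by
    have := memUV z
    have hdz : z ∈ U → z ∉ V := fun h => disjoint_left.1 hd h
    simp only [I, mem_union, mem_insert_iff] at this ⊢
    grind
  have haI : a ∈ I := Or.inl rfl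
  have hbI : b ∈ I := Or.inr (Or.inl rfl)
  have : PreconnectedSpace I := Subtype.preconnectedSpace hI
  -- no nonempty set `Q` open, closed in the complement of a point, missing `a`
  have clop : ∀ (x : X) (Q : Set X), IsOpen Q → IsClosed (insert x Q) → x ≠ a → a ∉ Q →
      x ∉ Q → Q = ∅ := fun x Q hQ hQc hxa haQ hxQ => by
    by_contra hne
    obtain ⟨q, hq⟩ := nonempty_iff_ne_empty.2 hne
    obtain ⟨p, hp, hp1, hp2⟩ := h1 x Q (insert x Q)ᶜ hQ hQc.isOpen_compl (fun z hz => by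
      by_cases hzQ : z ∈ Q
      · exact Or.inl hzQ
      · refine Or.inr fun h => ?_
        rcases h with h | h
        · exact hz h
        · exact hzQ h) ⟨q, fun h => hxQ (h ▸ hq), hq⟩ ⟨a, hxa.symm, fun h => by
          rcases h with h | h
          · exact hxa h.symm
          · exact haQ h⟩
    exact hp2 (Or.inr hp1)
  have sep : ∀ x ∈ U, ∃ A B : Set X, IsOpen A ∧ IsOpen B ∧ Disjoint A B ∧ I \ {x} ⊆ A ∪ B ∧
      x ∉ A ∧ x ∉ B ∧ a ∈ A ∧ b ∈ B := by
    intro x hx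
    obtain ⟨y, hy⟩ := hVn
    have hxy : x ≠ y := fun e => disjoint_left.1 hd hx (e ▸ hy)
    have hxa : x ≠ a := fun e => haU (e ▸ hx)
    have hxb : x ≠ b := fun e => hbU (e ▸ hx)
    have hya : y ≠ a := fun e => haV (e ▸ hy)
    have hyb : y ≠ b := fun e => hbV (e ▸ hy)
    have hop : IsOpen (({x}ᶜ : Set X) \ {y}) :=
      isOpen_compl_singleton.sdiff isClosed_singleton
    obtain ⟨S, T, hS, hT, hSn, hTn, hST, hSTe⟩ := split hop (h2 x y hxy)
    have memST : ∀ z, z ∈ S ∪ T ↔ z ≠ x ∧ z ≠ y := fun z => by rw [hSTe]; rfl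
    -- the two points cannot both lie in the same part
    have notboth : ∀ S T : Set X, IsOpen S → IsOpen T → T.Nonempty → Disjoint S T →
        (∀ z, z ∈ S ∪ T ↔ z ≠ x ∧ z ≠ y) → a ∈ S → b ∈ S → False := by
      intro S T hS hT hTn hST memST haS hbS
      have haT : a ∉ T := disjoint_left.1 hST haS
      have hbT : b ∉ T := disjoint_left.1 hST hbS
      have e1 : T ∩ U = ∅ := by
        refine clop x (T ∩ U) (hT.inter hU) ?_ hxa (fun h => haT h.1) (fun h => ?_)
        · have : insert x (T ∩ U) = (S ∪ V)ᶜ := by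
            ext z
            have m1 := memST z
            have m2 := memUV z
            have d1 : z ∈ S → z ∉ T := fun h => disjoint_left.1 hST h
            have d2 : z ∈ U → z ∉ V := fun h => disjoint_left.1 hd h
            have c1 : x ∉ S := fun h => ((memST x).1 (Or.inl h)).1 rfl
            have c2 : x ∉ V := fun h => disjoint_left.1 hd hx h
            simp only [mem_union, mem_compl_iff, mem_inter_iff, mem_insert_iff] at m1 m2 ⊢
            grind
          rw [this]
          exact (hS.union hV).isClosed_compl
        · exact ((memST x).1 (Or.inr h.1)).1 rfl
      have e2 : T ∩ V = ∅ := by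
        refine clop y (T ∩ V) (hT.inter hV) ?_ hya (fun h => haT h.1) (fun h => ?_)
        · have : insert y (T ∩ V) = (S ∪ U)ᶜ := by
            ext z
            have m1 := memST z
            have m2 := memUV z
            have d1 : z ∈ S → z ∉ T := fun h => disjoint_left.1 hST h
            have d2 : z ∈ U → z ∉ V := fun h => disjoint_left.1 hd h
            have c1 : y ∉ S := fun h => ((memST y).1 (Or.inl h)).2 rfl
            have c2 : y ∉ U := fun h => disjoint_left.1 hd h hy
            simp only [mem_union, mem_compl_iff, mem_inter_iff, mem_insert_iff] at m1 m2 ⊢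
            grind
          rw [this]
          exact (hS.union hU).isClosed_compl
        · exact ((memST y).1 (Or.inr h.1)).2 rfl
      obtain ⟨p, hp⟩ := hTn
      rcases (memUV p).2 ⟨fun e => haT (e ▸ hp), fun e => hbT (e ▸ hp)⟩ with h | h
      · have : p ∈ T ∩ U := ⟨hp, h⟩
        rw [e1] at this; exact this
      · have : p ∈ T ∩ V := ⟨hp, h⟩
        rw [e2] at this; exact this
    have cov : I \ {x} ⊆ S ∪ T := fun z hz =>
      (memST z).2 ⟨hz.2, fun e => (hIV z).1 hz.1 (e ▸ hy)⟩
    have xS : x ∉ S := fun h => ((memST x).1 (Or.inl h)).1 rfl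
    have xT : x ∉ T := fun h => ((memST x).1 (Or.inr h)).1 rfl
    rcases (memST a).2 ⟨hxa.symm, hya.symm⟩ with haS | haT
    · rcases (memST b).2 ⟨hxb.symm, hyb.symm⟩ with hbS | hbT
      · exact (notboth S T hS hT hTn hST memST haS hbS).elim
      · exact ⟨S, T, hS, hT, hST, cov, xS, xT, haS, hbT⟩
    · rcases (memST b).2 ⟨hxb.symm, hyb.symm⟩ with hbS | hbT
      · exact ⟨T, S, hT, hS, hST.symm, by rwa [union_comm], xT, xS, haT, hbS⟩
      · exact (notboth T S hT hS hSn hST.symm (fun z => by rw [union_comm]; exact memST z)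
          haT hbT).elim
  obtain ⟨f, hf, hfi, hfr, hfa, hfb⟩ := arc (Y := I) (a := ⟨a, haI⟩) (b := ⟨b, hbI⟩)
    (fun e => hab (congrArg Subtype.val e)) (fun x hxa hxb => by
      have hxU : x.1 ∈ U := by
        rcases x.2 with h | h | h
        · exact (hxa (Subtype.ext h)).elim
        · exact (hxb (Subtype.ext h)).elim
        · exact h
      obtain ⟨A, B, hA, hB, hAB, hcov, hxA, hxB, haA, hbB⟩ := sep x.1 hxU
      refine ⟨Subtype.val ⁻¹' A, Subtype.val ⁻¹' B, hA.preimage continuous_subtype_val,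
        hB.preimage continuous_subtype_val, hAB.preimage _, ?_, haA, hbB⟩
      ext z
      constructor
      · rintro (hz | hz) e
        · have e' : z = x := e
          rw [e'] at hz; exact hxA hz
        · have e' : z = x := e
          rw [e'] at hz; exact hxB hz
      · intro hz
        exact hcov ⟨z.2, fun e => hz (Subtype.ext e)⟩)
  let k : X → ℝ := fun x => if h : x ∈ I then 1 - 2 * f ⟨x, h⟩ else 0
  have hk : ∀ x : I, k x.1 = 1 - 2 * f x := fun x => by simp only [k, dif_pos x.2]
  refine ⟨k, ?_, ?_, ?_, ?_, ?_, ?_⟩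
  · rw [continuousOn_iff_continuous_domRestrict]
    have : I.domRestrict k = fun x => 1 - 2 * f x := funext hk
    rw [this]
    fun_prop
  · intro x hx y hy hxy
    have := hk ⟨x, hx⟩
    have h' := hk ⟨y, hy⟩
    have he : f ⟨x, hx⟩ = f ⟨y, hy⟩ := by
      simp only at this h'
      linarith
    exact congrArg Subtype.val (hfi he)
  · intro x hx
    have h3 := hk ⟨x, hx⟩
    have h4 := hfr ⟨x, hx⟩
    simp only at h3
    constructor <;> linarith [h4.1, h4.2]
  · have := hk ⟨a, haI⟩
    simp only at this
    rw [this, hfa]; norm_num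
  · have := hk ⟨b, hbI⟩
    simp only at this
    rw [this, hfb]; norm_num
  · intro r hr1 hr2
    obtain ⟨x, hx⟩ := mem_range_of_exists_le_of_exists_ge (c := (1 - r) / 2) hf
      ⟨⟨a, haI⟩, by rw [hfa]; linarith⟩ ⟨⟨b, hbI⟩, by rw [hfb]; linarith⟩
    exact ⟨x.1, x.2, by rw [hk, hx]; ring⟩

theorem circ_mem (p q : ℝ) : (!₂[p, q] : EuclideanSpace ℝ (Fin 2)) ∈ Circle1 ↔ p ^ 2 + q ^ 2 = 1 := by
  rw [mem_sphere_zero_iff_norm, ← sq_eq_sq₀ (norm_nonneg _) zero_le_one, EuclideanSpace.norm_sq_eq,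
    Fin.sum_univ_two]
  simp

theorem circle {X : Type*} [TopologicalSpace X] [T2Space X] [SecondCountableTopology X]
    [CompactSpace X] (h1 : ∀ x : X, IsPreconnected ({x}ᶜ : Set X))
    (h2 : ∀ x y : X, x ≠ y → ¬ IsPreconnected (({x}ᶜ : Set X) \ {y})) {a b : X} (hab : a ≠ b) :
    Nonempty (X ≃ₜ Circle1) := by
  classical
  have hop : IsOpen (({a}ᶜ : Set X) \ {b}) := isOpen_compl_singleton.sdiff isClosed_singleton
  obtain ⟨U, V, hU, hV, hUn, hVn, hd, hUV⟩ := split hop (h2 a b hab)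
  obtain ⟨k, kc, ki, kr, ka, kb, ks⟩ := side h1 h2 hab hU hV hUn hVn hd hUV
  obtain ⟨l, lc, li, lr, la, lb, ls⟩ := side h1 h2 hab hV hU hVn hUn hd.symm
    (by rwa [union_comm])
  set I := insert a (insert b U) with hIdef
  set J := insert a (insert b V) with hJdef
  have memUV : ∀ z, z ∈ U ∪ V ↔ z ≠ a ∧ z ≠ b := fun z => by rw [hUV]; rfl
  have hIV : ∀ z, z ∈ I ↔ z ∉ V := fun z => by
    have := memUV z
    have hdz : z ∈ U → z ∉ V := fun h => disjoint_left.1 hd h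
    simp only [I, mem_union, mem_insert_iff] at this ⊢
    grind
  have hJU : ∀ z, z ∈ J ↔ z ∉ U := fun z => by
    have := memUV z
    have hdz : z ∈ U → z ∉ V := fun h => disjoint_left.1 hd h
    simp only [J, mem_union, mem_insert_iff] at this ⊢
    grind
  have hIc : IsClosed I := by
    have : I = Vᶜ := by ext z; exact hIV z
    rw [this]; exact hV.isClosed_compl
  have hJc : IsClosed J := by
    have : J = Uᶜ := by ext z; exact hJU z
    rw [this]; exact hU.isClosed_compl
  have hIJ : I ∪ J = univ := by
    rw [eq_univ_iff_forall]
    intro z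
    by_cases hz : z ∈ V
    · exact Or.inr (Or.inr (Or.inr hz))
    · exact Or.inl ((hIV z).2 hz)
  have hboth : ∀ z, z ∈ I → z ∈ J → z = a ∨ z = b := fun z h1 h2 => by
    by_contra hcon
    push Not at hcon
    rcases (memUV z).2 hcon with h | h
    · exact (hJU z).1 h2 h
    · exact (hIV z).1 h1 h
  let c : X → ℝ := fun x => if x ∈ I then k x else l x
  let s : X → ℝ := fun x => if x ∈ I then √(1 - k x ^ 2) else -√(1 - l x ^ 2)
  have cI : ∀ x ∈ I, c x = k x := fun x hx => if_pos hx
  have sI : ∀ x ∈ I, s x = √(1 - k x ^ 2) := fun x hx => if_pos hx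
  have cJ : ∀ x ∈ J, c x = l x := fun x hx => by
    by_cases hxI : x ∈ I
    · rw [cI x hxI]
      rcases hboth x hxI hx with rfl | rfl
      · rw [ka, la]
      · rw [kb, lb]
    · exact if_neg hxI
  have sJ : ∀ x ∈ J, s x = -√(1 - l x ^ 2) := fun x hx => by
    by_cases hxI : x ∈ I
    · rw [sI x hxI]
      rcases hboth x hxI hx with rfl | rfl
      · rw [ka, la]; simp
      · rw [kb, lb]; simp
    · exact if_neg hxI
  have cc : Continuous c := by
    rw [← continuousOn_univ, ← hIJ]
    exact (kc.congr cI).union_of_isClosed (lc.congr cJ) hIc hJc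
  have sc : Continuous s := by
    rw [← continuousOn_univ, ← hIJ]
    refine ContinuousOn.union_of_isClosed (ContinuousOn.congr ?_ sI) (ContinuousOn.congr ?_ sJ)
      hIc hJc
    · exact (continuousOn_const.sub (kc.pow 2)).sqrt
    · exact (continuousOn_const.sub (lc.pow 2)).sqrt.neg
  have cov : ∀ x, x ∈ I ∨ x ∈ J := fun x => by
    have : x ∈ I ∪ J := hIJ ▸ mem_univ x
    exact this
  have cs : ∀ x, c x ^ 2 + s x ^ 2 = 1 := fun x => by
    rcases cov x with hx | hx
    · rw [cI x hx, sI x hx, Real.sq_sqrt]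
      · ring
      · have := kr x hx; nlinarith
    · rw [cJ x hx, sJ x hx, neg_sq, Real.sq_sqrt]
      · ring
      · have := lr x hx; nlinarith
  let Φ : X → Circle1 := fun x => ⟨!₂[c x, s x], (circ_mem _ _).2 (cs x)⟩
  have hΦ : Continuous Φ := by
    refine Continuous.subtype_mk ?_ _
    refine (PiLp.continuous_toLp 2 _).comp (continuous_pi fun i => ?_)
    fin_cases i
    · exact cc
    · exact sc
  -- a point of `I` and a point of `J` with the same image
  have mixed : ∀ x ∈ I, ∀ y ∈ J, c x = c y → s x = s y → x = y := by
    intro x hx y hy hc hs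
    have h0 : s x = 0 := by
      have p1 : 0 ≤ s x := by rw [sI x hx]; exact Real.sqrt_nonneg _
      have p2 : s y ≤ 0 := by rw [sJ y hy]; exact neg_nonpos.2 (Real.sqrt_nonneg _)
      linarith
    have h3 := cs x
    rw [h0] at h3
    have h4 : c x = 1 ∨ c x = -1 := by
      have : (c x - 1) * (c x + 1) = 0 := by linear_combination h3
      rcases mul_eq_zero.1 this with h | h
      · left; linarith
      · right; linarith
    rcases h4 with h4 | h4
    · have ex : x = a := ki hx (Or.inl rfl) (by rw [← cI x hx, h4, ka])
      have ey : y = a := li hy (Or.inl rfl) (by rw [← cJ y hy, ← hc, h4, la])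
      rw [ex, ey]
    · have ex : x = b := ki hx (Or.inr (Or.inl rfl)) (by rw [← cI x hx, h4, kb])
      have ey : y = b := li hy (Or.inr (Or.inl rfl)) (by rw [← cJ y hy, ← hc, h4, lb])
      rw [ex, ey]
  have hinj : Function.Injective Φ := by
    intro x y hxy
    have hv : (!₂[c x, s x] : EuclideanSpace ℝ (Fin 2)) = !₂[c y, s y] := congrArg Subtype.val hxy
    have hc : c x = c y := by simpa using congrArg (fun v => v 0) hv
    have hs : s x = s y := by simpa using congrArg (fun v => v 1) hv
    rcases cov x with hx | hx <;> rcases cov y with hy | hy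
    · exact ki hx hy (by rw [← cI x hx, ← cI y hy, hc])
    · exact mixed x hx y hy hc hs
    · exact (mixed y hy x hx hc.symm hs.symm).symm
    · exact li hx hy (by rw [← cJ x hx, ← cJ y hy, hc])
  have hsurj : Function.Surjective Φ := by
    rintro ⟨v, hv⟩
    have hve : v = !₂[v 0, v 1] := by
      ext i; fin_cases i <;> simp
    have hn : v 0 ^ 2 + v 1 ^ 2 = 1 := by rw [← circ_mem, ← hve]; exact hv
    have b1 : -1 ≤ v 0 := by nlinarith [sq_nonneg (v 1)]
    have b2 : v 0 ≤ 1 := by nlinarith [sq_nonneg (v 1)]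
    have hsq : 1 - v 0 ^ 2 = v 1 ^ 2 := by linarith
    rcases le_total 0 (v 1) with h | h
    · obtain ⟨x, hx, e⟩ := ks _ b1 b2
      refine ⟨x, Subtype.ext ?_⟩
      show !₂[c x, s x] = v
      rw [cI x hx, sI x hx, e, hsq, Real.sqrt_sq h, ← hve]
    · obtain ⟨x, hx, e⟩ := ls _ b1 b2
      refine ⟨x, Subtype.ext ?_⟩
      show !₂[c x, s x] = v
      rw [cJ x hx, sJ x hx, e, hsq, Real.sqrt_sq_eq_abs, abs_of_nonpos h, neg_neg, ← hve]
  exact ⟨Continuous.homeoOfEquivCompactToT2 (f := Equiv.ofBijective Φ ⟨hinj, hsurj⟩) hΦ⟩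

end KK

end

/-- A periodic orientation-reversing homeomorphism of the 2-sphere with at least one
fixed point has fixed point set an embedded circle, i.e. the set of fixed points (with
its subspace topology) is homeomorphic to a circle. -/
theorem fixed_point_set_of_periodic_orientation_reversing_homeo
    (F : Sphere2 ≃ₜ Sphere2) (n : ℕ) (hn : 1 ≤ n)
    (hper : ∀ x : Sphere2, F^[n] x = x)
    (hor : OrientReversing F)
    (x₀ : Sphere2) (hx₀ : F x₀ = x₀) :
    Nonempty ({x : Sphere2 // F x = x} ≃ₜ Circle1) := by
  have hind : Topology.IsInducing (Subtype.val : {x : Sphere2 // F x = x} → Sphere2) := ⟨rfl⟩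
  have hcl : IsClosed {x : Sphere2 | F x = x} := isClosed_eq F.continuous continuous_id
  have : CompactSpace {x : Sphere2 // F x = x} := isCompact_iff_compactSpace.mp hcl.isCompact
  have e1 : ∀ x : {x : Sphere2 // F x = x},
      Subtype.val '' ({x}ᶜ : Set {x : Sphere2 // F x = x}) = {z | F z = z} \ {x.1} := by
    intro x
    ext z
    constructor
    · rintro ⟨w, hw, rfl⟩
      exact ⟨w.2, fun h => hw (Subtype.ext h)⟩
    · rintro ⟨h1, h2⟩
      exact ⟨⟨z, h1⟩, fun h => h2 (congrArg Subtype.val h), rfl⟩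
  have e2 : ∀ x y : {x : Sphere2 // F x = x},
      Subtype.val '' (({x}ᶜ : Set {x : Sphere2 // F x = x}) \ {y})
        = ({z | F z = z} \ {x.1}) \ {y.1} := by
    intro x y
    rw [Set.image_sdiff Subtype.val_injective, e1, Set.image_singleton]
  obtain ⟨⟨b, hb1, hb2⟩, -⟩ := KK.fix_data hn hper hor hx₀
  refine KK.circle (a := ⟨x₀, hx₀⟩) (b := ⟨b, hb1⟩) ?_ ?_ ?_
  · intro x
    rw [← hind.isPreconnected_image, e1]
    exact (KK.fix_data hn hper hor x.2).2.1
  · intro x y hxy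
    rw [← hind.isPreconnected_image, e2]
    exact (KK.fix_data hn hper hor x.2).2.2 y.1 y.2 (fun h => hxy (Subtype.ext h.symm))
  · intro h
    exact hb2 (congrArg Subtype.val h).symm
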